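/- arXiv:1708.05902 — 5 statements merged into one kernel-verified Lean document; each statement's English description precedes it below -/
import Mathlib

section
/- If G is a connected finite simple graph of order at least 3, then χ'_g(G) ≤ 2(Δ(G) + col(G)) − 5, where Δ(G) is the maximum degree of G. -/
open Finset SimpleGraph

/-- A `𝒢`-twin edge coloring of `G`: a proper edge labeling `f : E(G) → 𝒢` such that
the induced weighted degrees `w(v) = ∑_{u ∈ N(v)} f(uv)` differ on adjacent vertices. -/
def IsTwinEdgeColoring {V : Type} [Fintype V] (G : SimpleGraph V) [DecidableRel G.Adj]
    {A : Type} [AddCommGroup A] (f : Sym2 V → A) : Prop :=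
  (∀ u v w : V, G.Adj u v → G.Adj u w → v ≠ w → f s(u, v) ≠ f s(u, w)) ∧
  (∀ u v : V, G.Adj u v →
    ∑ x ∈ G.neighborFinset u, f s(x, u) ≠ ∑ x ∈ G.neighborFinset v, f s(x, v))

/-- The set of integers `k ≥ 2` such that for every Abelian group `𝒢` of order `k`
there exists a `𝒢`-twin edge coloring of `G`.  The group twin chromatic index
`χ'_g(G)` is the least element of this set. -/
def TwinSet {V : Type} [Fintype V] (G : SimpleGraph V) [DecidableRel G.Adj] : Set ℕ :=
  {k | 2 ≤ k ∧ ∀ (A : Type) [AddCommGroup A] [Fintype A], Fintype.card A = k →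
      ∃ f : Sym2 V → A, IsTwinEdgeColoring G f}


/-- The coloring number of `G`: the least `k` such that every (induced) subgraph of `G`
has a vertex of degree less than `k`. -/
noncomputable def coloringNumber {V : Type} [Fintype V] (G : SimpleGraph V)
    [DecidableRel G.Adj] : ℕ :=
  sInf {k | ∀ s : Finset V, s.Nonempty → ∃ v ∈ s, (s.filter (fun u => G.Adj v u)).card < k}


section TwinHelpers
set_option linter.unusedSectionVars false
set_option linter.unusedSimpArgs false
open scoped Classical

variable {V : Type} [Fintype V] {A : Type} [AddCommGroup A]

noncomputable def twNb (G : SimpleGraph V) (u : V) : Finset V := univ.filter (fun x => G.Adj u x)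

noncomputable def twWt (G : SimpleGraph V) (f : Sym2 V → A) (u : V) : A :=
  ∑ x ∈ twNb G u, f s(u, x)

def twProper (G : SimpleGraph V) (f : Sym2 V → A) : Prop :=
  ∀ u v w : V, G.Adj u v → G.Adj u w → v ≠ w → f s(u, v) ≠ f s(u, w)

def twDel (G : SimpleGraph V) (v : V) (L : Finset V) : SimpleGraph V where
  Adj a b := G.Adj a b ∧ ¬ (a = v ∧ b ∈ L) ∧ ¬ (b = v ∧ a ∈ L)
  symm := ⟨fun _ _ h => ⟨h.1.symm, h.2.2, h.2.1⟩⟩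
  loopless := ⟨fun a h => G.loopless.irrefl a h.1⟩

noncomputable def twExt (f' : Sym2 V → A) (c : V → A) (v : V) (L : Finset V) : Sym2 V → A :=
  Sym2.lift ⟨fun a b => if a = v ∧ b ∈ L then c b else if b = v ∧ a ∈ L then c a else f' s(a, b), by
    intro a b
    dsimp only
    split_ifs with h1 h2 h2
    · rw [h1.1, h2.1]
    · rfl
    · rfl
    · rw [Sym2.eq_swap]⟩

lemma twExt_mk (f' : Sym2 V → A) (c : V → A) (v : V) (L : Finset V) (a b : V) :
    twExt f' c v L s(a, b) =
      if a = v ∧ b ∈ L then c b else if b = v ∧ a ∈ L then c a else f' s(a, b) := rfl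

lemma mem_twNb {G : SimpleGraph V} {u x : V} : x ∈ twNb G u ↔ G.Adj u x := by simp [twNb]

lemma twNb_mem_L {G : SimpleGraph V} {v : V} {L : Finset V} (hL : L ⊆ twNb G v) {u : V}
    (hu : u ∈ L) : twNb G u = insert v (twNb (twDel G v L) u) ∧ v ∉ twNb (twDel G v L) u := by
  have hvu : G.Adj v u := mem_twNb.1 (hL hu)
  constructor
  · ext x
    simp only [mem_insert, mem_twNb, twDel]
    constructor
    · intro h
      by_cases hx : x = v
      · exact Or.inl hx
      · exact Or.inr ⟨h, fun h' => hvu.ne h'.1.symm, fun h' => hx h'.1⟩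
    · rintro (rfl | h)
      · exact hvu.symm
      · exact h.1
  · simp [mem_twNb, twDel, hu]

lemma twNb_other {G : SimpleGraph V} {v : V} {L : Finset V} {u : V} (hu : u ∉ L) (huv : u ≠ v) :
    twNb (twDel G v L) u = twNb G u := by
  ext x; simp [mem_twNb, twDel, hu, huv]

lemma twNb_center {G : SimpleGraph V} {v : V} {L : Finset V} (hL : L ⊆ twNb G v) :
    twNb (twDel G v L) v = twNb G v \ L := by
  have : v ∉ L := fun h => G.loopless.irrefl v (mem_twNb.1 (hL h))
  ext x; simp [mem_twNb, twDel, this]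

lemma twWt_other {G : SimpleGraph V} {v : V} {L : Finset V} (hL : L ⊆ twNb G v) {u : V}
    (huv : u ≠ v) (f' : Sym2 V → A) (c : V → A) :
    twWt G (twExt f' c v L) u = twWt (twDel G v L) f' u + if u ∈ L then c u else 0 := by
  by_cases hu : u ∈ L
  · obtain ⟨h1, h2⟩ := twNb_mem_L hL hu
    unfold twWt
    rw [h1, sum_insert h2, if_pos hu, add_comm, twExt_mk, if_neg (fun h => huv h.1),
      if_pos ⟨rfl, hu⟩]
    congr 1
    apply sum_congr rfl
    intro x hx
    rw [twExt_mk, if_neg (fun h => huv h.1), if_neg]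
    rintro ⟨rfl, -⟩
    exact h2 hx
  · unfold twWt
    rw [twNb_other hu huv, if_neg hu, add_zero]
    apply sum_congr rfl
    intro x hx
    rw [twExt_mk, if_neg (fun h => huv h.1), if_neg (fun h => hu h.2)]

lemma twWt_center {G : SimpleGraph V} {v : V} {L : Finset V} (hL : L ⊆ twNb G v)
    (f' : Sym2 V → A) (c : V → A) :
    twWt G (twExt f' c v L) v = twWt (twDel G v L) f' v + ∑ u ∈ L, c u := by
  have hv : v ∉ L := fun h => G.loopless.irrefl v (mem_twNb.1 (hL h))
  unfold twWt
  rw [twNb_center hL, ← sum_sdiff hL]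
  congr 1
  · apply sum_congr rfl
    intro x hx
    rw [mem_sdiff] at hx
    rw [twExt_mk, if_neg (fun h => hx.2 h.2), if_neg (fun h => hv h.2)]
  · apply sum_congr rfl
    intro x hx
    rw [twExt_mk, if_pos ⟨rfl, hx⟩]

lemma twProper_ext {G : SimpleGraph V} {v : V} {L : Finset V} (hL : L ⊆ twNb G v)
    {f' : Sym2 V → A} {c : V → A} (hf : twProper (twDel G v L) f')
    (hinj : ∀ a ∈ L, ∀ b ∈ L, a ≠ b → c a ≠ c b)
    (h1 : ∀ u ∈ L, ∀ z, (twDel G v L).Adj u z → c u ≠ f' s(u, z))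
    (h2 : ∀ u ∈ L, ∀ z, (twDel G v L).Adj v z → c u ≠ f' s(v, z)) :
    twProper G (twExt f' c v L) := by
  have hv : v ∉ L := fun h => G.loopless.irrefl v (mem_twNb.1 (hL h))
  intro a b e hab hae hbe
  rw [twExt_mk, twExt_mk]
  by_cases ha : a = v
  · subst ha
    by_cases hb : b ∈ L <;> by_cases he : e ∈ L
    · simpa [hb, he] using hinj b hb e he hbe
    · simpa [hb, he, hv] using h2 b hb e ⟨hae, by simp [he], by simp [hv]⟩
    · simpa [hb, he, hv] using (h2 e he b ⟨hab, by simp [hb], by simp [hv]⟩).symm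
    · simpa [hb, he, hv] using hf a b e ⟨hab, by simp [hb], by simp [hv]⟩
        ⟨hae, by simp [he], by simp [hv]⟩ hbe
  · by_cases haL : a ∈ L
    · by_cases hb : b = v
      · subst hb
        simpa [ha, haL, hbe.symm] using h1 a haL e ⟨hae, by simp [ha], by simp [hbe.symm]⟩
      · by_cases he : e = v
        · subst he
          simpa [ha, haL, hbe] using (h1 a haL b ⟨hab, by simp [ha], by simp [hbe]⟩).symm
        · simpa [ha, haL, hb, he] using hf a b e ⟨hab, by simp [ha], by simp [hb]⟩
            ⟨hae, by simp [ha], by simp [he]⟩ hbe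
    · simpa [ha, haL] using hf a b e ⟨hab, by simp [ha], by simp [haL]⟩
            ⟨hae, by simp [ha], by simp [haL]⟩ hbe

lemma twDel_lt {G : SimpleGraph V} {v : V} {L : Finset V} (hL : L ⊆ twNb G v)
    (hne : L.Nonempty) : twDel G v L < G := by
  refine lt_of_le_of_ne (fun a b h => h.1) ?_
  intro h
  obtain ⟨u, hu⟩ := hne
  have h1 : (twDel G v L).Adj v u := by rw [h]; exact mem_twNb.1 (hL hu)
  exact h1.2.1 ⟨rfl, hu⟩

lemma twNb_mono {G H : SimpleGraph V} (h : G ≤ H) (u : V) : twNb G u ⊆ twNb H u := by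
  intro x hx; rw [mem_twNb] at *; exact h hx

def twDegen (G : SimpleGraph V) (d : ℕ) : Prop :=
  ∀ s : Finset V, s.Nonempty → ∃ v ∈ s, (s.filter (fun u => G.Adj v u)).card ≤ d

lemma twDegen_mono {G H : SimpleGraph V} (h : G ≤ H) {d : ℕ} (hd : twDegen H d) :
    twDegen G d := by
  intro s hs
  obtain ⟨v, hv, hc⟩ := hd s hs
  refine ⟨v, hv, le_trans (card_le_card ?_) hc⟩
  intro x hx
  rw [mem_filter] at *
  exact ⟨hx.1, h hx.2⟩

/-- sequential selection -/
lemma twSel [Fintype A] (B : ℕ → (ℕ → A) → Finset A)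
    (hB : ∀ i x y, (∀ j < i, x j = y j) → B i x = B i y)
    (n : ℕ) (hc : ∀ i < n, ∀ x, (B i x).card < Fintype.card A) :
    ∃ x : ℕ → A, ∀ i < n, x i ∉ B i x := by
  induction n with
  | zero => exact ⟨fun _ => 0, fun i hi => absurd hi (Nat.not_lt_zero i)⟩
  | succ n ih =>
    obtain ⟨x, hx⟩ := ih (fun i hi => hc i (by omega))
    obtain ⟨a, ha⟩ : ∃ a, a ∉ B n x := by
      by_contra! h
      have : B n x = univ := by ext; simp [h]
      have h2 := hc n (by omega) x
      rw [this, card_univ] at h2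
      omega
    refine ⟨Function.update x n a, fun i hi => ?_⟩
    have hcg : B i (Function.update x n a) = B i x := by
      apply hB
      intro j hj
      rw [Function.update_of_ne (by omega)]
    rw [hcg]
    by_cases hin : i = n
    · subst hin; simpa using ha
    · rw [Function.update_of_ne hin]; exact hx i (by omega)

lemma twSeq [Fintype A] (n : ℕ) (hn : 1 ≤ n) (p : A) (S : ℕ → (ℕ → A) → Finset A)
    (hS : ∀ i x y, (∀ j < i, x j = y j) → S i x = S i y)
    (U : ℕ → Prop) [DecidablePred U] (τ : ℕ → A) (T : Finset A)
    (hb : ∀ i < n, ∀ x, (S i x).card + i +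
      (if i + 1 = n then ((range i).filter U).card + T.card else 0) +
      (if i + 2 = n ∧ U (i + 1) then 1 else 0) < Fintype.card A)
    (hbase : n = 1 → U 0 → p ≠ τ 0) :
    ∃ x : ℕ → A, (∀ i < n, x i ∉ S i x) ∧ (∀ i < n, ∀ j < n, i ≠ j → x i ≠ x j) ∧
      (p + ∑ i ∈ range n, x i ∉ T) ∧
      ∀ j < n, U j → p + ∑ i ∈ range n, x i ≠ τ j + x j := by
  let B : ℕ → (ℕ → A) → Finset A := fun i x =>
    S i x ∪ (range i).image x ∪
      (if i + 1 = n then ((range i).filter U).image (fun j => τ j + x j - (p + ∑ k ∈ range i, x k))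
        ∪ T.image (fun t => t - (p + ∑ k ∈ range i, x k)) else ∅) ∪
      (if i + 2 = n ∧ U (i + 1) then {τ (i + 1) - (p + ∑ k ∈ range i, x k)} else ∅)
  obtain ⟨x, hx⟩ := twSel B (by
    intro i x y h
    have h1 : ∑ k ∈ range i, x k = ∑ k ∈ range i, y k :=
      sum_congr rfl (fun k hk => h k (mem_range.1 hk))
    have h2 : (range i).image x = (range i).image y :=
      image_congr (fun k hk => h k (by simpa using hk))
    have h3 : ((range i).filter U).image (fun j => τ j + x j - (p + ∑ k ∈ range i, x k))
      = ((range i).filter U).image (fun j => τ j + y j - (p + ∑ k ∈ range i, y k)) := by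
      apply image_congr
      intro k hk
      have : k < i := by simp at hk; exact hk.1
      simp only [h1, h k this]
    simp only [B]
    rw [hS i x y h, h2, h3, h1]) n (by
    intro i hi x
    refine lt_of_le_of_lt ?_ (hb i hi x)
    refine (card_union_le _ _).trans (Nat.add_le_add ((card_union_le _ _).trans (Nat.add_le_add
      ((card_union_le _ _).trans (Nat.add_le_add le_rfl ?_)) ?_)) ?_)
    · exact card_image_le.trans (by simp)
    · split_ifs
      · exact (card_union_le _ _).trans (Nat.add_le_add card_image_le card_image_le)
      · simp
    · split_ifs <;> simp)
  simp only [B, mem_union, not_or] at hx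
  obtain ⟨m, rfl⟩ : ∃ m, n = m + 1 := ⟨n - 1, by omega⟩
  have hlt : ∀ i < m + 1, ∀ j < i, x j ≠ x i := by
    intro i hi j hj h
    exact (hx i hi).1.1.2 (mem_image.2 ⟨j, mem_range.2 hj, h⟩)
  have hlast := (hx m (by omega)).1.2
  rw [if_pos rfl, mem_union, not_or] at hlast
  refine ⟨x, fun i hi => (hx i hi).1.1.1, ?_, ?_, ?_⟩
  · intro i hi j hj hij
    rcases lt_or_gt_of_ne hij with h | h
    · exact hlt j hj i h
    · exact (hlt i hi j h).symm
  · intro h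
    apply hlast.2
    refine mem_image.2 ⟨_, h, ?_⟩
    rw [sum_range_succ]; abel
  · intro j hj hU h
    rw [sum_range_succ] at h
    by_cases hjm : j = m
    · subst hjm
      have h' : p + ∑ k ∈ range j, x k = τ j := by
        rw [← add_assoc] at h; exact add_right_cancel h
      cases j with
      | zero => exact hbase rfl hU (by simpa using h')
      | succ k =>
        have := (hx k (by omega)).2
        rw [if_pos ⟨rfl, hU⟩, mem_singleton] at this
        apply this
        rw [← h', sum_range_succ]; abel
    · apply hlast.1
      refine mem_image.2 ⟨j, mem_filter.2 ⟨mem_range.2 (by omega), hU⟩, ?_⟩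
      rw [← h]; abel

/-- enumeration -/
lemma twEnum (C L : Finset V) (hd : Disjoint C L) (v : V) :
    ∃ (z : ℕ → V) (idx : V → ℕ), (∀ u ∈ C ∪ L, z (idx u) = u ∧ idx u < C.card + L.card) ∧
      (∀ i < C.card + L.card, idx (z i) = i) ∧
      (∀ i < C.card, z i ∈ C) ∧ (∀ i, C.card ≤ i → i < C.card + L.card → z i ∈ L) := by
  let l := C.toList ++ L.toList
  have hl : l.length = C.card + L.card := by simp [l]
  have hnd : l.Nodup := by
    refine List.Nodup.append C.nodup_toList L.nodup_toList ?_
    intro a ha hb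
    simp at ha hb
    exact (disjoint_left.1 hd) ha hb
  refine ⟨fun i => l.getD i v, fun u => l.idxOf u, ?_, ?_, ?_, ?_⟩
  · intro u hu
    have hm : u ∈ l := by simpa [l] using hu
    have := List.idxOf_lt_length_of_mem hm
    refine ⟨?_, by show l.idxOf u < _; omega⟩
    show l.getD (l.idxOf u) v = u
    rw [List.getD_eq_getElem _ _ this]
    exact List.getElem_idxOf this
  · intro i hi
    have : i < l.length := by omega
    simp only [List.getD_eq_getElem _ _ this]
    exact hnd.idxOf_getElem i this
  · intro i hi
    have : i < l.length := by omega
    simp only [List.getD_eq_getElem _ _ this]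
    have h2 : i < C.toList.length := by simpa using hi
    simp only [l]
    rw [List.getElem_append_left h2]
    exact Finset.mem_toList.1 (List.getElem_mem h2)
  · intro i hi hi2
    have : i < l.length := by omega
    simp only [List.getD_eq_getElem _ _ this]
    have h2 : C.toList.length ≤ i := by simpa using hi
    simp only [l]
    rw [List.getElem_append_right h2]
    have := List.getElem_mem (l := L.toList) (n := i - C.toList.length) (by simp; omega)
    exact Finset.mem_toList.1 this


lemma twCaseI [Fintype A] (D d : ℕ) (hd : 2 ≤ d) (hD : 1 ≤ D) (hK : 2 * D + 2 * d ≤ Fintype.card A + 3)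
    (G : SimpleGraph V) : (∀ u, (twNb G u).card ≤ D) → twDegen G d →
    ∃ f : Sym2 V → A, twProper G f ∧ ∀ a b, G.Adj a b →
      (2 ≤ (twNb G a).card ∨ 2 ≤ (twNb G b).card) → twWt G f a ≠ twWt G f b := by
  induction G using WellFoundedLT.induction with
  | ind G ih =>
  intro hdeg hdgn
  by_cases hs : ((univ : Finset V).filter (fun u => 2 ≤ (twNb G u).card)).Nonempty
  swap
  · have hs' : ∀ u, (twNb G u).card < 2 := by
      intro u
      by_contra h
      exact hs ⟨u, by simp; omega⟩
    refine ⟨fun _ => 0, ?_, ?_⟩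
    · intro u a b ha hb hab
      exfalso
      have := hs' u
      have h2 : 1 < (twNb G u).card :=
        one_lt_card.2 ⟨a, mem_twNb.2 ha, b, mem_twNb.2 hb, hab⟩
      omega
    · intro a b _ h
      have := hs' a
      have := hs' b
      omega
  obtain ⟨v, hv, hvd⟩ := hdgn _ hs
  have hv2 : 2 ≤ (twNb G v).card := by simpa using hv
  set L := twNb G v with hLdef
  have hL : L ⊆ twNb G v := subset_rfl
  have hLne : L.Nonempty := card_pos.1 (by omega)
  have hlt := twDel_lt hL hLne
  set G' := twDel G v L with hG'
  obtain ⟨f', hf'p, hf'w⟩ := ih G' hlt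
    (fun u => (card_le_card (twNb_mono hlt.le u)).trans (hdeg u)) (twDegen_mono hlt.le hdgn)
  have hvL : v ∉ L := fun h => G.loopless.irrefl v (mem_twNb.1 (hL h))
  have hcardL : ∀ u ∈ L, (twNb G u).card = (twNb G' u).card + 1 := by
    intro u hu
    obtain ⟨h1, h2⟩ := twNb_mem_L hL hu
    rw [h1, card_insert_of_notMem h2]
  let P : V → Prop := fun u => 2 ≤ (twNb G u).card
  obtain ⟨z, idx, hz1, hz2, hzC, hzL⟩ := twEnum (L.filter P) (L.filter (fun u => ¬ P u))
    (disjoint_filter_filter_not _ _ _) v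
  rw [filter_union_filter_not_eq] at hz1
  have hcs : (L.filter P).card + (L.filter (fun u => ¬ P u)).card = L.card :=
    card_filter_add_card_filter_not _
  rw [hcs] at hz1 hz2 hzL
  have hCd : (L.filter P).card ≤ d := by
    refine le_trans (card_le_card ?_) hvd
    intro x hx
    simp only [mem_filter, mem_univ, true_and, P, hLdef, mem_twNb] at hx ⊢
    exact ⟨hx.2, hx.1⟩
  set t := (L.filter P).card
  have hzmem : ∀ i < L.card, z i ∈ L := by
    intro i hi
    by_cases h : i < t
    · exact (mem_filter.1 (hzC i h)).1
    · exact (mem_filter.1 (hzL i (by omega) hi)).1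
  let S : ℕ → (ℕ → A) → Finset A := fun i x =>
    (twNb G' (z i)).image (fun y => f' s(z i, y)) ∪
    (twNb G' (z i)).image (fun y => twWt G' f' y +
      (if y ∈ L ∧ idx y < i then x (idx y) else 0) - twWt G' f' (z i))
  have hScard : ∀ i x, (S i x).card ≤ (twNb G' (z i)).card + (twNb G' (z i)).card := fun i x =>
    (card_union_le _ _).trans (Nat.add_le_add card_image_le card_image_le)
  have hLD : L.card ≤ D := hdeg v
  obtain ⟨x, hx1, hx2, -, hx4⟩ := twSeq L.card (by omega) (0 : A) S (by
    intro i x y h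
    simp only [S]
    congr 1
    apply image_congr
    intro w _
    dsimp only
    split_ifs with h1
    · rw [h _ h1.2]
    · rfl) (fun _ => True) (fun j => twWt G' f' (z j)) ∅ (by
    intro i hi x
    have h1 := hScard i x
    have h2 := hcardL _ (hzmem i hi)
    have h3 := hdeg (z i)
    have h4 : ((range i).filter (fun _ => True)).card = i := by simp
    rw [h4]
    simp only [card_empty, and_true]
    by_cases h : i < t
    · split_ifs <;> omega
    · have h5 := (mem_filter.1 (hzL i (by omega) hi)).2
      simp only [P] at h5
      split_ifs <;> omega) (by omega)
  have hxS : ∀ u ∈ L, x (idx u) ∉ S (idx u) x := fun u hu => hx1 _ (hz1 u hu).2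
  have hinj : ∀ a ∈ L, ∀ b ∈ L, a ≠ b → x (idx a) ≠ x (idx b) := by
    intro a ha b hb hab
    apply hx2 _ (hz1 a ha).2 _ (hz1 b hb).2
    intro h
    apply hab
    rw [← (hz1 a ha).1, ← (hz1 b hb).1, h]
  have hsum : ∑ i ∈ range L.card, x i = ∑ u ∈ L, x (idx u) := by
    symm
    apply sum_bij (fun u _ => idx u)
    · intro u hu; exact mem_range.2 (hz1 u hu).2
    · intro a ha b hb h
      rw [← (hz1 a ha).1, ← (hz1 b hb).1, h]
    · intro i hi
      have hi := mem_range.1 hi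
      exact ⟨z i, hzmem i hi, hz2 i hi⟩
    · intro u _; rfl
  have hnv : ∀ w, ¬ G'.Adj v w := by
    intro w hw
    exact hw.2.1 ⟨rfl, mem_twNb.2 hw.1⟩
  have hwv : twWt G' f' v = 0 := by
    unfold twWt
    apply sum_eq_zero
    intro w hw
    exact absurd (mem_twNb.1 hw) (hnv w)
  have hc : ∀ u ∈ L, ∑ w ∈ L, x (idx w) ≠ twWt G' f' u + x (idx u) := by
    intro u hu
    have h := hx4 _ (hz1 u hu).2 trivial
    rw [(hz1 u hu).1, hsum, zero_add] at h
    exact h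
  have hb : ∀ a ∈ L, ∀ b, G'.Adj a b → twWt G' f' a + x (idx a) ≠
      twWt G' f' b + (if b ∈ L then x (idx b) else 0) := by
    have key : ∀ a ∈ L, ∀ b, G'.Adj a b → (b ∈ L → idx b < idx a) → twWt G' f' a + x (idx a) ≠
      twWt G' f' b + (if b ∈ L then x (idx b) else 0) := by
      intro a ha b hab hlt' he
      apply hxS a ha
      refine mem_union_right _ (mem_image.2 ⟨b, ?_, ?_⟩)
      · rw [(hz1 a ha).1]; exact mem_twNb.2 hab
      · rw [(hz1 a ha).1]
        have : (if b ∈ L ∧ idx b < idx a then x (idx b) else 0) =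
            (if b ∈ L then x (idx b) else 0) := by
          by_cases hbL : b ∈ L
          · simp [hbL, hlt' hbL]
          · simp [hbL]
        rw [this, ← he]; abel
    intro a ha b hab
    by_cases hbL : b ∈ L
    · rcases lt_trichotomy (idx a) (idx b) with h | h | h
      · have := key b hbL a hab.symm (fun _ => h)
        rw [if_pos ha] at this
        rw [if_pos hbL]
        exact this.symm
      · exfalso
        apply hab.ne
        rw [← (hz1 a ha).1, ← (hz1 b hbL).1, h]
      · exact key a ha b hab (fun _ => h)
    · exact key a ha b hab (fun h => absurd h hbL)
  refine ⟨twExt f' (fun u => x (idx u)) v L, ?_, ?_⟩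
  · apply twProper_ext hL hf'p hinj
    · intro u hu w hw h
      apply hxS u hu
      refine mem_union_left _ (mem_image.2 ⟨w, ?_, ?_⟩)
      · rw [(hz1 u hu).1]; exact mem_twNb.2 hw
      · rw [(hz1 u hu).1]; exact h.symm
    · intro u _ w hw
      exact absurd hw (hnv w)
  · have hvu : ∀ b, G.Adj v b → twWt G (twExt f' (fun u => x (idx u)) v L) v ≠
        twWt G (twExt f' (fun u => x (idx u)) v L) b := by
      intro b hb
      have hbL : b ∈ L := mem_twNb.2 hb
      rw [twWt_center hL, twWt_other hL hb.ne', if_pos hbL]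
      rw [hwv, zero_add]
      exact hc b hbL
    intro a b hab h2
    by_cases hav : a = v
    · subst hav; exact hvu b hab
    by_cases hbv : b = v
    · subst hbv; exact (hvu a hab.symm).symm
    have hab' : G'.Adj a b := ⟨hab, fun h => hav h.1, fun h => hbv h.1⟩
    rw [twWt_other hL hav, twWt_other hL hbv]
    by_cases haL : a ∈ L
    · have := hb a haL b hab'
      simpa only [if_pos haL] using this
    · by_cases hbL : b ∈ L
      · have := (hb b hbL a hab'.symm).symm
        simpa only [if_pos hbL] using this
      · simp only [if_neg haL, if_neg hbL, add_zero]
        apply hf'w a b hab'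
        rw [twNb_other haL hav, twNb_other hbL hbv]
        exact h2


lemma twCaseII [Fintype A] (D : ℕ) (hD : 3 ≤ D) (hK : 2 * D ≤ Fintype.card A + 1)
    (G : SimpleGraph V) : (∀ u, (twNb G u).card ≤ D) → twDegen G 1 →
    ∀ M : V → Prop, (∀ u, M u → (twNb G u).card ≤ 1) →
    ∃ f : Sym2 V → A, twProper G f ∧ (∀ u y, M u → G.Adj u y → f s(u, y) ≠ 0) ∧
      ∀ a b, G.Adj a b → ¬ M a → ¬ M b →
      (2 ≤ (twNb G a).card ∨ 2 ≤ (twNb G b).card) → twWt G f a ≠ twWt G f b := by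
  induction G using WellFoundedLT.induction with
  | ind G ih =>
  intro hdeg hdgn M hM
  by_cases hs : ((univ : Finset V).filter (fun u => 2 ≤ (twNb G u).card)).Nonempty
  swap
  · have hs' : ∀ u, (twNb G u).card < 2 := by
      intro u
      by_contra h
      exact hs ⟨u, by simp; omega⟩
    have : Nontrivial A := Fintype.one_lt_card_iff_nontrivial.1 (by omega)
    obtain ⟨e, he⟩ := exists_ne (0 : A)
    refine ⟨fun _ => e, ?_, fun _ _ _ _ => he, ?_⟩
    · intro u a b ha hb hab
      exfalso
      have := hs' u
      have h2 : 1 < (twNb G u).card :=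
        one_lt_card.2 ⟨a, mem_twNb.2 ha, b, mem_twNb.2 hb, hab⟩
      omega
    · intro a b _ _ _ h
      have := hs' a
      have := hs' b
      omega
  obtain ⟨v, hv, hvd⟩ := hdgn _ hs
  have hv2 : 2 ≤ (twNb G v).card := by simpa using hv
  obtain ⟨y, hy, hyl⟩ : ∃ y ∈ twNb G v, ∀ u ∈ twNb G v, u ≠ y → (twNb G u).card ≤ 1 := by
    by_cases h : ∃ y ∈ twNb G v, 2 ≤ (twNb G y).card
    · obtain ⟨y, hy, hy2⟩ := h
      refine ⟨y, hy, fun u hu huy => ?_⟩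
      by_contra hu2
      apply huy
      refine card_le_one.1 hvd u ?_ y ?_
      · simp only [mem_filter, mem_univ, true_and]
        exact ⟨by omega, mem_twNb.1 hu⟩
      · simp only [mem_filter, mem_univ, true_and]
        exact ⟨hy2, mem_twNb.1 hy⟩
    · push Not at h
      obtain ⟨y, hy⟩ : (twNb G v).Nonempty := card_pos.1 (by omega)
      exact ⟨y, hy, fun u hu _ => by have := h u hu; omega⟩
  have hvy : G.Adj v y := mem_twNb.1 hy
  set L := (twNb G v).erase y with hLdef
  have hL : L ⊆ twNb G v := erase_subset _ _
  have hLc : L.card + 1 = (twNb G v).card := card_erase_add_one hy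
  have hLne : L.Nonempty := card_pos.1 (by omega)
  have hyL : y ∉ L := by simp [hLdef]
  have hlt := twDel_lt hL hLne
  set G' := twDel G v L with hG'
  have hvL : v ∉ L := fun h => G.loopless.irrefl v (mem_twNb.1 (hL h))
  have hnv : twNb G' v = {y} := by
    rw [hG', twNb_center hL]
    ext w
    simp only [mem_sdiff, mem_singleton, hLdef, mem_erase]
    constructor
    · rintro ⟨h1, h2⟩
      by_contra h
      exact h2 ⟨h, h1⟩
    · rintro rfl
      exact ⟨hy, by simp⟩
  have hvM : ¬ M v := fun h => by have := hM v h; omega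
  obtain ⟨f', hf'p, hf'M, hf'w⟩ := ih G' hlt
    (fun u => (card_le_card (twNb_mono hlt.le u)).trans (hdeg u)) (twDegen_mono hlt.le hdgn)
    (fun u => M u ∨ u = v) (by
      rintro u (hu | rfl)
      · exact (card_le_card (twNb_mono hlt.le u)).trans (hM u hu)
      · rw [hnv]; simp)
  have hLemp : ∀ u ∈ L, twNb G' u = ∅ := by
    intro u hu
    obtain ⟨h1, h2⟩ := twNb_mem_L hL hu
    have h3 := hyl u (hL hu) (fun h => hyL (h ▸ hu))
    rw [h1, card_insert_of_notMem h2] at h3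
    change (twNb G' u).card + 1 ≤ 1 at h3
    exact card_eq_zero.1 (by omega)
  have hLw : ∀ u ∈ L, twWt G' f' u = 0 := by
    intro u hu
    simp [twWt, hLemp u hu]
  have hvy' : G'.Adj v y := mem_twNb.1 (by rw [hnv]; simp)
  set p := f' s(v, y) with hp
  have hp0 : p ≠ 0 := hf'M v y (Or.inr rfl) hvy'
  have hwv : twWt G' f' v = p := by simp [twWt, hnv, hp]
  obtain ⟨z, idx, hz1, hz2, hzC, hzL⟩ := twEnum (L.filter M) (L.filter (fun u => ¬ M u))
    (disjoint_filter_filter_not _ _ _) v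
  rw [filter_union_filter_not_eq] at hz1
  have hcs : (L.filter M).card + (L.filter (fun u => ¬ M u)).card = L.card :=
    card_filter_add_card_filter_not _
  rw [hcs] at hz1 hz2 hzL
  set t := (L.filter M).card
  have hzmem : ∀ i < L.card, z i ∈ L := by
    intro i hi
    by_cases h : i < t
    · exact (mem_filter.1 (hzC i h)).1
    · exact (mem_filter.1 (hzL i (by omega) hi)).1
  let S : ℕ → (ℕ → A) → Finset A := fun i _ => {p} ∪ (if M (z i) then {0} else ∅)
  have hLD : L.card + 1 ≤ D := by rw [hLc]; exact hdeg v
  obtain ⟨x, hx1, hx2, hx3, hx4⟩ := twSeq L.card (by omega) p S (by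
    intro i x y h
    rfl) (fun j => ¬ M (z j)) (fun j => 0) {twWt G' f' y} (by
    intro i hi x
    have h1 : (S i x).card ≤ 1 + (if M (z i) then 1 else 0) := by
      refine (card_union_le _ _).trans (Nat.add_le_add (by simp) ?_)
      split_ifs <;> simp
    have h4 : ((range i).filter (fun j => ¬ M (z j))).card ≤ i :=
      (card_filter_le _ _).trans (by simp)
    rw [card_singleton]
    by_cases h : i < t
    · have h5 : ((range i).filter (fun j => ¬ M (z j))).card = 0 := by
        rw [card_eq_zero, filter_eq_empty_iff]
        intro j hj
        have := mem_range.1 hj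
        have := (mem_filter.1 (hzC j (by omega))).2
        simpa using this
      rw [h5]
      have : (if M (z i) then 1 else 0) ≤ 1 := by split_ifs <;> simp
      split_ifs at * <;> omega
    · have h5 := (mem_filter.1 (hzL i (by omega) hi)).2
      rw [if_neg h5] at h1
      split_ifs <;> omega) (fun _ _ => hp0)
  have hxS : ∀ u ∈ L, x (idx u) ∉ S (idx u) x := fun u hu => hx1 _ (hz1 u hu).2
  have hinj : ∀ a ∈ L, ∀ b ∈ L, a ≠ b → x (idx a) ≠ x (idx b) := by
    intro a ha b hb hab
    apply hx2 _ (hz1 a ha).2 _ (hz1 b hb).2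
    intro h
    apply hab
    rw [← (hz1 a ha).1, ← (hz1 b hb).1, h]
  have hsum : ∑ i ∈ range L.card, x i = ∑ u ∈ L, x (idx u) := by
    symm
    apply sum_bij (fun u _ => idx u)
    · intro u hu; exact mem_range.2 (hz1 u hu).2
    · intro a ha b hb h
      rw [← (hz1 a ha).1, ← (hz1 b hb).1, h]
    · intro i hi
      have hi := mem_range.1 hi
      exact ⟨z i, hzmem i hi, hz2 i hi⟩
    · intro u _; rfl
  rw [hsum, mem_singleton] at hx3
  have hc : ∀ u ∈ L, ¬ M u → p + ∑ w ∈ L, x (idx w) ≠ x (idx u) := by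
    intro u hu hMu
    have h := hx4 _ (hz1 u hu).2 (by simpa only [(hz1 u hu).1] using hMu)
    rw [hsum, zero_add] at h
    exact h
  refine ⟨twExt f' (fun u => x (idx u)) v L, ?_, ?_, ?_⟩
  · apply twProper_ext hL hf'p hinj
    · intro u hu w hw
      have := mem_twNb.2 hw
      rw [hLemp u hu] at this
      simp at this
    · intro u hu w hw h
      have := mem_twNb.2 hw
      rw [hnv, mem_singleton] at this
      subst this
      apply hxS u hu
      exact mem_union_left _ (mem_singleton.2 h)
  · intro u w hu huw
    rw [twExt_mk]
    have huv : u ≠ v := fun h => hvM (h ▸ hu)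
    rw [if_neg (fun h => huv h.1)]
    split_ifs with h
    · intro h0
      apply hxS u h.2
      refine mem_union_right _ ?_
      rw [(hz1 u h.2).1, if_pos hu]
      exact mem_singleton.2 h0
    · exact hf'M u w (Or.inl hu) ⟨huw, fun h => huv h.1, h⟩
  · have hvu : ∀ b, G.Adj v b → ¬ M b → twWt G (twExt f' (fun u => x (idx u)) v L) v ≠
        twWt G (twExt f' (fun u => x (idx u)) v L) b := by
      intro b hb hMb
      rw [twWt_center hL, twWt_other hL hb.ne', hwv]
      by_cases hbL : b ∈ L
      · rw [if_pos hbL, hLw b hbL, zero_add]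
        exact hc b hbL hMb
      · have hby : b = y := by
          by_contra h
          exact hbL (mem_erase.2 ⟨h, mem_twNb.2 hb⟩)
        subst hby
        rw [if_neg hbL, add_zero]
        exact hx3
    intro a b hab hMa hMb h2
    by_cases hav : a = v
    · subst hav; exact hvu b hab hMb
    by_cases hbv : b = v
    · subst hbv; exact (hvu a hab.symm hMa).symm
    have hab' : G'.Adj a b := ⟨hab, fun h => hav h.1, fun h => hbv h.1⟩
    have haL : a ∉ L := fun h => by
      have := mem_twNb.2 hab'
      rw [hLemp a h] at this
      simp at this
    have hbL : b ∉ L := fun h => by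
      have := mem_twNb.2 hab'.symm
      rw [hLemp b h] at this
      simp at this
    rw [twWt_other hL hav, twWt_other hL hbv, if_neg haL, if_neg hbL, add_zero, add_zero]
    apply hf'w a b hab' (by simp [hMa, hav]) (by simp [hMb, hbv])
    rw [twNb_other haL hav, twNb_other hbL hbv]
    exact h2


lemma twCaseIII [Fintype A] (hK : 3 ≤ Fintype.card A)
    (G : SimpleGraph V) : (∀ u, (twNb G u).card ≤ 2) → twDegen G 1 →
    ∃ f : Sym2 V → A, twProper G f ∧ ∀ a b c e, G.Adj a b → G.Adj b c → G.Adj c e →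
      a ≠ c → b ≠ e → f s(a, b) ≠ f s(c, e) := by
  induction G using WellFoundedLT.induction with
  | ind G ih =>
  intro hdeg hdgn
  by_cases hs : ((univ : Finset V).filter (fun u => 1 ≤ (twNb G u).card)).Nonempty
  swap
  · have hs' : ∀ u w, ¬ G.Adj u w := by
      intro u w h
      exact hs ⟨u, by
        simp only [mem_filter, mem_univ, true_and]
        exact card_pos.2 ⟨w, mem_twNb.2 h⟩⟩
    exact ⟨fun _ => 0, fun u a b ha => absurd ha (hs' _ _),
      fun a b c e ha => absurd ha (hs' _ _)⟩
  obtain ⟨v, hv, hvd⟩ := hdgn _ hs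
  have hv1 : 1 ≤ (twNb G v).card := by simpa using hv
  obtain ⟨u, hu⟩ : (twNb G v).Nonempty := card_pos.1 hv1
  have hvu : G.Adj v u := mem_twNb.1 hu
  have hN : ∀ w, G.Adj v w → w = u := by
    intro w hw
    refine card_le_one.1 hvd w ?_ u ?_
    · simp only [mem_filter, mem_univ, true_and]
      exact ⟨card_pos.2 ⟨v, mem_twNb.2 hw.symm⟩, hw⟩
    · simp only [mem_filter, mem_univ, true_and]
      exact ⟨card_pos.2 ⟨v, mem_twNb.2 hvu.symm⟩, hvu⟩
  have hL : {u} ⊆ twNb G v := by simpa using hu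
  have hlt := twDel_lt hL (singleton_nonempty u)
  have hadj : ∀ a b, G.Adj a b → a ≠ v → b ≠ v → (twDel G v {u}).Adj a b :=
    fun a b h ha hb => ⟨h, fun h => ha h.1, fun h => hb h.1⟩
  have hcu := twNb_mem_L hL (mem_singleton_self u)
  set G' := twDel G v {u} with hG'
  have hcu' : (twNb G' u).card ≤ 1 := by
    have := hdeg u
    rw [hcu.1, card_insert_of_notMem hcu.2] at this
    omega
  have hdeg' : ∀ u, (twNb G' u).card ≤ 2 :=
    fun u => (card_le_card (twNb_mono hlt.le u)).trans (hdeg u)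
  obtain ⟨f', hp, hf⟩ := ih G' hlt hdeg' (twDegen_mono hlt.le hdgn)
  obtain ⟨x, hx⟩ : ∃ x, x ∉ (twNb G' u).image (fun w => f' s(u, w)) ∪
      (twNb G' u).biUnion (fun w => ((twNb G' w).erase u).image (fun e => f' s(w, e))) := by
    by_contra! h
    have h1 := card_le_card (fun a _ => h a : (univ : Finset A) ⊆ _)
    rw [card_univ] at h1
    have h2 := h1.trans (card_union_le _ _)
    have h3 : ((twNb G' u).image (fun w => f' s(u, w))).card ≤ 1 := card_image_le.trans hcu'
    have h4 := card_biUnion_le_card_mul (twNb G' u)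
      (fun w => ((twNb G' w).erase u).image (fun e => f' s(w, e))) 1 (by
        intro w hw
        refine card_image_le.trans ?_
        have := card_erase_add_one (mem_twNb.2 (mem_twNb.1 hw).symm : u ∈ twNb G' w)
        have := hdeg' w
        omega)
    omega
  rw [mem_union, not_or] at hx
  have hx1 : ∀ w, G'.Adj u w → x ≠ f' s(u, w) := fun w hw h =>
    hx.1 (mem_image.2 ⟨w, mem_twNb.2 hw, h.symm⟩)
  have hx2 : ∀ w e, G'.Adj u w → G'.Adj w e → e ≠ u → x ≠ f' s(w, e) := fun w e hw he hne h =>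
    hx.2 (mem_biUnion.2 ⟨w, mem_twNb.2 hw, mem_image.2 ⟨e, mem_erase.2 ⟨hne, mem_twNb.2 he⟩, h.symm⟩⟩)
  have hfv : ∀ a b, a ≠ v → b ≠ v → twExt f' (fun _ => x) v {u} s(a, b) = f' s(a, b) := by
    intro a b ha hb
    rw [twExt_mk, if_neg (fun h => ha h.1), if_neg (fun h => hb h.1)]
  have hfu : twExt f' (fun _ => x) v {u} s(v, u) = x := by simp [twExt_mk]
  have hfu' : twExt f' (fun _ => x) v {u} s(u, v) = x := by rw [Sym2.eq_swap, hfu]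
  refine ⟨twExt f' (fun _ => x) v {u}, ?_, ?_⟩
  · apply twProper_ext hL hp
    · intro a ha b hb hab
      exact absurd ((mem_singleton.1 ha).trans (mem_singleton.1 hb).symm) hab
    · intro a ha w hw
      rw [mem_singleton] at ha
      subst ha
      exact hx1 w hw
    · intro a ha w hw
      exact absurd ⟨rfl, mem_singleton.2 (hN w hw.1)⟩ hw.2.1
  · intro a b c e hab hbc hce hac hbe
    have hbv : b ≠ v := by
      rintro rfl
      exact hac ((hN a hab.symm).trans (hN c hbc).symm)
    have hcv : c ≠ v := by
      rintro rfl
      exact hbe ((hN b hbc.symm).trans (hN e hce).symm)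
    have hbc' := hadj b c hbc hbv hcv
    by_cases ha : a = v
    · subst ha
      obtain rfl := hN b hab
      have hev : e ≠ a := by
        rintro rfl
        exact hbc.ne (hN c hce.symm).symm
      rw [hfu, hfv c e hcv hev]
      exact hx2 c e hbc' (hadj c e hce hcv hev) hbe.symm
    · by_cases he : e = v
      · subst he
        obtain rfl := hN c hce.symm
        rw [hfu', hfv a b ha hbv, Sym2.eq_swap]
        exact (hx2 b a hbc'.symm (hadj b a hab.symm hbv ha) hac).symm
      · rw [hfv a b ha hbv, hfv c e hcv he]
        exact hf a b c e (hadj _ _ hab ha hbv) hbc' (hadj _ _ hce hcv he) hac hbe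

lemma twNoK2 (G : SimpleGraph V) (hconn : G.Connected) (hcard : 3 ≤ Fintype.card V)
    (a b : V) (hab : G.Adj a b) : 2 ≤ (twNb G a).card ∨ 2 ≤ (twNb G b).card := by
  by_contra! h
  obtain ⟨w, hw⟩ : ∃ w, w ∉ ({a, b} : Finset V) := by
    by_contra! h'
    have h1 := card_le_card (fun a _ => h' a : (univ : Finset V) ⊆ _)
    rw [card_univ] at h1
    have := card_le_two (a := a) (b := b)
    omega
  have key : ∀ u w : V, G.Walk u w → (u = a ∨ u = b) → (w = a ∨ w = b) := by
    intro u w p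
    induction p with
    | nil => exact id
    | cons hadj _ ih =>
      intro hu
      apply ih
      rcases hu with rfl | rfl
      · exact Or.inr (card_le_one.1 (by omega) _ (mem_twNb.2 hadj) _ (mem_twNb.2 hab))
      · exact Or.inl (card_le_one.1 (by omega) _ (mem_twNb.2 hadj) _ (mem_twNb.2 hab.symm))
  obtain ⟨p⟩ := hconn.preconnected a w
  have := key a w p (Or.inl rfl)
  simp at hw
  tauto

lemma twPath [Fintype A] (hK : 3 ≤ Fintype.card A)
    (G : SimpleGraph V) (hconn : G.Connected) (hcard : 3 ≤ Fintype.card V)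
    (hdeg : ∀ u, (twNb G u).card ≤ 2) (hdgn : twDegen G 1) :
    ∃ f : Sym2 V → A, twProper G f ∧ ∀ a b, G.Adj a b → twWt G f a ≠ twWt G f b := by
  obtain ⟨f, hp, hf⟩ := twCaseIII hK G hdeg hdgn
  have hdd : ∀ u, G.degree u = (twNb G u).card := by
    intro u
    rw [← card_neighborFinset_eq_degree]
    congr 1
    ext w
    simp [mem_twNb]
  have hpos : ∀ u, 1 ≤ (twNb G u).card := by
    intro u
    have : Nontrivial V := Fintype.one_lt_card_iff_nontrivial.1 (by omega)
    rw [← hdd]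
    exact hconn.preconnected.degree_pos_of_nontrivial u
  have hleaf : ((univ : Finset V).filter (fun u => (twNb G u).card = 1)).card ≤ 2 := by
    have h1 := hconn.card_vert_le_card_edgeSet_add_one
    have h2 := G.sum_degrees_eq_twice_card_edges
    rw [Nat.card_eq_fintype_card, Nat.card_eq_fintype_card, ← edgeFinset_card] at h1
    have h3 : ∑ u, (G.degree u + if (twNb G u).card = 1 then 1 else 0) ≤ ∑ u : V, 2 := by
      apply sum_le_sum
      intro u _
      have := hdeg u
      rw [hdd]
      split_ifs <;> omega
    rw [sum_add_distrib, h2, ← card_filter] at h3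
    simp only [sum_const, card_univ, smul_eq_mul] at h3
    omega
  obtain ⟨s, hs⟩ : ∃ s, s ∉ ((univ : Finset V).filter (fun u => (twNb G u).card = 1)).biUnion
      (fun l => (twNb G l).biUnion (fun u => ((twNb G u).erase l).image (fun w => - f s(u, w)))) := by
    by_contra! h
    have h1 := card_le_card (fun a _ => h a : (univ : Finset A) ⊆ _)
    rw [card_univ] at h1
    have h4 := card_biUnion_le_card_mul
      ((univ : Finset V).filter (fun u => (twNb G u).card = 1))
      (fun l => (twNb G l).biUnion (fun u => ((twNb G u).erase l).image (fun w => - f s(u, w)))) 1 (by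
        intro l hl
        have hl1 : (twNb G l).card = 1 := by simpa using hl
        have h5 := card_biUnion_le_card_mul (twNb G l)
          (fun u => ((twNb G u).erase l).image (fun w => - f s(u, w))) 1 (by
          intro u hu
          refine card_image_le.trans ?_
          have := card_erase_add_one (mem_twNb.2 (mem_twNb.1 hu).symm : l ∈ twNb G u)
          have := hdeg u
          omega)
        omega)
    omega
  have hs' : ∀ l u w, (twNb G l).card = 1 → G.Adj l u → G.Adj u w → w ≠ l → f s(u, w) + s ≠ 0 := by
    intro l u w hl hlu huw hwl h
    apply hs
    refine mem_biUnion.2 ⟨l, by simpa using hl, mem_biUnion.2 ⟨u, mem_twNb.2 hlu, mem_image.2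
      ⟨w, mem_erase.2 ⟨hwl, mem_twNb.2 huw⟩, ?_⟩⟩⟩
    exact neg_eq_of_add_eq_zero_right h
  refine ⟨fun e => f e + s, ?_, ?_⟩
  · intro a b c hab hac hbc h
    exact hp a b c hab hac hbc (add_right_cancel h)
  · have hw : ∀ a b, G.Adj a b → ((twNb G a).card = 1 ∧ twWt G (fun e => f e + s) a = f s(a, b) + s) ∨
        ∃ a', G.Adj a a' ∧ a' ≠ b ∧
          twWt G (fun e => f e + s) a = (f s(a, b) + s) + (f s(a, a') + s) := by
      intro a b hab
      have hm : b ∈ twNb G a := mem_twNb.2 hab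
      have hc := card_erase_add_one hm
      have hd := hdeg a
      have hsum : twWt G (fun e => f e + s) a = (f s(a, b) + s) +
          ∑ w ∈ (twNb G a).erase b, (f s(a, w) + s) := (add_sum_erase _ _ hm).symm
      rcases Nat.lt_or_ge ((twNb G a).erase b).card 1 with h0 | h0
      · left
        have : (twNb G a).erase b = ∅ := card_eq_zero.1 (by omega)
        rw [this] at hsum
        exact ⟨by omega, by simpa using hsum⟩
      · right
        obtain ⟨a', ha'⟩ := card_eq_one.1 (by omega : ((twNb G a).erase b).card = 1)
        have hm' : a' ∈ (twNb G a).erase b := by rw [ha']; simp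
        rw [mem_erase, mem_twNb] at hm'
        rw [ha', sum_singleton] at hsum
        exact ⟨a', hm'.2, hm'.1, hsum⟩
    intro a b hab
    have hsw : f s(b, a) = f s(a, b) := by rw [Sym2.eq_swap]
    rcases hw a b hab with ⟨ha, hwa⟩ | ⟨a', haa, hab', hwa⟩ <;>
    rcases hw b a hab.symm with ⟨hb, hwb⟩ | ⟨b', hbb, hba', hwb⟩ <;> rw [hwa, hwb, hsw]
    · have := twNoK2 G hconn hcard a b hab
      omega
    · intro h
      exact hs' a b b' ha hab hbb hba' (by simpa using h)
    · intro h
      exact hs' b a a' hb hab.symm haa hab' (by simpa using h)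
    · intro h
      have h1 := add_right_cancel (add_left_cancel h)
      rw [Sym2.eq_swap] at h1
      exact hf a' a b b' haa.symm hab hbb hab' hba'.symm h1

lemma twMain [Fintype A] (G : SimpleGraph V) (hconn : G.Connected) (hcard : 3 ≤ Fintype.card V)
    (D c : ℕ) (hD : ∀ u, (twNb G u).card ≤ D) (hD2 : 2 ≤ D) (hc2 : 2 ≤ c)
    (hc : twDegen G (c - 1)) (hA : Fintype.card A = 2 * (D + c) - 5) :
    ∃ f : Sym2 V → A, twProper G f ∧ ∀ a b, G.Adj a b → twWt G f a ≠ twWt G f b := by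
  by_cases h : 3 ≤ c
  · obtain ⟨f, h1, h2⟩ := twCaseI (A := A) D (c - 1) (by omega) (by omega) (by omega) G hD hc
    exact ⟨f, h1, fun a b hab => h2 a b hab (twNoK2 G hconn hcard a b hab)⟩
  · obtain rfl : c = 2 := by omega
    by_cases h' : 3 ≤ D
    · obtain ⟨f, h1, -, h2⟩ := twCaseII (A := A) D h' (by omega) G hD hc (fun _ => False)
        (fun _ h => h.elim)
      exact ⟨f, h1, fun a b hab => h2 a b hab id id (twNoK2 G hconn hcard a b hab)⟩
    · obtain rfl : D = 2 := by omega
      exact twPath (by omega) G hconn hcard hD hc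


end TwinHelpers

/-- If `G` is a connected graph of order at least `3`, then
`χ'_g(G) ≤ 2(Δ(G) + col(G)) - 5`. -/
theorem groupTwinChromaticIndex_le_of_connected {V : Type} [Fintype V] (G : SimpleGraph V)
    [DecidableRel G.Adj] (hconn : G.Connected) (hcard : 3 ≤ Fintype.card V) :
    ∃ k ∈ TwinSet G, k ≤ 2 * (G.maxDegree + coloringNumber G) - 5 := by
  have hne : {k | ∀ s : Finset V, s.Nonempty →
      ∃ v ∈ s, (s.filter (fun u => G.Adj v u)).card < k}.Nonempty := by
    refine ⟨Fintype.card V + 1, ?_⟩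
    rintro s ⟨v, hv⟩
    exact ⟨v, hv, Nat.lt_succ_of_le (card_le_univ _)⟩
  have hcol : ∀ s : Finset V, s.Nonempty →
      ∃ v ∈ s, (s.filter (fun u => G.Adj v u)).card < coloringNumber G := Nat.sInf_mem hne
  have hnb : ∀ u, twNb G u = G.neighborFinset u := by
    intro u
    ext w
    simp [mem_twNb]
  have hD : ∀ u, (twNb G u).card ≤ G.maxDegree := by
    intro u
    rw [hnb, card_neighborFinset_eq_degree]
    exact G.degree_le_maxDegree u
  obtain ⟨a, b, hab⟩ : ∃ a b, G.Adj a b := by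
    have : Nontrivial V := Fintype.one_lt_card_iff_nontrivial.1 (by omega)
    obtain ⟨a⟩ := hconn.nonempty
    have := hconn.preconnected.degree_pos_of_nontrivial a
    obtain ⟨b, hb⟩ := (G.degree_pos_iff_exists_adj a).1 this
    exact ⟨a, b, hb⟩
  have hD2 : 2 ≤ G.maxDegree := by
    rcases twNoK2 G hconn hcard a b hab with h | h
    · exact h.trans (hD a)
    · exact h.trans (hD b)
  have hc2 : 2 ≤ coloringNumber G := by
    classical
    obtain ⟨v, hv, hlt⟩ := hcol {a, b} ⟨a, by simp⟩
    have h1 : 0 < ((({a, b} : Finset V)).filter (fun u => G.Adj v u)).card := by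
      rw [card_pos]
      simp only [mem_insert, mem_singleton] at hv
      rcases hv with rfl | rfl
      · exact ⟨b, by simp [hab]⟩
      · exact ⟨a, by simp [hab.symm]⟩
    omega
  have hdg : twDegen G (coloringNumber G - 1) := by
    intro s hs
    obtain ⟨v, hv, hlt⟩ := hcol s hs
    refine ⟨v, hv, ?_⟩
    have : (s.filter (fun u => G.Adj v u)).card ≤ coloringNumber G - 1 := by omega
    convert this
  refine ⟨2 * (G.maxDegree + coloringNumber G) - 5, ⟨by omega, ?_⟩, le_rfl⟩
  intro A _ _ hA
  obtain ⟨f, h1, h2⟩ := twMain (A := A) G hconn hcard _ _ hD hD2 hc2 hdg hA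
  refine ⟨f, h1, ?_⟩
  intro u v huv
  have hw : ∀ u, ∑ x ∈ G.neighborFinset u, f s(x, u) = twWt G f u := by
    intro u
    unfold twWt
    rw [hnb]
    exact sum_congr rfl (fun x _ => by rw [Sym2.eq_swap])
  rw [hw, hw]
  exact h2 u v huv
end

section
/- If G is a connected planar finite simple graph of order at least 3, then χ'_g(G) ≤ 2Δ(G) + 7, where Δ(G) is the maximum degree of G. -/
open Finset SimpleGraph

/-- `H` is a minor of `G`: there is a family of nonempty, pairwise disjoint, connected
branch sets in `G` indexed by the vertices of `H` such that adjacent vertices of `H`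
correspond to branch sets joined by an edge of `G`. -/
def HasGraphMinor {V W : Type} (G : SimpleGraph V) (H : SimpleGraph W) : Prop :=
  ∃ B : W → Set V,
    (∀ w, (B w).Nonempty) ∧
    (∀ w, (G.induce (B w)).Connected) ∧
    (∀ w₁ w₂, w₁ ≠ w₂ → Disjoint (B w₁) (B w₂)) ∧
    (∀ w₁ w₂, H.Adj w₁ w₂ → ∃ v₁ ∈ B w₁, ∃ v₂ ∈ B w₂, G.Adj v₁ v₂)

/-- A graph is planar iff it has neither a `K₅` nor a `K₃,₃` minor (Wagner's theorem). -/
def IsPlanarGraph {V : Type} (G : SimpleGraph V) : Prop :=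
  ¬ HasGraphMinor G (⊤ : SimpleGraph (Fin 5)) ∧
  ¬ HasGraphMinor G (completeBipartiteGraph (Fin 3) (Fin 3))


theorem hgm_trans {U V W : Type} {G : SimpleGraph U} {H : SimpleGraph V} {K : SimpleGraph W}
    (h1 : HasGraphMinor G H) (h2 : HasGraphMinor H K) : HasGraphMinor G K := by
  obtain ⟨B, hBn, hBc, hBd, hBa⟩ := h1
  obtain ⟨C, hCn, hCc, hCd, hCa⟩ := h2
  refine ⟨fun w => ⋃ h ∈ C w, B h, ?_, ?_, ?_, ?_⟩
  · intro w
    obtain ⟨h, hh⟩ := hCn w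
    obtain ⟨x, hx⟩ := hBn h
    exact ⟨x, Set.mem_biUnion hh hx⟩
  · intro w
    set S : Set U := ⋃ h ∈ C w, B h with hS
    have hsub : ∀ h ∈ C w, B h ⊆ S := fun h hh => Set.subset_biUnion_of_mem hh
    have same : ∀ h (hh : h ∈ C w) (x y : U) (hx : x ∈ B h) (hy : y ∈ B h),
        (G.induce S).Reachable ⟨x, hsub h hh hx⟩ ⟨y, hsub h hh hy⟩ := by
      intro h hh x y hx hy
      exact ((hBc h).preconnected ⟨x, hx⟩ ⟨y, hy⟩).map (G.induceHomOfLE (hsub h hh)).toHom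
    have key : ∀ (a b : C w), (H.induce (C w)).Walk a b → ∀ (x y : U) (hx : x ∈ B a)
        (hy : y ∈ B b),
        (G.induce S).Reachable ⟨x, hsub a a.2 hx⟩ ⟨y, hsub b b.2 hy⟩ := by
      intro a b p
      induction p with
      | nil => intro x y hx hy; exact same _ (Subtype.coe_prop _) x y hx hy
      | @cons a c b hac p ih =>
        intro x y hx hy
        obtain ⟨v1, hv1, v2, hv2, hadj⟩ := hBa a c hac
        refine (same a a.2 x v1 hx hv1).trans (Reachable.trans ?_ (ih v2 y hv2 hy))
        exact Adj.reachable (by simpa using hadj)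
    obtain ⟨h, hh⟩ := hCn w
    obtain ⟨x, hx⟩ := hBn h
    have : Nonempty S := ⟨⟨x, hsub h hh hx⟩⟩
    refine ⟨?_⟩
    rintro ⟨x, hx⟩ ⟨y, hy⟩
    obtain ⟨a, ha, hxa⟩ := Set.mem_iUnion₂.1 hx
    obtain ⟨b, hb, hyb⟩ := Set.mem_iUnion₂.1 hy
    obtain ⟨p⟩ := (hCc w).preconnected ⟨a, ha⟩ ⟨b, hb⟩
    exact key _ _ p x y hxa hyb
  · intro w1 w2 hne
    rw [Set.disjoint_left]
    intro x hx hy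
    obtain ⟨a, ha, hxa⟩ := Set.mem_iUnion₂.1 hx
    obtain ⟨b, hb, hyb⟩ := Set.mem_iUnion₂.1 hy
    by_cases hab : a = b
    · subst hab
      exact Set.disjoint_left.1 (hCd w1 w2 hne) ha hb
    · exact Set.disjoint_left.1 (hBd a b hab) hxa hyb
  · intro w1 w2 hadj
    obtain ⟨a, ha, b, hb, hab⟩ := hCa w1 w2 hadj
    obtain ⟨x, hx, y, hy, hxy⟩ := hBa a b hab
    exact ⟨x, Set.mem_biUnion ha hx, y, Set.mem_biUnion hb hy, hxy⟩

theorem singleton_conn {V : Type} (G : SimpleGraph V) (x : V) :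
    (G.induce ({x} : Set V)).Connected := by
  have : Nonempty ({x} : Set V) := ⟨⟨x, rfl⟩⟩
  refine ⟨?_⟩
  rintro ⟨a, ha⟩ ⟨b, hb⟩
  obtain rfl : a = x := ha
  obtain rfl : b = a := hb
  exact Reachable.refl _

theorem hgm_of_inj {V W : Type} {G : SimpleGraph V} {H : SimpleGraph W} (f : W → V)
    (hf : Function.Injective f) (hadj : ∀ a b, H.Adj a b → G.Adj (f a) (f b)) :
    HasGraphMinor G H := by
  refine ⟨fun w => {f w}, fun w => ⟨_, rfl⟩, fun w => singleton_conn G _, ?_, ?_⟩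
  · intro a b hab
    simpa using fun h => hab (hf h)
  · intro a b hab
    exact ⟨_, rfl, _, rfl, hadj a b hab⟩

/-- the contraction map -/
noncomputable def cmap {W : Type} (u v : W) (huv : u ≠ v) (x : W) : {x : W // x ≠ v} :=
  open Classical in if h : x = v then ⟨u, huv⟩ else ⟨x, h⟩

theorem hgm_contract {W : Type} (H : SimpleGraph W) (u v : W) (huv : u ≠ v) (hadj : H.Adj u v) :
    HasGraphMinor H (H.map (cmap u v huv)) := by
  classical
  have hm : ∀ x, x ∈ (if (cmap u v huv x).1 = u then {u, v} else {(cmap u v huv x).1} : Set W) := by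
    intro x
    unfold cmap
    split_ifs <;> simp_all
  refine ⟨fun x => if x.1 = u then {u, v} else {x.1}, ?_, ?_, ?_, ?_⟩
  · intro x; dsimp only; split_ifs <;> simp
  · intro x
    dsimp only
    by_cases h : x.1 = u
    · rw [if_pos h]
      exact induce_pair_connected_of_adj hadj
    · rw [if_neg h]
      exact singleton_conn _ _
  · rintro ⟨a, ha⟩ ⟨b, hb⟩ hab
    have : a ≠ b := fun h => hab (Subtype.ext h)
    dsimp only
    rw [Set.disjoint_left]
    intro z
    split_ifs <;> simp <;> grind
  · intro a b hab
    rw [SimpleGraph.map_adj'] at hab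
    obtain ⟨-, x, y, hxy, rfl, rfl⟩ := hab
    exact ⟨x, hm x, y, hm y, hxy⟩

open Classical in
theorem contract_card {W : Type} [Fintype W] (H : SimpleGraph W) (u v : W) (huv : u ≠ v)
    [Fintype (H.map (cmap u v huv)).edgeSet] :
    #H.edgeFinset ≤ #(H.map (cmap u v huv)).edgeFinset + 1 +
      #(H.neighborFinset u ∩ H.neighborFinset v) := by
  set bad : Finset (Sym2 W) := insert s(v, u)
    ((H.neighborFinset u ∩ H.neighborFinset v).image (fun z => s(v, z))) with hbad
  have hb : #bad ≤ #(H.neighborFinset u ∩ H.neighborFinset v) + 1 :=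
    (Finset.card_insert_le _ _).trans (Nat.add_le_add_right Finset.card_image_le 1)
  have h1 : #(H.edgeFinset \ bad) ≤ #(H.map (cmap u v huv)).edgeFinset := by
    apply Finset.card_le_card_of_injOn (Sym2.map (cmap u v huv))
    · intro e
      induction e with
      | _ a b =>
        simp only [hbad, coe_sdiff, Set.mem_sdiff, mem_coe, mem_edgeFinset, mem_edgeSet,
          SimpleGraph.map_adj', Sym2.map_mk, mem_insert, mem_image, mem_inter, mem_neighborFinset]
        rintro ⟨hab, hn⟩
        refine ⟨?_, a, b, hab, rfl, rfl⟩
        have := hab.ne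
        intro h
        apply hn
        left
        unfold cmap at h
        split_ifs at h <;> simp_all
    · intro e he e' he' h
      induction e with
      | _ a b =>
      induction e' with
      | _ c d =>
        simp only [hbad, coe_sdiff, Set.mem_sdiff, mem_coe, mem_edgeFinset, mem_edgeSet,
          SimpleGraph.map_adj', Sym2.map_mk, mem_insert, mem_image, mem_inter,
          mem_neighborFinset] at he he' h
        obtain ⟨hab, hn⟩ := he
        obtain ⟨hcd, hn'⟩ := he'
        have e1 := hab.ne
        have e2 := hcd.ne
        have e3 := hab.symm
        have e4 := hcd.symm
        push Not at hn hn'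
        have n1 : ∀ z, H.Adj u z → H.Adj v z → s(v,z) ≠ s(a,b) := fun z h1 h2 => hn.2 z ⟨h1, h2⟩
        have n2 : ∀ z, H.Adj u z → H.Adj v z → s(v,z) ≠ s(c,d) := fun z h1 h2 => hn'.2 z ⟨h1, h2⟩
        have n3 := hn.1
        have n4 := hn'.1
        clear hn hn'
        simp only [Sym2.eq_iff, cmap, ne_eq] at *
        grind
  have h2 : #H.edgeFinset ≤ #(H.edgeFinset \ bad) + #bad := by
    have := Finset.le_card_sdiff bad H.edgeFinset
    omega
  omega

theorem k5_of_six {V : Type} (G : SimpleGraph V) (v a b c d e : V)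
    (hva : G.Adj v a) (hvb : G.Adj v b) (hvc : G.Adj v c) (hvd : G.Adj v d) (hve : G.Adj v e)
    (hac : G.Adj a c) (had : G.Adj a d) (hae : G.Adj a e)
    (hbc : G.Adj b c) (hbd : G.Adj b d) (hbe : G.Adj b e) (hde : G.Adj d e)
    (hab : a ≠ b) (hcd : c ≠ d) (hce : c ≠ e) :
    HasGraphMinor G (⊤ : SimpleGraph (Fin 5)) := by
  have := hva.ne
  have := hvb.ne
  have := hvc.ne
  have := hvd.ne
  have := hve.ne
  have := hac.ne
  have := had.ne
  have := hae.ne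
  have := hbc.ne
  have := hbd.ne
  have := hbe.ne
  have := hde.ne
  refine ⟨![{a, c}, {b}, {d}, {e}, {v}], ?_, ?_, ?_, ?_⟩
  · intro w; fin_cases w <;> simp
  · intro w
    fin_cases w
    · exact induce_pair_connected_of_adj hac
    all_goals exact singleton_conn _ _
  · intro w1 w2 h
    rw [Set.disjoint_left]
    fin_cases w1 <;> fin_cases w2 <;> simp at h ⊢ <;> grind
  · have hs : ∀ w1 w2 : Fin 5, w1 < w2 →
        ∃ v₁ ∈ (![{a, c}, {b}, {d}, {e}, {v}] : Fin 5 → Set V) w1,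
        ∃ v₂ ∈ (![{a, c}, {b}, {d}, {e}, {v}] : Fin 5 → Set V) w2, G.Adj v₁ v₂ := by
      intro w1 w2 h
      fin_cases w1 <;> fin_cases w2 <;> simp at h ⊢ <;> simp [*, G.adj_comm]
    intro w1 w2 h
    rcases lt_or_gt_of_ne h.ne with h | h
    · exact hs _ _ h
    · obtain ⟨x, hx, y, hy, hxy⟩ := hs _ _ h
      exact ⟨y, hy, x, hx, hxy.symm⟩

theorem k5_of_five {V : Type} (G : SimpleGraph V) (v a b c d : V)
    (hva : G.Adj v a) (hvb : G.Adj v b) (hvc : G.Adj v c) (hvd : G.Adj v d)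
    (hac : G.Adj a c) (had : G.Adj a d) (hab : G.Adj a b)
    (hbc : G.Adj b c) (hbd : G.Adj b d) (hcd : G.Adj c d) :
    HasGraphMinor G (⊤ : SimpleGraph (Fin 5)) := by
  have hs : ∀ i j : Fin 5, i ≠ j → G.Adj (![v, a, b, c, d] i) (![v, a, b, c, d] j) := by
    intro i j h
    fin_cases i <;> fin_cases j <;> simp at h ⊢ <;> first | assumption | (apply SimpleGraph.Adj.symm; assumption)
  refine hgm_of_inj ![v, a, b, c, d] ?_ (fun i j h => hs i j h.ne)
  intro i j h
  by_contra hij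
  exact (hs i j hij).ne h

open Classical in
theorem k5_local {W : Type} [Fintype W] (H : SimpleGraph W) (v : W) (h0 : 0 < H.degree v)
    (h5 : H.degree v ≤ 5)
    (ht : ∀ u, H.Adj u v → 3 ≤ #(H.neighborFinset u ∩ H.neighborFinset v)) :
    HasGraphMinor H (⊤ : SimpleGraph (Fin 5)) := by
  set N := H.neighborFinset v with hN
  have hNm : ∀ x, x ∈ N ↔ H.Adj v x := by intro x; simp [hN]
  have hcard : #N = H.degree v := rfl
  have h4 : 4 ≤ #N := by
    obtain ⟨u, hu⟩ := Finset.card_pos.1 (hcard ▸ h0)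
    have h1 := ht u ((hNm u).1 hu).symm
    have h2 : H.neighborFinset u ∩ N ⊆ N.erase u := by
      intro x hx; simp at hx ⊢; exact ⟨hx.1.ne', hx.2⟩
    have := Finset.card_le_card h2
    rw [Finset.card_erase_of_mem hu] at this
    omega
  have h45 : #N = 4 ∨ #N = 5 := by omega
  rcases h45 with hc | hc
  · have hadj : ∀ u ∈ N, ∀ p ∈ N, u ≠ p → H.Adj u p := by
      intro u hu p hp hup
      by_contra hn
      have h1 := ht u ((hNm u).1 hu).symm
      have h2 : H.neighborFinset u ∩ N ⊆ (N.erase u).erase p := by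
        intro x hx; simp at hx ⊢
        refine ⟨?_, hx.1.ne', hx.2⟩
        rintro rfl; exact hn hx.1
      have := Finset.card_le_card h2
      rw [Finset.card_erase_of_mem (by simp [hp, hup.symm]), Finset.card_erase_of_mem hu] at this
      omega
    obtain ⟨a, b, c, d, hab, hac, had, hbc, hbd, hcd, hNe⟩ := Finset.card_eq_four.1 hc
    have ma : a ∈ N := by rw [hNe]; simp
    have mb : b ∈ N := by rw [hNe]; simp
    have mc : c ∈ N := by rw [hNe]; simp
    have md : d ∈ N := by rw [hNe]; simp
    exact k5_of_five H v a b c d ((hNm _).1 ma) ((hNm _).1 mb) ((hNm _).1 mc) ((hNm _).1 md)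
      (hadj _ ma _ mc hac) (hadj _ ma _ md had) (hadj _ ma _ mb hab) (hadj _ mb _ mc hbc)
      (hadj _ mb _ md hbd) (hadj _ mc _ md hcd)
  · have hadj : ∀ u ∈ N, ∀ p ∈ N, ∀ q ∈ N, u ≠ p → u ≠ q → p ≠ q → ¬ H.Adj u p → H.Adj u q := by
      intro u hu p hp q hq hup huq hpq hn
      by_contra hn'
      have h1 := ht u ((hNm u).1 hu).symm
      have h2 : H.neighborFinset u ∩ N ⊆ ((N.erase u).erase p).erase q := by
        intro x hx; simp at hx ⊢
        refine ⟨?_, ?_, hx.1.ne', hx.2⟩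
        · rintro rfl; exact hn' hx.1
        · rintro rfl; exact hn hx.1
      have := Finset.card_le_card h2
      rw [Finset.card_erase_of_mem (by simp [hq, huq.symm, hpq.symm]),
        Finset.card_erase_of_mem (by simp [hp, hup.symm]), Finset.card_erase_of_mem hu] at this
      omega
    have hpair : ∃ a ∈ N, ∃ b ∈ N, a ≠ b ∧ ∀ c ∈ N, c ≠ a → c ≠ b → H.Adj a c ∧ H.Adj b c := by
      by_cases hex : ∃ a ∈ N, ∃ b ∈ N, a ≠ b ∧ ¬ H.Adj a b
      · obtain ⟨a, ha, b, hb, hab, hn⟩ := hex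
        refine ⟨a, ha, b, hb, hab, fun c hc hca hcb => ⟨?_, ?_⟩⟩
        · exact hadj a ha b hb c hc hab hca.symm hcb.symm hn
        · exact hadj b hb a ha c hc hab.symm hcb.symm hca.symm (fun h => hn h.symm)
      · push Not at hex
        obtain ⟨a, ha, b, hb, hab⟩ := Finset.one_lt_card.1 (by omega : 1 < #N)
        exact ⟨a, ha, b, hb, hab, fun c hc hca hcb =>
          ⟨hex a ha c hc hca.symm, hex b hb c hc hcb.symm⟩⟩
    obtain ⟨a, ha, b, hb, hab, hco⟩ := hpair
    have h3 : #((N.erase a).erase b) = 3 := by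
      rw [Finset.card_erase_of_mem (by simp [hb, hab.symm]), Finset.card_erase_of_mem ha, hc]
    have fin : ∀ c ∈ (N.erase a).erase b, ∀ d ∈ (N.erase a).erase b, ∀ e ∈ (N.erase a).erase b,
        c ≠ d → c ≠ e → H.Adj d e → HasGraphMinor H (⊤ : SimpleGraph (Fin 5)) := by
      intro c hc d hd e he hcd hce hde
      simp only [mem_erase] at hc hd he
      obtain ⟨hc1, hc2, hc3⟩ := hc
      obtain ⟨hd1, hd2, hd3⟩ := hd
      obtain ⟨he1, he2, he3⟩ := he
      have q1 := hco c hc3 hc2 hc1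
      have q2 := hco d hd3 hd2 hd1
      have q3 := hco e he3 he2 he1
      exact k5_of_six H v a b c d e ((hNm _).1 ha) ((hNm _).1 hb) ((hNm _).1 hc3) ((hNm _).1 hd3)
        ((hNm _).1 he3) q1.1 q2.1 q3.1 q1.2 q2.2 q3.2 hde hab hcd hce
    obtain ⟨c, d, e, hcd, hce, hde, hE⟩ := Finset.card_eq_three.1 h3
    have mc : c ∈ (N.erase a).erase b := by rw [hE]; simp
    have md : d ∈ (N.erase a).erase b := by rw [hE]; simp
    have me : e ∈ (N.erase a).erase b := by rw [hE]; simp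
    by_cases h : H.Adj d e
    · exact fin c mc d md e me hcd hce h
    · have : H.Adj d c := hadj d (mem_of_mem_erase (mem_of_mem_erase md)) e
        (mem_of_mem_erase (mem_of_mem_erase me)) c (mem_of_mem_erase (mem_of_mem_erase mc))
        hde hcd.symm hce.symm h
      exact fin e me d md c mc hde.symm hce.symm this

open Classical in
theorem mader5 (n : ℕ) (hn : 3 ≤ n) : ∀ (W : Type) [Fintype W] (H : SimpleGraph W) [Fintype H.edgeSet],
    Fintype.card W = n → 3 * n ≤ #H.edgeFinset + 5 →
    HasGraphMinor H (⊤ : SimpleGraph (Fin 5)) := by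
  induction n, hn using Nat.le_induction with
  | base =>
    intro W _ H _ hW he
    exfalso
    have := H.card_edgeFinset_le_card_choose_two
    rw [hW] at this
    simp only [Nat.choose_two_right] at this
    omega
  | succ n hn ih =>
    intro W _ H' _ hW he'
    obtain ⟨H, hle, he⟩ : ∃ H : SimpleGraph W, H ≤ H' ∧ #H.edgeFinset = 3 * n - 2 := by
      obtain ⟨T, hT, hTc⟩ := Finset.exists_subset_card_eq (s := H'.edgeFinset) (n := 3 * n - 2)
        (by omega)
      have hTE : (fromEdgeSet (T : Set (Sym2 W))).edgeFinset = T := by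
        ext e
        simp only [mem_edgeFinset, edgeSet_fromEdgeSet, Set.mem_sdiff, mem_coe]
        refine ⟨fun h => h.1, fun h => ⟨h, ?_⟩⟩
        have := hT h
        rw [mem_edgeFinset] at this
        simpa using H'.not_isDiag_of_mem_edgeSet this
      refine ⟨fromEdgeSet (T : Set (Sym2 W)), ?_, ?_⟩
      · intro a b hab
        have : s(a, b) ∈ T := by
          rw [fromEdgeSet_adj] at hab
          exact hab.1
        simpa using hT this
      · rw [← hTc]
        convert congrArg Finset.card hTE
    refine hgm_trans (hgm_of_inj (G := H') (H := H) id Function.injective_id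
      (fun a b h => hle h)) ?_
    by_cases hcon : ∃ u v, H.Adj u v ∧ #(H.neighborFinset u ∩ H.neighborFinset v) ≤ 2
    · obtain ⟨u, v, huv, hle⟩ := hcon
      refine hgm_trans (hgm_contract H u v huv.ne huv) ?_
      apply ih
      · simp [Fintype.card_subtype_compl, hW]
      · have := contract_card H u v huv.ne
        omega
    · push Not at hcon
      have : ∃ v, H.degree v ≤ 5 := by
        by_contra! h
        have h1 := H.sum_degrees_eq_twice_card_edges
        have h2 : ∑ v : W, 6 ≤ ∑ v, H.degree v := Finset.sum_le_sum (fun v _ => h v)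
        simp [hW] at h2
        omega
      obtain ⟨v, hv⟩ := this
      by_cases h0 : H.degree v = 0
      · refine hgm_trans (hgm_of_inj (G := H) (H := H.induce {v}ᶜ) Subtype.val
          Subtype.val_injective (fun a b h => h)) ?_
        apply ih
        · rw [Fintype.card_compl_set]; simp [hW]
        · have := H.card_edgeFinset_induce_compl_singleton v
          have h2 := H.card_edgeFinset_deleteIncidenceSet v
          have h3 : #(H.induce {v}ᶜ).edgeFinset = #H.edgeFinset := by
            have h4 := this.trans h2
            rw [h0, Nat.sub_zero] at h4
            convert h4
          omega
      · exact k5_local H v (by omega) hv (fun u hu => hcon u v hu)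

open Classical in
theorem exists_small {V : Type} [Fintype V] (G : SimpleGraph V)
    (hG : ¬ HasGraphMinor G (⊤ : SimpleGraph (Fin 5))) (S : Finset V) (hS : S.Nonempty) :
    ∃ v ∈ S, #(S.filter (fun u => G.Adj v u)) ≤ 5 := by
  by_contra! h
  apply hG
  set H := G.induce (S : Set V) with hH
  refine hgm_trans (hgm_of_inj (G := G) (H := H) Subtype.val
          Subtype.val_injective (fun a b h => h)) ?_
  have hd : ∀ v : (S : Set V), 6 ≤ H.degree v := by
    intro v
    refine le_trans (show 6 ≤ #(S.filter (fun u => G.Adj v u)) from h v v.2) ?_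
    rw [← card_neighborFinset_eq_degree]
    rw [← Finset.card_map (Function.Embedding.subtype (· ∈ (S : Set V)))]
    apply Finset.card_le_card
    intro x hx
    simp at hx
    simp [hH, hx]
  have hc : 3 ≤ Fintype.card (S : Set V) := by
    obtain ⟨v, hv⟩ := hS
    have := hd ⟨v, hv⟩
    have := H.degree_lt_card_verts ⟨v, hv⟩
    omega
  refine mader5 _ hc _ H rfl ?_
  have h1 := H.sum_degrees_eq_twice_card_edges
  have h2 : ∑ v : (S : Set V), 6 ≤ ∑ v, H.degree v := Finset.sum_le_sum (fun v _ => hd v)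
  simp only [sum_const, smul_eq_mul, card_univ] at h2
  have h3 : 3 * Fintype.card (S : Set V) ≤ #H.edgeFinset + 5 := by omega
  convert h3

open Classical in
theorem exists_order {V : Type} [Fintype V] (G : SimpleGraph V)
    (hG : ¬ HasGraphMinor G (⊤ : SimpleGraph (Fin 5))) (n : ℕ) : ∀ S : Finset V, #S = n →
    ∃ ρ : V → ℕ, Set.InjOn ρ S ∧ (∀ v ∈ S, ρ v < n) ∧
      ∀ v ∈ S, #(S.filter (fun u => G.Adj v u ∧ ρ u < ρ v)) ≤ 5 := by
  induction n with
  | zero =>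
    intro S hS
    rw [Finset.card_eq_zero] at hS
    subst hS
    exact ⟨fun _ => 0, by simp⟩
  | succ n ih =>
    intro S hS
    obtain ⟨v, hv, h5⟩ := exists_small G hG S (Finset.card_pos.1 (by omega))
    obtain ⟨ρ, h1, h2, h3⟩ := ih (S.erase v) (by rw [Finset.card_erase_of_mem hv, hS]; rfl)
    refine ⟨Function.update ρ v n, ?_, ?_, ?_⟩
    · intro a ha b hb hab
      have h2a := h2 a
      have h2b := h2 b
      have := @h1 a
      simp only [Function.update_apply, coe_erase, Set.mem_sdiff, mem_coe, mem_erase] at *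
      grind
    · intro a ha
      have h2a := h2 a
      simp only [Function.update_apply, mem_erase] at *
      grind
    · intro a ha
      by_cases hav : a = v
      · subst hav
        refine le_trans (Finset.card_le_card ?_) h5
        intro x; simp; tauto
      · refine le_trans (Finset.card_le_card ?_) (h3 a (by simp [hav, ha]))
        intro x hx
        have h2a := h2 a
        simp only [Function.update_apply, mem_erase, mem_filter] at *
        grind

open Classical in
/-- the weighted degree changes in a simple way under update -/
theorem w_update {V : Type} [Fintype V] (G : SimpleGraph V) [DecidableRel G.Adj]
    {A : Type} [AddCommGroup A] (f : Sym2 V → A) (x y : V) (hxy : G.Adj x y) (a : A) :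
    ∑ z ∈ G.neighborFinset x, Function.update f s(x, y) a s(z, x) =
      ∑ z ∈ G.neighborFinset x, f s(z, x) + (a - f s(x, y)) := by
  have hy : y ∈ G.neighborFinset x := by simpa using hxy
  rw [← Finset.add_sum_erase _ _ hy, ← Finset.add_sum_erase _ (fun z => f s(z, x)) hy]
  have : ∑ z ∈ (G.neighborFinset x).erase y, Function.update f s(x, y) a s(z, x) =
      ∑ z ∈ (G.neighborFinset x).erase y, f s(z, x) := by
    apply Finset.sum_congr rfl
    intro z hz
    rw [Function.update_of_ne]
    have h1 := Finset.ne_of_mem_erase hz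
    have h2 := hxy.ne
    simp only [ne_eq, Sym2.eq_iff]
    grind
  rw [this, Sym2.eq_swap, Function.update_self]
  abel

open Classical in
theorem w_update' {V : Type} [Fintype V] (G : SimpleGraph V) [DecidableRel G.Adj]
    {A : Type} [AddCommGroup A] (f : Sym2 V → A) (x y p : V) (hx : p ≠ x) (hy : p ≠ y) (a : A) :
    ∑ z ∈ G.neighborFinset p, Function.update f s(x, y) a s(z, p) =
      ∑ z ∈ G.neighborFinset p, f s(z, p) := by
  apply Finset.sum_congr rfl
  intro z hz
  rw [Function.update_of_ne]
  simp only [ne_eq, Sym2.eq_iff]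
  grind

open Classical in
theorem greedy {V : Type} [Fintype V] (G : SimpleGraph V) [DecidableRel G.Adj]
    {A : Type} [AddCommGroup A] [Fintype A] (key : Sym2 V → ℕ) (hkey : Function.Injective key)
    (hiso : ∀ u v, G.Adj u v → ∃ z, (G.Adj u z ∧ z ≠ v) ∨ (G.Adj v z ∧ z ≠ u))
    (hb : ∀ x y, G.Adj x y →
      #((G.neighborFinset x).filter (fun z => z ≠ y ∧ key s(x, z) < key s(x, y))) +
      #((G.neighborFinset y).filter (fun z => z ≠ x ∧ key s(y, z) < key s(x, y))) +
      #((G.neighborFinset x).filter (fun q => q ≠ y ∧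
        ∀ z, G.Adj x z → z ≠ q → key s(x, z) ≤ key s(x, y))) +
      #((G.neighborFinset y).filter (fun q => q ≠ x ∧
        ∀ z, G.Adj y z → z ≠ q → key s(y, z) ≤ key s(x, y))) < Fintype.card A) :
    ∃ f : Sym2 V → A, IsTwinEdgeColoring G f := by
  have main : ∀ n : ℕ, ∃ f : Sym2 V → A,
      (∀ u v w : V, G.Adj u v → G.Adj u w → v ≠ w → key s(u, v) < n → key s(u, w) < n →
        f s(u, v) ≠ f s(u, w)) ∧
      (∀ u v : V, G.Adj u v → (∀ z, G.Adj u z → z ≠ v → key s(u, z) < n) →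
        (∀ z, G.Adj v z → z ≠ u → key s(v, z) < n) →
        ∑ x ∈ G.neighborFinset u, f s(x, u) ≠ ∑ x ∈ G.neighborFinset v, f s(x, v)) := by
    intro n
    induction n with
    | zero =>
      refine ⟨fun _ => 0, ?_, ?_⟩
      · intro u v w _ _ _ h; omega
      · intro u v huv h1 h2
        obtain ⟨z, ⟨hz, hz'⟩ | ⟨hz, hz'⟩⟩ := hiso u v huv
        · have := h1 z hz hz'; omega
        · have := h2 z hz hz'; omega
    | succ n ih =>
      obtain ⟨f, hf1, hf2⟩ := ih
      by_cases hex : ∃ x y, G.Adj x y ∧ key s(x, y) = n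
      · obtain ⟨x, y, hxy, hn⟩ := hex
        have hlt : ∀ e, key e < n + 1 → e ≠ s(x, y) → key e < n := by
          intro e h1 h2
          have : key e ≠ n := fun h => h2 (hkey (h.trans hn.symm))
          omega
        set W : V → A := fun p => ∑ z ∈ G.neighborFinset p, f s(z, p) with hW
        set F : Finset A :=
          ((G.neighborFinset x).filter (fun z => z ≠ y ∧ key s(x, z) < key s(x, y))).image
            (fun z => f s(x, z)) ∪
          ((G.neighborFinset y).filter (fun z => z ≠ x ∧ key s(y, z) < key s(x, y))).image
            (fun z => f s(y, z)) ∪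
          ((G.neighborFinset x).filter (fun q => q ≠ y ∧
            ∀ z, G.Adj x z → z ≠ q → key s(x, z) ≤ key s(x, y))).image
            (fun q => W q - W x + f s(x, y)) ∪
          ((G.neighborFinset y).filter (fun q => q ≠ x ∧
            ∀ z, G.Adj y z → z ≠ q → key s(y, z) ≤ key s(x, y))).image
            (fun q => W q - W y + f s(x, y)) with hF
        have hFc : #F < Fintype.card A := by
          refine lt_of_le_of_lt ?_ (hb x y hxy)
          refine (Finset.card_union_le _ _).trans (Nat.add_le_add ?_ Finset.card_image_le)
          refine (Finset.card_union_le _ _).trans (Nat.add_le_add ?_ Finset.card_image_le)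
          exact (Finset.card_union_le _ _).trans
            (Nat.add_le_add Finset.card_image_le Finset.card_image_le)
        obtain ⟨a, ha⟩ : ∃ a, a ∉ F := by
          by_contra! h
          have : F = Finset.univ := Finset.eq_univ_iff_forall.2 h
          rw [this, Finset.card_univ] at hFc
          omega
        simp only [hF, mem_union, mem_image, mem_filter, mem_neighborFinset, not_or] at ha
        obtain ⟨⟨⟨ha1, ha2⟩, ha3⟩, ha4⟩ := ha
        have A1 : ∀ z, G.Adj x z → z ≠ y → key s(x, z) < n → a ≠ f s(x, z) :=
          fun z h1 h2 h3 h4 => ha1 ⟨z, ⟨h1, h2, by omega⟩, h4.symm⟩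
        have A2 : ∀ z, G.Adj y z → z ≠ x → key s(y, z) < n → a ≠ f s(y, z) :=
          fun z h1 h2 h3 h4 => ha2 ⟨z, ⟨h1, h2, by omega⟩, h4.symm⟩
        have A3 : ∀ q, G.Adj x q → q ≠ y → (∀ z, G.Adj x z → z ≠ q → key s(x, z) < n + 1) →
            W x + (a - f s(x, y)) ≠ W q := by
          intro q h1 h2 h3 h4
          refine ha3 ⟨q, ⟨h1, h2, fun z h5 h6 => by have := h3 z h5 h6; omega⟩, ?_⟩
          rw [← h4]; abel
        have A4 : ∀ q, G.Adj y q → q ≠ x → (∀ z, G.Adj y z → z ≠ q → key s(y, z) < n + 1) →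
            W y + (a - f s(x, y)) ≠ W q := by
          intro q h1 h2 h3 h4
          refine ha4 ⟨q, ⟨h1, h2, fun z h5 h6 => by have := h3 z h5 h6; omega⟩, ?_⟩
          rw [← h4]; abel
        have Wx : ∑ z ∈ G.neighborFinset x, Function.update f s(x, y) a s(z, x) =
            W x + (a - f s(x, y)) := w_update G f x y hxy a
        have Wy : ∑ z ∈ G.neighborFinset y, Function.update f s(x, y) a s(z, y) =
            W y + (a - f s(x, y)) := by
          have := w_update G f y x hxy.symm a
          rwa [Sym2.eq_swap (a := y) (b := x)] at this
        have Wo : ∀ p, p ≠ x → p ≠ y →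
            ∑ z ∈ G.neighborFinset p, Function.update f s(x, y) a s(z, p) = W p :=
          fun p h1 h2 => w_update' G f x y p h1 h2 a
        refine ⟨Function.update f s(x, y) a, ?_, ?_⟩
        · have half : ∀ u v w : V, G.Adj u v → G.Adj u w → v ≠ w → s(u, v) = s(x, y) →
              key s(u, w) < n + 1 → a ≠ f s(u, w) := by
            intro u v w huv huw hvw he hk
            have hk' : key s(u, w) < n := by
              apply hlt _ hk
              rw [← he]
              simp only [ne_eq, Sym2.eq_iff]
              have := huv.ne
              grind
            rcases Sym2.eq_iff.1 he with ⟨rfl, rfl⟩ | ⟨rfl, rfl⟩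
            · exact A1 w huw hvw.symm hk'
            · exact A2 w huw hvw.symm hk'
          intro u v w huv huw hvw hk1 hk2
          by_cases e1 : s(u, v) = s(x, y)
          · have e2 : s(u, w) ≠ s(x, y) := by
              rw [← e1]
              simp only [ne_eq, Sym2.eq_iff]
              have := huv.ne
              grind
            rw [e1, Function.update_self, Function.update_of_ne e2]
            exact half u v w huv huw hvw e1 hk2
          · by_cases e2 : s(u, w) = s(x, y)
            · rw [e2, Function.update_self, Function.update_of_ne e1]
              exact (half u w v huw huv hvw.symm e2 hk1).symm
            · rw [Function.update_of_ne e1, Function.update_of_ne e2]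
              exact hf1 u v w huv huw hvw (hlt _ hk1 e1) (hlt _ hk2 e2)
        · have hxn := hxy.ne
          have half : ∀ u v : V, G.Adj u v → (u = x ∧ v ≠ y ∨ u = y ∧ v ≠ x) →
              (∀ z, G.Adj u z → z ≠ v → key s(u, z) < n + 1) →
              ∑ z ∈ G.neighborFinset u, Function.update f s(x, y) a s(z, u) ≠
              ∑ z ∈ G.neighborFinset v, Function.update f s(x, y) a s(z, v) := by
            intro u v huv h hk
            have := huv.ne
            rcases h with ⟨rfl, h⟩ | ⟨rfl, h⟩
            · rw [Wx, Wo v this.symm h]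
              exact A3 v huv h hk
            · rw [Wy, Wo v h this.symm]
              exact A4 v huv h hk
          intro u v huv h1 h2
          have hne := huv.ne
          by_cases c1 : u = x ∧ v ≠ y ∨ u = y ∧ v ≠ x
          · exact half u v huv c1 h1
          by_cases c2 : v = x ∧ u ≠ y ∨ v = y ∧ u ≠ x
          · exact (half v u huv.symm c2 h2).symm
          have old : W u ≠ W v := by
            refine hf2 u v huv ?_ ?_
            · intro z hz hzv
              refine hlt _ (h1 z hz hzv) ?_
              simp only [ne_eq, Sym2.eq_iff]
              grind
            · intro z hz hzv
              refine hlt _ (h2 z hz hzv) ?_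
              simp only [ne_eq, Sym2.eq_iff]
              grind
          by_cases c3 : u = x
          · have c4 : v = y := by grind
            subst c3 c4
            rw [Wx, Wy]
            exact fun h => old (add_right_cancel h)
          by_cases c5 : u = y
          · have c4 : v = x := by grind
            subst c5 c4
            rw [Wx, Wy]
            exact fun h => old (add_right_cancel h)
          · rw [Wo u c3 c5, Wo v (by grind) (by grind)]
            exact old
      · push Not at hex
        have hlt : ∀ x y, G.Adj x y → key s(x, y) < n + 1 → key s(x, y) < n := by
          intro x y h1 h2
          have := hex x y h1
          omega
        refine ⟨f, ?_, ?_⟩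
        · intro u v w h1 h2 h3 h4 h5
          exact hf1 u v w h1 h2 h3 (hlt _ _ h1 h4) (hlt _ _ h2 h5)
        · intro u v h1 h2 h3
          exact hf2 u v h1 (fun z h4 h5 => hlt _ _ h4 (h2 z h4 h5))
            (fun z h4 h5 => hlt _ _ h4 (h3 z h4 h5))
  obtain ⟨f, h1, h2⟩ := main (∑ e : Sym2 V, key e + 1)
  have hk : ∀ e, key e < ∑ e : Sym2 V, key e + 1 := fun e =>
    Nat.lt_succ_of_le (Finset.single_le_sum (f := key) (fun _ _ => Nat.zero_le _)
      (Finset.mem_univ e))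
  exact ⟨f, fun u v w a b c => h1 u v w a b c (hk _) (hk _),
    fun u v a => h2 u v a (fun _ _ _ => hk _) (fun _ _ _ => hk _)⟩

theorem groupTwinChromaticIndex_le_of_planar {V : Type} [Fintype V] (G : SimpleGraph V)
    [DecidableRel G.Adj] (hconn : G.Connected) (hplanar : IsPlanarGraph G)
    (hcard : 3 ≤ Fintype.card V) :
    ∃ k ∈ TwinSet G, k ≤ 2 * G.maxDegree + 7 := by
  classical
  refine ⟨2 * G.maxDegree + 7, ⟨by omega, ?_⟩, le_rfl⟩
  intro A _ _ hA
  obtain ⟨ρ, hρ, hρN, hρ5⟩ := exists_order G hplanar.1 _ (Finset.univ : Finset V) rfl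
  set N := #(Finset.univ : Finset V) with hN
  have hinj : Function.Injective ρ := fun a b h => hρ (by simp) (by simp) h
  replace hρN : ∀ v, ρ v < N := fun v => hρN v (by simp)
  let key : Sym2 V → ℕ := Sym2.lift ⟨fun a b => min (ρ a) (ρ b) * N + max (ρ a) (ρ b), by
    intro a b; dsimp only; rw [min_comm, max_comm]⟩
  have hkv : ∀ a b, key s(a, b) = min (ρ a) (ρ b) * N + max (ρ a) (ρ b) := fun a b => rfl
  have lex : ∀ p q r s : ℕ, q < N → s < N → p * N + q ≤ r * N + s → p < r ∨ p = r ∧ q ≤ s := by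
    intro p q r s h1 h2 h
    rcases lt_trichotomy p r with h3 | h3 | h3
    · exact Or.inl h3
    · subst h3; exact Or.inr ⟨rfl, by omega⟩
    · nlinarith
  have hkle : ∀ a b c d, key s(a, b) ≤ key s(c, d) →
      min (ρ a) (ρ b) < min (ρ c) (ρ d) ∨ min (ρ a) (ρ b) = min (ρ c) (ρ d) ∧
        max (ρ a) (ρ b) ≤ max (ρ c) (ρ d) := by
    intro a b c d h
    rw [hkv, hkv] at h
    exact lex _ _ _ _ (max_lt (hρN _) (hρN _)) (max_lt (hρN _) (hρN _)) h
  have hkey : Function.Injective key := by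
    intro e e' h
    induction e with
    | _ a b =>
    induction e' with
    | _ c d =>
      have h1 := hkle a b c d h.le
      have h2 := hkle c d a b h.ge
      have h3 : ρ a = ρ c ∧ ρ b = ρ d ∨ ρ a = ρ d ∧ ρ b = ρ c := by omega
      rw [Sym2.eq_iff]
      exact h3.imp (fun h => ⟨hinj h.1, hinj h.2⟩) (fun h => ⟨hinj h.1, hinj h.2⟩)
  have hiso : ∀ u v, G.Adj u v → ∃ z, (G.Adj u z ∧ z ≠ v) ∨ (G.Adj v z ∧ z ≠ u) := by
    intro u v huv
    by_contra! h
    have hcl : ∀ a b, G.Reachable a b → (a = u ∨ a = v) → (b = u ∨ b = v) := by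
      rintro a b ⟨p⟩
      induction p with
      | nil => exact id
      | cons hac p ih =>
        intro ha
        apply ih
        rcases ha with rfl | rfl
        · exact Or.inr ((h _).1 hac)
        · exact Or.inl ((h _).2 hac)
    have : (Finset.univ : Finset V) ⊆ {u, v} := by
      intro x _
      simpa using hcl u x (hconn.preconnected u x) (Or.inl rfl)
    have := Finset.card_le_card this
    have h2 := Finset.card_le_two (a := u) (b := v)
    rw [Finset.card_univ] at this
    omega
  apply greedy G key hkey hiso
  have hX : ∀ x y, G.Adj x y → ∀ (P : V → Prop) [DecidablePred fun z => z ≠ y ∧ P z],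
      #((G.neighborFinset x).filter (fun z => z ≠ y ∧ P z)) + 1 ≤ G.maxDegree := by
    intro x y hxy P _
    refine le_trans ?_ (G.degree_le_maxDegree x)
    rw [← card_neighborFinset_eq_degree, ← Finset.card_erase_add_one
      (show y ∈ G.neighborFinset x by simpa using hxy)]
    refine Nat.add_le_add_right (Finset.card_le_card ?_) 1
    intro z; simp; tauto
  have hback : ∀ x y, G.Adj x y → ρ x < ρ y → ∀ T : Finset V,
      (∀ z ∈ T, G.Adj y z ∧ z ≠ x ∧ ρ z < ρ y) → #T ≤ 4 := by
    intro x y hxy hlt T hT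
    have h5 := hρ5 y (by simp)
    have hx : x ∉ T := fun h => (hT x h).2.1 rfl
    have : #(insert x T) ≤ 5 := by
      refine le_trans (Finset.card_le_card ?_) h5
      intro z hz
      rw [Finset.mem_insert] at hz
      rcases hz with rfl | hz
      · simp [hxy.symm, hlt]
      · have := hT z hz
        simp [this.1, this.2.2]
    rw [Finset.card_insert_of_notMem hx] at this
    omega
  have hY1 : ∀ x y, G.Adj x y → ρ x < ρ y →
      #((G.neighborFinset y).filter (fun z => z ≠ x ∧ key s(y, z) < key s(x, y))) ≤ 4 := by
    intro x y hxy hlt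
    apply hback x y hxy hlt
    intro z hz
    simp only [mem_filter, mem_neighborFinset] at hz
    obtain ⟨h1, h2, h3⟩ := hz
    refine ⟨h1, h2, ?_⟩
    have h4 := hkle _ _ _ _ h3.le
    have : ρ z ≠ ρ x := fun h => h2 (hinj h)
    omega
  have hY2 : ∀ x y, G.Adj x y → ρ x < ρ y →
      #((G.neighborFinset y).filter (fun q => q ≠ x ∧
        ∀ z, G.Adj y z → z ≠ q → key s(y, z) ≤ key s(x, y))) ≤ 4 := by
    intro x y hxy hlt
    by_contra! hgt
    refine absurd (hback x y hxy hlt _ ?_) (not_le.2 hgt)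
    intro z hz
    obtain ⟨q, hq, hqz⟩ := Finset.exists_mem_ne (lt_of_le_of_lt (by norm_num) hgt) z
    simp only [mem_filter, mem_neighborFinset] at hz hq
    refine ⟨hz.1, hz.2.1, ?_⟩
    have h4 := hkle _ _ _ _ (hq.2.2 z hz.1 hqz.symm)
    have : ρ z ≠ ρ x := fun h => hz.2.1 (hinj h)
    have : ρ z ≠ ρ y := fun h => hz.1.ne (hinj h).symm
    omega
  have fin : ∀ x y, G.Adj x y → ρ x < ρ y →
      #((G.neighborFinset x).filter (fun z => z ≠ y ∧ key s(x, z) < key s(x, y))) +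
      #((G.neighborFinset y).filter (fun z => z ≠ x ∧ key s(y, z) < key s(x, y))) +
      #((G.neighborFinset x).filter (fun q => q ≠ y ∧
        ∀ z, G.Adj x z → z ≠ q → key s(x, z) ≤ key s(x, y))) +
      #((G.neighborFinset y).filter (fun q => q ≠ x ∧
        ∀ z, G.Adj y z → z ≠ q → key s(y, z) ≤ key s(x, y))) < Fintype.card A := by
    intro x y hxy hlt
    have h1 := hX x y hxy (fun z => key s(x, z) < key s(x, y))
    have h2 := hX x y hxy (fun q => ∀ z, G.Adj x z → z ≠ q → key s(x, z) ≤ key s(x, y))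
    have h3 := hY1 x y hxy hlt
    have h4 := hY2 x y hxy hlt
    omega
  intro x y hxy
  rcases lt_or_gt_of_ne (fun h => hxy.ne (hinj h) : ρ x ≠ ρ y) with h | h
  · exact fin x y hxy h
  · have := fin y x hxy.symm h
    rw [Sym2.eq_swap (a := y) (b := x)] at this
    omega
end

section
/- Let T be a tree with maximum degree t ≥ 5 such that every vertex of degree 2 has at least one neighbor of degree 2, and let 𝒢 be an Abelian group with exactly one involution and |𝒢| ≥ t + 2. Then there exists a 𝒢-twin edge coloring of T. -/
open Finset SimpleGraph

section grp
set_option linter.unusedSectionVars false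
variable {A : Type} [AddCommGroup A] [Fintype A] [DecidableEq A]

lemma aux_avoid (Q : Finset A) (h : Q.card < Fintype.card A) : ∃ x, x ∉ Q := by
  by_contra! hh
  have : Q = univ := by ext; simp [hh]
  rw [this, card_univ] at h
  omega

lemma aux_half (hinv : ∃! ι : A, ι ≠ 0 ∧ ι + ι = 0) (m : A) :
    ∃ H : Finset A, H.card ≤ 2 ∧ ∀ x, x + x = m → x ∈ H := by
  obtain ⟨ι, h1, h2⟩ := hinv
  by_cases h : ∃ x0 : A, x0 + x0 = m
  · obtain ⟨x0, hx0⟩ := h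
    refine ⟨{x0, x0 + ι}, card_le_two, ?_⟩
    intro x hx
    by_cases e : x = x0
    · simp [e]
    · have := h2 (x - x0) ⟨sub_ne_zero.mpr e, by
        have : x - x0 + (x - x0) = (x + x) - (x0 + x0) := by abel
        rw [this, hx, hx0, sub_self]⟩
      simp [← this]
  · exact ⟨∅, by simp, fun x hx => (h ⟨x, hx⟩).elim⟩

lemma aux_sub (Q : Finset A) (j : ℕ) (h : Q.card + j ≤ Fintype.card A) :
    ∃ R : Finset A, R.card = j ∧ Disjoint Q R := by
  obtain ⟨R, hR, hc⟩ := Finset.exists_subset_card_eq (s := Qᶜ) (n := j)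
    (by rw [card_compl]; omega)
  refine ⟨R, hc, ?_⟩
  rw [Finset.disjoint_left]
  intro x hx hx'
  exact (mem_compl.mp (hR hx')) hx

lemma aux_pick2 (hinv : ∃! ι : A, ι ≠ 0 ∧ ι + ι = 0) (Q : Finset A) (m : A)
    (h : 2 * Q.card + 2 < Fintype.card A) :
    ∃ x y, x ∉ Q ∧ y ∉ Q ∧ x ≠ y ∧ x + y = m := by
  obtain ⟨H, hH, hH'⟩ := aux_half hinv m
  obtain ⟨x, hx⟩ := aux_avoid (Q ∪ (Q.image (fun q => m - q) ∪ H)) (by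
    have h1 := card_union_le Q (Q.image (fun q => m - q) ∪ H)
    have h2 := card_union_le (Q.image (fun q => m - q)) H
    have h3 : (Q.image (fun q => m - q)).card ≤ Q.card := card_image_le
    omega)
  simp only [mem_union, mem_image, not_or, not_exists, not_and] at hx
  refine ⟨x, m - x, hx.1, fun hq => hx.2.1 _ hq (by abel), ?_, by abel⟩
  intro e
  exact hx.2.2 (hH' x (by nth_rewrite 2 [e]; abel))

lemma aux_sum {ι : A} (h1 : ι ≠ 0 ∧ ι + ι = 0) (h2 : ∀ y : A, y ≠ 0 ∧ y + y = 0 → y = ι) :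
    ∑ x : A, x = ι := by
  have h : ∑ x ∈ univ.erase ι, x = 0 := by
    apply Finset.sum_involution (fun x _ => -x)
    · intro x _; abel
    · intro x hx hx0 e
      have : x = ι := h2 x ⟨hx0, by nth_rewrite 1 [← e]; abel⟩
      simp [this] at hx
    · intro x _; simp
    · intro x hx
      simp only [mem_erase, mem_univ, and_true, ne_eq] at hx ⊢
      intro e
      apply hx
      rw [← neg_neg x, e]
      exact neg_eq_of_add_eq_zero_left h1.2
  rw [← Finset.add_sum_erase univ _ (mem_univ ι), h, add_zero]

lemma aux_small (a c : A) (k : ℕ) (hk : 2 ≤ k) (hk2 : 2 * k < Fintype.card A) :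
    ∃ S : Finset A, S.card = k ∧ a ∉ S ∧ a + ∑ x ∈ S, x ∉ S ∧ a + ∑ x ∈ S, x ≠ c := by
  obtain ⟨S1, hS1, hd1⟩ := aux_sub {a} (k - 2) (by simp; omega)
  simp only [disjoint_singleton_left] at hd1
  obtain ⟨z, hz⟩ := aux_avoid (insert a (insert (- a - ∑ x ∈ S1, x) S1)) (by
    have := card_insert_le a (insert (- a - ∑ x ∈ S1, x) S1)
    have := card_insert_le (- a - ∑ x ∈ S1, x) S1
    omega)
  simp only [mem_insert, not_or] at hz
  obtain ⟨hza, hzs, hz1⟩ := hz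
  obtain ⟨S0, hS0⟩ : ∃ S0, S0 = insert z S1 := ⟨_, rfl⟩
  have hc0 : S0.card = k - 1 := by rw [hS0, card_insert_of_notMem hz1]; omega
  have ha0 : a ∉ S0 := by simp [hS0, hd1, Ne.symm hza]
  have hs0 : a + ∑ x ∈ S0, x ≠ 0 := by
    rw [hS0, sum_insert hz1]
    intro e
    apply hzs
    rw [← sub_eq_zero, ← e]; abel
  obtain ⟨s, hs⟩ : ∃ s, s = a + ∑ x ∈ S0, x := ⟨_, rfl⟩
  rw [← hs] at hs0
  obtain ⟨x, hx⟩ := aux_avoid (insert a (insert (c - s) (S0 ∪ S0.image (fun q => q - s)))) (by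
    have := card_insert_le a (insert (c - s) (S0 ∪ S0.image (fun q => q - s)))
    have := card_insert_le (c - s) (S0 ∪ S0.image (fun q => q - s))
    have := card_union_le S0 (S0.image (fun q => q - s))
    have : (S0.image (fun q => q - s)).card ≤ S0.card := card_image_le
    omega)
  simp only [mem_insert, mem_union, mem_image, not_or, not_exists, not_and] at hx
  obtain ⟨hxa, hxc, hx0, hxi⟩ := hx
  have hw : a + ∑ y ∈ insert x S0, y = s + x := by
    rw [sum_insert hx0, hs]; abel
  refine ⟨insert x S0, ?_, ?_, ?_, ?_⟩
  · rw [card_insert_of_notMem hx0]; omega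
  · simp [ha0, Ne.symm hxa]
  · rw [hw, mem_insert, not_or]
    refine ⟨by simpa using hs0, fun h => hxi _ h (by abel)⟩
  · rw [hw]
    intro e
    apply hxc
    rw [← e]; abel

lemma aux_large (hinv : ∃! ι : A, ι ≠ 0 ∧ ι + ι = 0) (hn : 7 ≤ Fintype.card A)
    (a c : A) (r : ℕ) (hk : 2 ≤ r) (hk2 : 2 * r < Fintype.card A) :
    ∃ R : Finset A, R.card = r ∧ a ∉ R ∧ ∑ x, x - ∑ x ∈ R, x ∈ insert a R ∧
      ∑ x, x - ∑ x ∈ R, x ≠ c := by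
  obtain ⟨σ, hσ⟩ : ∃ σ, σ = ∑ x : A, x := ⟨_, rfl⟩
  rw [← hσ]
  by_cases hca : c = a
  · subst hca
    by_cases hr : 3 ≤ r
    · obtain ⟨x, hx⟩ := aux_avoid {c} (by simp; omega)
      simp only [mem_singleton] at hx
      have hcc : ({c, x} : Finset A).card = 2 := card_pair (Ne.symm hx)
      obtain ⟨R1, hR1, hd1⟩ := aux_sub {c, x} (r - 3) (by omega)
      obtain ⟨y, z, hy, hz, hyz, hsum⟩ := aux_pick2 hinv ({c, x} ∪ R1)
        (σ - x - x - ∑ u ∈ R1, u) (by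
          rw [card_union_of_disjoint hd1]; omega)
      simp only [mem_union, mem_insert, mem_singleton, not_or] at hy hz
      simp only [disjoint_insert_left, disjoint_singleton_left] at hd1
      have hxn : x ∉ insert y (insert z R1) := by
        simp [hd1, Ne.symm hy.1.2, Ne.symm hz.1.2]
      have hyn : y ∉ insert z R1 := by simp [hyz, hy]
      have hw : σ - ∑ u ∈ insert x (insert y (insert z R1)), u = x := by
        rw [sum_insert hxn, sum_insert hyn, sum_insert hz.2, ← add_assoc y, hsum]; abel
      refine ⟨insert x (insert y (insert z R1)), ?_, ?_, ?_, ?_⟩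
      · rw [card_insert_of_notMem hxn, card_insert_of_notMem hyn, card_insert_of_notMem hz.2]
        omega
      · simp [Ne.symm hx, Ne.symm hy.1.1, Ne.symm hz.1.1, hd1]
      · rw [hw]; simp
      · rw [hw]; exact hx
    · have hr2 : r = 2 := by omega
      subst hr2
      obtain ⟨ι, h1, h2⟩ := id hinv
      have hσι : σ = ι := by rw [hσ]; exact aux_sum h1 h2
      have key : ∀ x : A, x ≠ c → ι - x - x ≠ c → ι - x - x ≠ x →
          ∃ R : Finset A, R.card = 2 ∧ c ∉ R ∧ σ - ∑ x ∈ R, x ∈ insert c R ∧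
          σ - ∑ x ∈ R, x ≠ c := by
        intro x e1 e2 e3
        have hw : σ - ∑ u ∈ ({x, ι - x - x} : Finset A), u = x := by
          rw [sum_pair (Ne.symm e3), hσι]; abel
        refine ⟨{x, ι - x - x}, card_pair (Ne.symm e3), ?_, ?_, ?_⟩
        · simp [Ne.symm e1, Ne.symm e2]
        · rw [hw]; simp
        · rw [hw]; exact e1
      by_cases hc0 : c ≠ 0 ∧ c ≠ ι
      · exact key 0 (Ne.symm hc0.1) (by simpa using Ne.symm hc0.2) (by simpa using h1.1)
      · obtain ⟨H, hH, hH'⟩ := aux_half hinv ι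
        obtain ⟨x, hx⟩ := aux_avoid (insert 0 (insert ι H)) (by
          have := card_insert_le 0 (insert ι H)
          have := card_insert_le ι H
          omega)
        simp only [mem_insert, not_or] at hx
        obtain ⟨hx0, hxι, hxH⟩ := hx
        have hxx : x + x ≠ ι := fun h => hxH (hH' _ h)
        have hxx0 : x + x ≠ 0 := fun h => hxι (h2 x ⟨hx0, h⟩)
        have hii := h1.2
        have key2 : ∀ x : A, x ≠ 0 → x ≠ ι → x + x ≠ ι → x + x ≠ 0 → x + x + x ≠ ι →
          ∃ R : Finset A, R.card = 2 ∧ c ∉ R ∧ σ - ∑ x ∈ R, x ∈ insert c R ∧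
          σ - ∑ x ∈ R, x ≠ c := by
          intro x e1 e2 e3 e4 e5
          have hc : c = 0 ∨ c = ι := by tauto
          apply key x
          · rcases hc with h | h <;> rw [h] <;> assumption
          · rcases hc with h | h <;> rw [h] <;> intro e
            · apply e3; rw [sub_sub, sub_eq_zero] at e; exact e.symm
            · apply e4; rw [sub_sub, sub_eq_self] at e; exact e
          · intro e
            apply e5
            nth_rewrite 3 [← e]; abel
        by_cases h3 : x + x + x = ι
        · apply key2 (x + x) hxx0 hxx
          · intro e
            apply hx0
            have : x = (x + x + (x + x)) - (x + x + x) := by abel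
            rw [this, e, h3, sub_self]
          · intro e
            apply hxι
            have : x = (x + x + (x + x)) - (x + x + x) := by abel
            rw [this, e, h3, zero_sub]
            exact neg_eq_of_add_eq_zero_left hii
          · intro e
            apply h1.1
            have : ι = (x + x + x) + (x + x + x) := by rw [← e]; abel
            rw [this, h3, hii]
        · exact key2 x hx0 hxι hxx hxx0 h3
  · obtain ⟨R1, hR1, hd1⟩ := aux_sub {a} (r - 2) (by simp; omega)
    simp only [disjoint_singleton_left] at hd1
    obtain ⟨y, z, hy, hz, hyz, hsum⟩ := aux_pick2 hinv (insert a R1)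
        (σ - a - ∑ u ∈ R1, u) (by
          rw [card_insert_of_notMem hd1]; omega)
    simp only [mem_insert, not_or] at hy hz
    have hyn : y ∉ insert z R1 := by simp [hyz, hy]
    have hw : σ - ∑ u ∈ (insert y (insert z R1)), u = a := by
      rw [sum_insert hyn, sum_insert hz.2, ← add_assoc y, hsum]; abel
    refine ⟨(insert y (insert z R1)), ?_, ?_, ?_, ?_⟩
    · rw [card_insert_of_notMem hyn, card_insert_of_notMem hz.2]
      omega
    · simp [Ne.symm hy.1, Ne.symm hz.1, hd1]
    · rw [hw]; simp
    · rw [hw]; exact Ne.symm hca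

lemma aux_main (hinv : ∃! ι : A, ι ≠ 0 ∧ ι + ι = 0) (hn : 7 ≤ Fintype.card A)
    (a c : A) (k : ℕ) (hk : 2 ≤ k) (hk2 : k + 3 ≤ Fintype.card A) :
    ∃ S : Finset A, S.card = k ∧ a ∉ S ∧ a + ∑ x ∈ S, x ∉ S ∧ a + ∑ x ∈ S, x ≠ c := by
  by_cases h : 2 * k < Fintype.card A
  · exact aux_small a c k hk h
  · obtain ⟨R, hR, haR, hm, hc⟩ := aux_large hinv hn a c (Fintype.card A - 1 - k)
      (by omega) (by omega)
    have hw : a + ∑ x ∈ (insert a R)ᶜ, x = ∑ x, x - ∑ x ∈ R, x := by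
      rw [← Finset.sum_add_sum_compl (insert a R) (fun x => x), sum_insert haR]; abel
    refine ⟨(insert a R)ᶜ, ?_, by simp, ?_, ?_⟩
    · rw [card_compl, card_insert_of_notMem haR]; omega
    · rw [hw, mem_compl, not_not]; exact hm
    · rw [hw]; exact hc
end grp

lemma aux_assign {V A : Type} [AddCommGroup A] [DecidableEq V] [DecidableEq A]
    (C : Finset V) (S : Finset A) (h : C.card = S.card) :
    ∃ F : V → A, Set.InjOn F C ∧ (∀ u ∈ C, F u ∈ S) ∧ ∑ u ∈ C, F u = ∑ x ∈ S, x := by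
  let e : C ≃ S := Finset.equivOfCardEq h
  let F : V → A := fun u => if hu : u ∈ C then (e ⟨u, hu⟩ : A) else 0
  have hF : ∀ u (hu : u ∈ C), F u = e ⟨u, hu⟩ := fun u hu => by simp [F, hu]
  have hinj : Set.InjOn F C := by
    intro u hu v hv huv
    rw [hF u hu, hF v hv] at huv
    have := e.injective (Subtype.ext huv)
    exact congrArg Subtype.val this
  have hmem : ∀ u ∈ C, F u ∈ S := fun u hu => by rw [hF u hu]; exact (e ⟨u, hu⟩).2
  refine ⟨F, hinj, hmem, ?_⟩
  have himg : C.image F = S := by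
    apply Finset.eq_of_subset_of_card_le
    · intro x hx
      obtain ⟨u, hu, rfl⟩ := Finset.mem_image.mp hx
      exact hmem u hu
    · rw [Finset.card_image_of_injOn hinj, h]
  rw [← himg, Finset.sum_image hinj]

def AuxInv {V A : Type} [Fintype V] (T : SimpleGraph V) [DecidableRel T.Adj] [AddCommGroup A]
    (u : V) (x w : A) : Prop :=
  (T.degree u = 1 → x ≠ w) ∧ (T.degree u = 2 → (∃ l, T.Adj u l ∧ T.degree l = 1) → x ≠ 0)

lemma aux_big {V A : Type} [Fintype V] (T : SimpleGraph V) [DecidableRel T.Adj] [AddCommGroup A]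
    [DecidableEq V]
    (hdeg2 : ∀ v : V, T.degree v = 2 → ∃ u : V, T.Adj v u ∧ T.degree u = 2)
    (v u : V) (x w : A) (hv : 3 ≤ T.degree v) (huv : T.Adj u v) (hxw : x ≠ w) :
    AuxInv T u x w := by
  refine ⟨fun _ => hxw, ?_⟩
  rintro h2 ⟨l, hl, hl1⟩
  exfalso
  obtain ⟨m, hm, hm2⟩ := hdeg2 u h2
  have hsub : ({v, l, m} : Finset V) ⊆ T.neighborFinset u := by
    intro y hy
    simp only [mem_insert, mem_singleton] at hy
    rw [mem_neighborFinset]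
    rcases hy with rfl | rfl | rfl <;> assumption
  have hc := Finset.card_le_card hsub
  rw [card_neighborFinset_eq_degree, h2, Finset.card_eq_three.mpr
    ⟨v, l, m, by rintro rfl; omega, by rintro rfl; omega, by rintro rfl; omega, rfl⟩] at hc
  omega

lemma aux_par {V : Type} (T : SimpleGraph V) (hT : T.IsTree) (r v : V) (hv : v ≠ r) :
    ∃ p, T.Adj v p ∧ T.dist r v = T.dist r p + 1 ∧
      ∀ u, T.Adj v u → T.dist r v = T.dist r u + 1 → u = p := by
  have hex : ∃ p, T.Adj v p ∧ T.dist r v = T.dist r p + 1 := by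
    obtain ⟨p, hp⟩ := hT.connected.exists_walk_length_eq_dist v r
    cases p with
    | nil => exact (hv rfl).elim
    | @cons _ u _ h q =>
      refine ⟨u, h, ?_⟩
      have h1 := T.dist_le q
      rw [Walk.length_cons, T.dist_comm] at hp
      rw [T.dist_comm] at h1
      rcases hT.dist_eq_dist_add_one_of_adj r h with e | e <;> omega
  obtain ⟨p, hp, hpd⟩ := hex
  refine ⟨p, hp, hpd, ?_⟩
  intro u hu hud
  have key : ∀ u (hu : T.Adj v u), T.dist r v = T.dist r u + 1 →
      ∃ q : T.Walk r v, q.IsPath ∧ q.penultimate = u := by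
    intro u hu hud
    obtain ⟨q, hq⟩ := hT.connected.exists_walk_length_eq_dist r u
    refine ⟨q.concat hu.symm, ?_, Walk.penultimate_concat _ _⟩
    apply Walk.isPath_of_length_eq_dist
    rw [Walk.length_concat, hq, hud]
  obtain ⟨q1, hq1, e1⟩ := key u hu hud
  obtain ⟨q2, hq2, e2⟩ := key p hp hpd
  have := (hT.existsUnique_path r v).unique hq1 hq2
  rw [← e1, ← e2, this]

lemma aux_local {V : Type} [Fintype V] [DecidableEq V] (T : SimpleGraph V)
    [DecidableRel T.Adj] (hT : T.IsTree)
    (hdeg2 : ∀ v : V, T.degree v = 2 → ∃ u : V, T.Adj v u ∧ T.degree u = 2)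
    {A : Type} [AddCommGroup A] [Fintype A] [DecidableEq A]
    (hinv : ∃! ι : A, ι ≠ 0 ∧ ι + ι = 0)
    (hcard : T.maxDegree + 2 ≤ Fintype.card A) (ht : 5 ≤ T.maxDegree) (r : V)
    (hr : T.degree r = T.maxDegree) (C : V → Finset V)
    (hC : ∀ v u, u ∈ C v ↔ T.Adj v u ∧ T.dist r u = T.dist r v + 1)
    (hN : ∀ v, v ≠ r → ∃ p, p ∉ C v ∧ T.neighborFinset v = insert p (C v))
    (hNr : T.neighborFinset r = C r)
    (v : V) (a c : A) :
    ∃ F : V → A, AuxInv T v a c → Set.InjOn F (C v) ∧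
      (v ≠ r → (∀ u ∈ C v, F u ≠ a) ∧ (if v = r then 0 else a) + ∑ u ∈ C v, F u ≠ c) ∧
      ∀ u ∈ C v, AuxInv T u (F u) ((if v = r then 0 else a) + ∑ u ∈ C v, F u) := by
  have hle := T.degree_le_maxDegree v
  by_cases hvr : v = r
  · subst hvr
    obtain ⟨S, hS, h0S, hm, hc⟩ := aux_main hinv (by omega) (0 : A) 0 (T.maxDegree - 1)
      (by omega) (by omega)
    rw [zero_add] at hm hc
    obtain ⟨F, hF1, hF2, hF3⟩ := aux_assign (C v) (insert 0 S) (by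
      rw [card_insert_of_notMem h0S, ← hNr, card_neighborFinset_eq_degree]; omega)
    refine ⟨F, fun _ => ⟨hF1, fun h => (h rfl).elim, ?_⟩⟩
    intro u hu
    rw [if_pos rfl, hF3, sum_insert h0S, zero_add]
    refine aux_big T hdeg2 v u _ _ (by omega) ((hC _ _).mp hu).1.symm ?_
    intro e
    have := hF2 u hu
    rw [e, zero_add, mem_insert] at this
    tauto
  · obtain ⟨p, hp, hNp⟩ := hN v hvr
    have hcC : (C v).card + 1 = T.degree v := by
      rw [← card_neighborFinset_eq_degree, hNp, card_insert_of_notMem hp]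
    simp only [if_neg hvr]
    by_cases h3 : 3 ≤ T.degree v
    · obtain ⟨S, hS, haS, hm, hc⟩ := aux_main hinv (by omega) a c (T.degree v - 1)
        (by omega) (by omega)
      obtain ⟨F, hF1, hF2, hF3⟩ := aux_assign (C v) S (by omega)
      refine ⟨F, fun _ => ⟨hF1, fun _ => ⟨fun u hu e => haS (e ▸ hF2 u hu), ?_⟩, ?_⟩⟩
      · rw [hF3]; exact hc
      · intro u hu
        rw [hF3]
        exact aux_big T hdeg2 v u _ _ h3 ((hC _ _).mp hu).1.symm
          (fun e => hm (e ▸ hF2 u hu))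
    · by_cases h1 : (C v).card = 0
      · rw [card_eq_zero] at h1
        rw [h1]
        refine ⟨0, fun hI => ⟨by simp, fun _ => ⟨by simp, ?_⟩, by simp⟩⟩
        simp only [sum_empty, add_zero]
        exact hI.1 (by rw [← hcC, h1]; rfl)
      · obtain ⟨u, hu⟩ := card_eq_one.mp (show (C v).card = 1 by omega)
        obtain ⟨x, hx⟩ := aux_avoid ({a, c - a, 0} : Finset A) (by
          have := card_le_three (a := a) (b := c - a) (c := 0)
          omega)
        simp only [mem_insert, mem_singleton, not_or] at hx
        have huC : u ∈ C v := by rw [hu]; simp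
        rw [hu]
        refine ⟨fun _ => x, fun hI => ⟨by simp, fun _ => ⟨fun _ _ => hx.1, ?_⟩, ?_⟩⟩
        · simp only [sum_singleton]
          intro e
          apply hx.2.1
          rw [← e]; abel
        · intro u' hu'
          rw [mem_singleton] at hu'
          subst hu'
          simp only [sum_singleton]
          refine ⟨fun hd e => ?_, fun _ _ => hx.2.2⟩
          apply hI.2 (by rw [← hcC, hu]; rfl) ⟨u', ((hC _ _).mp huC).1, hd⟩
          simpa using e

noncomputable def auxG {V A : Type} [AddCommGroup A] (par : V → V) (F : V → A → A → V → A)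
    (W : V → A → A → A) : ℕ → V → A × A
  | 0, _ => (0, 0)
  | n + 1, v =>
    (F (par v) (auxG par F W n (par v)).1 (auxG par F W n (par v)).2 v,
     W (par v) (auxG par F W n (par v)).1 (auxG par F W n (par v)).2)

/-- Let `T` be a tree with maximum degree `t ≥ 5` such that every vertex of degree `2`
has at least one neighbor of degree `2`, and let `𝒢` be an Abelian group with exactly
one involution and `|𝒢| ≥ t + 2`.  Then there exists a `𝒢`-twin edge coloring of `T`. -/
theorem tree_twin_coloring_of_unique_involution {V : Type} [Fintype V] (T : SimpleGraph V)
    [DecidableRel T.Adj] (hT : T.IsTree) (ht : 5 ≤ T.maxDegree)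
    (hdeg2 : ∀ v : V, T.degree v = 2 → ∃ u : V, T.Adj v u ∧ T.degree u = 2)
    (A : Type) [AddCommGroup A] [Fintype A]
    (hinv : ∃! ι : A, ι ≠ 0 ∧ ι + ι = 0)
    (hcard : T.maxDegree + 2 ≤ Fintype.card A) :
    ∃ f : Sym2 V → A, IsTwinEdgeColoring T f := by
  classical
  have := hT.connected.nonempty
  obtain ⟨r, hr⟩ := T.exists_maximal_degree_vertex
  have hpar0 : ∀ v, ∃ p, v ≠ r → T.Adj v p ∧ T.dist r v = T.dist r p + 1 ∧
      ∀ u, T.Adj v u → T.dist r v = T.dist r u + 1 → u = p := by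
    intro v
    by_cases h : v = r
    · exact ⟨r, fun h' => (h' h).elim⟩
    · obtain ⟨p, hp⟩ := aux_par T hT r v h
      exact ⟨p, fun _ => hp⟩
  choose par hpar using hpar0
  obtain ⟨C, hC⟩ : ∃ C : V → Finset V,
      ∀ v u, u ∈ C v ↔ T.Adj v u ∧ T.dist r u = T.dist r v + 1 :=
    ⟨fun v => univ.filter (fun u => T.Adj v u ∧ T.dist r u = T.dist r v + 1), by simp⟩
  have hd : ∀ {u v}, T.Adj u v → T.dist r u = T.dist r v + 1 ∨ T.dist r v = T.dist r u + 1 :=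
    fun h => hT.dist_eq_dist_add_one_of_adj r h
  have hparC : ∀ v, v ≠ r → par v ∉ C v ∧ T.neighborFinset v = insert (par v) (C v) := by
    intro v hv
    obtain ⟨h1, h2, h3⟩ := hpar v hv
    refine ⟨fun h => ?_, ?_⟩
    · have := ((hC _ _).mp h).2
      omega
    · ext u
      rw [mem_neighborFinset, mem_insert, hC]
      constructor
      · intro h
        rcases hd h with e | e
        · exact Or.inl (h3 u h e)
        · exact Or.inr ⟨h, e⟩
      · rintro (rfl | h)
        · exact h1
        · exact h.1
  have hNr : T.neighborFinset r = C r := by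
    ext u
    rw [mem_neighborFinset, hC]
    refine ⟨fun h => ⟨h, ?_⟩, fun h => h.1⟩
    rcases hd h with e | e
    · rw [T.dist_self] at e; omega
    · exact e
  choose F hF using aux_local T hT hdeg2 hinv hcard ht r hr.symm C hC
    (fun v hv => ⟨par v, hparC v hv⟩) hNr
  let W : V → A → A → A := fun v a c => (if v = r then 0 else a) + ∑ u ∈ C v, F v a c u
  let g : V → A × A := fun v => auxG par F W (T.dist r v) v
  have hg : ∀ v u, u ∈ C v → g u = (F v (g v).1 (g v).2 u, W v (g v).1 (g v).2) := by
    intro v u hu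
    obtain ⟨h1, h2⟩ := (hC v u).mp hu
    have hur : u ≠ r := by
      rintro rfl
      rw [T.dist_self] at h2; omega
    have hpu : v = par u := (hpar u hur).2.2 v h1.symm h2
    simp only [g]
    rw [h2, auxG, ← hpu]
  have hI : ∀ n v, T.dist r v = n → AuxInv T v (g v).1 (g v).2 := by
    intro n
    induction n with
    | zero =>
      intro v hv
      have : r = v := hT.connected.dist_eq_zero_iff.mp hv
      subst this
      exact ⟨fun h => by omega, fun h => by omega⟩
    | succ n ih =>
      intro v hv
      have hvr : v ≠ r := by
        rintro rfl
        rw [T.dist_self] at hv; omega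
      obtain ⟨h1, h2, h3⟩ := hpar v hvr
      have hvC : v ∈ C (par v) := (hC _ _).mpr ⟨h1.symm, h2⟩
      rw [hg (par v) v hvC]
      exact (hF (par v) _ _ (ih (par v) (by omega))).2.2 v hvC
  let f0 : V → V → A := fun u v =>
    if T.dist r u < T.dist r v then (g v).1 else if T.dist r v < T.dist r u then (g u).1 else 0
  have hsymm : ∀ u v, f0 u v = f0 v u := by
    intro u v
    simp only [f0]
    split_ifs <;> first | rfl | omega
  let f : Sym2 V → A := Sym2.lift ⟨f0, hsymm⟩
  have hfC : ∀ v u, u ∈ C v → f s(v, u) = F v (g v).1 (g v).2 u := by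
    intro v u hu
    have h2 := ((hC v u).mp hu).2
    have : f s(v, u) = (g u).1 := by
      simp only [f, Sym2.lift_mk, f0]
      rw [if_pos (by omega)]
    rw [this, hg v u hu]
  have hfp : ∀ v, v ≠ r → f s(v, par v) = (g v).1 := by
    intro v hv
    have h2 := (hpar v hv).2.1
    simp only [f, Sym2.lift_mk, f0]
    rw [if_neg (by omega), if_pos (by omega)]
  have hW : ∀ v, ∑ x ∈ T.neighborFinset v, f s(x, v) = W v (g v).1 (g v).2 := by
    intro v
    simp only [Sym2.eq_swap (b := v)]
    have hs : ∑ x ∈ C v, f s(v, x) = ∑ x ∈ C v, F v (g v).1 (g v).2 x :=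
      sum_congr rfl (fun x hx => hfC v x hx)
    by_cases hv : v = r
    · simp only [W, if_pos hv, zero_add]
      rw [← hs, hv, hNr]
    · simp only [W, if_neg hv]
      rw [(hparC v hv).2, sum_insert (hparC v hv).1, hfp v hv, hs]
  have hcases : ∀ u v, T.Adj u v → v ∈ C u ∨ (u ≠ r ∧ v = par u) := by
    intro u v h
    by_cases hu : u = r
    · left
      rw [hu, ← hNr, mem_neighborFinset, ← hu]
      exact h
    · have : v ∈ T.neighborFinset u := by rwa [mem_neighborFinset]
      rw [(hparC u hu).2, mem_insert] at this
      tauto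
  have hne : ∀ u v, v ∈ C u → ∑ x ∈ T.neighborFinset u, f s(x, u) ≠
      ∑ x ∈ T.neighborFinset v, f s(x, v) := by
    intro u v hv
    have hvr : v ≠ r := by
      rintro rfl
      have := ((hC _ _).mp hv).2
      rw [T.dist_self] at this; omega
    rw [hW, hW]
    have h := ((hF v _ _ (hI _ v rfl)).2.1 hvr).2
    have h2 : (g v).2 = W u (g u).1 (g u).2 := by rw [hg u v hv]
    intro e
    exact h (e.symm.trans h2.symm)
  refine ⟨f, ?_, ?_⟩
  · intro u v w huv huw hvw
    have hFu := hF u _ _ (hI _ u rfl)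
    rcases hcases u v huv with h1 | ⟨hu, h1⟩ <;> rcases hcases u w huw with h2 | ⟨hu', h2⟩
    · rw [hfC u v h1, hfC u w h2]
      exact fun e => hvw (hFu.1 h1 h2 e)
    · rw [hfC u v h1, h2, hfp u hu']
      exact (hFu.2.1 hu').1 v h1
    · rw [hfC u w h2, h1, hfp u hu]
      exact ((hFu.2.1 hu).1 w h2).symm
    · exact (hvw (h1.trans h2.symm)).elim
  · intro u v huv
    rcases hd huv with e | e
    · exact (hne v u ((hC _ _).mpr ⟨huv.symm, e⟩)).symm
    · exact hne u v ((hC _ _).mpr ⟨huv, e⟩)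
end

section
/- Let T be a tree with maximum degree t ≥ 5 such that every vertex of degree 2 has at least one neighbor of degree 2, and let 𝒢 be an Abelian group of order k ≥ t + 2 having more than one involution. If 𝒢 is not isomorphic to (ℤ_2)^p for any integer p with 2^p ∈ {t+2, t+3}, then there exists a 𝒢-twin edge coloring of T. -/
open Finset SimpleGraph

set_option linter.unusedSectionVars false
section comb
variable {A : Type} [AddCommGroup A] [Fintype A]

lemma ttc_exists_notMem [DecidableEq A] (F : Finset A) (h : F.card < Fintype.card A) : ∃ x, x ∉ F := by
  by_contra hc
  push Not at hc
  rw [(Finset.eq_univ_iff_forall).2 hc, Finset.card_univ] at h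
  exact lt_irrefl _ h

lemma ttc_sum_mem {i : A} (hi : i ≠ 0) (hi2 : i + i = 0) :
    ∑ x : A, x ∈ AddSubgroup.zmultiples i := by
  classical
  rw [← QuotientAddGroup.eq_zero_iff]
  have h1 : ((∑ x : A, x : A) : A ⧸ AddSubgroup.zmultiples i)
      = ∑ x : A, (x : A ⧸ AddSubgroup.zmultiples i) :=
    map_sum (QuotientAddGroup.mk' (AddSubgroup.zmultiples i)) (fun x : A => x) Finset.univ
  rw [h1]
  have hi0 : ((i : A) : A ⧸ AddSubgroup.zmultiples i) = 0 := by
    rw [QuotientAddGroup.eq_zero_iff]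
    exact AddSubgroup.mem_zmultiples i
  refine Finset.sum_involution (fun x _ => if x + x = 0 then x + i else -x) ?_ ?_ ?_ ?_
  · intro x _
    split_ifs with h
    · rw [QuotientAddGroup.mk_add, hi0, add_zero, ← QuotientAddGroup.mk_add, h]; rfl
    · rw [QuotientAddGroup.mk_neg]; simp
  · intro x _ _
    split_ifs with h
    · simpa using hi
    · intro h'
      apply h
      nth_rewrite 1 [← h']
      simp
  · intro x _; simp
  · intro x _
    by_cases h : x + x = 0
    · have : x + i + (x + i) = 0 := by
        rw [add_add_add_comm, h, hi2, add_zero]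
      simp only [h, if_true, this, add_assoc, hi2, add_zero]
    · have : ¬ (-x + -x = 0) := by
        intro h'; apply h; rw [← neg_add, neg_eq_zero] at h'; exact h'
      simp only [h, if_false, this, neg_neg]

lemma ttc_sum_zero {i j : A} (hij : i ≠ j) (hi : i ≠ 0) (hi2 : i + i = 0) (hj : j ≠ 0)
    (hj2 : j + j = 0) : ∑ x : A, x = 0 := by
  have key : ∀ {i : A}, i + i = 0 → ∀ s ∈ AddSubgroup.zmultiples i, s = 0 ∨ s = i := by
    intro i hi2 s hs
    obtain ⟨n, rfl⟩ := AddSubgroup.mem_zmultiples_iff.1 hs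
    rcases Int.even_or_odd' n with ⟨c, rfl | rfl⟩
    · left
      rw [mul_comm, mul_zsmul, two_zsmul, hi2, smul_zero]
    · right
      rw [add_zsmul, mul_comm, mul_zsmul, two_zsmul, hi2, smul_zero, one_zsmul, zero_add]
  rcases key hi2 _ (ttc_sum_mem hi hi2) with h | h
  · exact h
  · rcases key hj2 _ (ttc_sum_mem hj hj2) with h' | h'
    · exact h'
    · exact absurd (h.symm.trans h') hij

lemma ttc_image [DecidableEq A] {i : A} (hi : i ≠ 0) (hi2 : i + i = 0) :
    2 * (Finset.univ.image (fun x : A => x + x)).card ≤ Fintype.card A := by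
  rw [← Finset.card_univ (α := A)]
  apply Finset.mul_card_image_le_card
  intro b hb
  obtain ⟨x, -, rfl⟩ := Finset.mem_image.1 hb
  have : ({x, x + i} : Finset A).card = 2 := Finset.card_pair (by simpa using hi)
  rw [← this]
  apply Finset.card_le_card
  intro y hy
  simp only [Finset.mem_insert, Finset.mem_singleton] at hy
  simp only [Finset.mem_filter, Finset.mem_univ, true_and]
  rcases hy with rfl | rfl
  · rfl
  · rw [add_add_add_comm, hi2, add_zero]

lemma ttc_P0 [DecidableEq A] {i : A} (hi : i ≠ 0) (hi2 : i + i = 0) (E : Finset A) (hE : E.card ≤ 2)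
    (n : ℕ) (hn : 3 ≤ n) (hk : 2 * n + 2 ≤ Fintype.card A) (g : A) :
    ∃ S : Finset A, Disjoint S E ∧ S.card = n ∧ ∑ x ∈ S, x = g := by
  have hD := ttc_image hi hi2
  set D := Finset.univ.image (fun x : A => x + x) with hDdef
  obtain ⟨S, hSE, hS⟩ : ∃ S ⊆ Eᶜ, S.card = n - 3 := by
    apply Finset.exists_subset_card_eq
    rw [Finset.card_compl]; omega
  obtain ⟨z, hz⟩ := ttc_exists_notMem (S ∪ E ∪ D.image (fun d => g - ∑ x ∈ S, x - d)) (by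
    have h1 := Finset.card_union_le (S ∪ E) (D.image (fun d => g - ∑ x ∈ S, x - d))
    have h2 := Finset.card_union_le S E
    have h3 := Finset.card_image_le (s := D) (f := (fun d => g - ∑ x ∈ S, x - d))
    omega)
  simp only [Finset.mem_union, not_or, Finset.mem_image, not_exists, not_and] at hz
  obtain ⟨⟨hzS, hzE⟩, hzD⟩ := hz
  set h := g - ∑ x ∈ S, x - z with hh
  have hhD : ∀ x, x + x ≠ h := by
    intro x hx
    refine hzD h ?_ ?_
    · rw [← hx, hDdef]; exact Finset.mem_image_of_mem _ (Finset.mem_univ x)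
    · rw [hh]; abel
  obtain ⟨x, hx⟩ := ttc_exists_notMem ((E ∪ insert z S) ∪ (E ∪ insert z S).image (fun d => h - d)) (by
    have h1 := Finset.card_union_le (E ∪ insert z S) ((E ∪ insert z S).image (fun d => h - d))
    have h2 := Finset.card_union_le E (insert z S)
    have h3 := Finset.card_image_le (s := E ∪ insert z S) (f := (fun d => h - d))
    have h4 := Finset.card_insert_le z S
    omega)
  rw [Finset.mem_union, not_or] at hx
  obtain ⟨hx1, hx2⟩ := hx
  have hx3 : h - x ∉ E ∪ insert z S := by
    intro hc
    exact hx2 (Finset.mem_image.2 ⟨h - x, hc, by abel⟩)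
  have hxy : x ≠ h - x := by
    intro hc
    apply hhD x
    nth_rewrite 2 [hc]
    abel
  rw [Finset.mem_union, not_or] at hx1 hx3
  have hxI : x ∉ insert (h - x) (insert z S) := by
    rw [Finset.mem_insert, not_or]; exact ⟨hxy, hx1.2⟩
  refine ⟨insert x (insert (h - x) (insert z S)), ?_, ?_, ?_⟩
  · rw [Finset.disjoint_insert_left, Finset.disjoint_insert_left, Finset.disjoint_insert_left]
    refine ⟨hx1.1, hx3.1, hzE, ?_⟩
    rw [← Finset.subset_compl_iff_disjoint_right]; exact hSE
  · rw [Finset.card_insert_of_notMem hxI, Finset.card_insert_of_notMem hx3.2,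
      Finset.card_insert_of_notMem hzS]
    omega
  · rw [Finset.sum_insert hxI, Finset.sum_insert hx3.2, Finset.sum_insert hzS, hh]
    abel

lemma ttc_P [DecidableEq A] {i : A} (hi : i ≠ 0) (hi2 : i + i = 0) (hσ : ∑ x : A, x = 0)
    (hev : Even (Fintype.card A)) (E : Finset A) (hE1 : 1 ≤ E.card)
    (hE : E.card ≤ 2) (n : ℕ) (hn : 3 ≤ n) (hk : n + 3 + E.card ≤ Fintype.card A) (g : A) :
    ∃ S : Finset A, Disjoint S E ∧ S.card = n ∧ ∑ x ∈ S, x = g := by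
  by_cases h2 : 2 * n + 2 ≤ Fintype.card A
  · exact ttc_P0 hi hi2 E hE n hn h2 g
  · obtain ⟨c, hc⟩ := hev
    obtain ⟨S, hSE, hS, hSg⟩ := ttc_P0 hi hi2 E hE (Fintype.card A - E.card - n) (by omega)
      (by omega) (-(∑ x ∈ E, x) - g)
    refine ⟨(S ∪ E)ᶜ, ?_, ?_, ?_⟩
    · rw [← Finset.subset_compl_iff_disjoint_right]
      exact Finset.compl_subset_compl.2 Finset.subset_union_right
    · rw [Finset.card_compl, Finset.card_union_of_disjoint hSE]; omega
    · have := Finset.sum_add_sum_compl (S ∪ E) (fun x : A => x)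
      rw [hσ, Finset.sum_union hSE, hSg] at this
      have h3 := eq_neg_of_add_eq_zero_right this
      rw [h3]; abel

lemma ttc_comb {i j : A} (hij : i ≠ j) (hi : i ≠ 0) (hi2 : i + i = 0) (hj : j ≠ 0)
    (hj2 : j + j = 0) (hk8 : 7 ≤ Fintype.card A) (n : ℕ) (hn : 2 ≤ n)
    (hnk : n + 3 ≤ Fintype.card A) (hne : n + 5 ≤ Fintype.card A ∨ ∃ x : A, x + x ≠ 0) (a W : A) :
    ∃ S : Finset A, S.card = n ∧ a ∉ S ∧ a + ∑ x ∈ S, x ∉ S ∧ a + ∑ x ∈ S, x ≠ W := by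
  classical
  have hσ := ttc_sum_zero hij hi hi2 hj hj2
  have hev : Even (Fintype.card A) := by
    have h1 : addOrderOf i = 2 := addOrderOf_eq_prime (by rw [two_nsmul, hi2]) hi
    rw [even_iff_two_dvd, ← h1]
    exact addOrderOf_dvd_card
  -- coset helper
  have H : ∀ x0 p q : A, ∃ x, x + x = x0 + x0 ∧ x ≠ p ∧ x ≠ q := by
    intro x0 p q
    have e1 : x0 + i + (x0 + i) = x0 + x0 := by rw [add_add_add_comm, hi2, add_zero]
    have e2 : x0 + j + (x0 + j) = x0 + x0 := by rw [add_add_add_comm, hj2, add_zero]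
    have n1 : x0 + i ≠ x0 := by simpa using hi
    have n2 : x0 + j ≠ x0 := by simpa using hj
    have n3 : x0 + i ≠ x0 + j := by simpa using hij
    by_cases c0 : x0 ≠ p ∧ x0 ≠ q
    · exact ⟨x0, rfl, c0⟩
    by_cases c1 : x0 + i ≠ p ∧ x0 + i ≠ q
    · exact ⟨_, e1, c1⟩
    refine ⟨_, e2, ?_, ?_⟩ <;> grind
  -- complement helper
  have K : ∀ C : Finset A, C.card + n + 1 = Fintype.card A → a ∉ C →
      (-(∑ x ∈ C, x) = a ∨ -(∑ x ∈ C, x) ∈ C) → -(∑ x ∈ C, x) ≠ W →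
      ∃ S : Finset A, S.card = n ∧ a ∉ S ∧ a + ∑ x ∈ S, x ∉ S ∧ a + ∑ x ∈ S, x ≠ W := by
    intro C hC haC h1 h2
    have hs : a + ∑ x ∈ (insert a C)ᶜ, x = -(∑ x ∈ C, x) := by
      have := Finset.sum_add_sum_compl (insert a C) (fun x : A => x)
      rw [hσ, Finset.sum_insert haC] at this
      rw [eq_neg_iff_add_eq_zero, ← this]; abel
    refine ⟨(insert a C)ᶜ, ?_, ?_, ?_, ?_⟩
    · rw [Finset.card_compl, Finset.card_insert_of_notMem haC]; omega
    · simp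
    · rw [hs, Finset.mem_compl, not_not, Finset.mem_insert]; exact h1
    · rw [hs]; exact h2
  have hdbl : (∃ x : A, x + x ≠ 0) → ∀ b : A, ∃ x : A, x + x ≠ b := by
    rintro ⟨x, hx⟩ b
    by_cases hb : b = 0
    · exact ⟨x, hb ▸ hx⟩
    · exact ⟨0, by simpa using Ne.symm hb⟩
  by_cases hn2 : n = 2
  · obtain ⟨c, hc⟩ := hev
    obtain ⟨x, hx⟩ := ttc_exists_notMem ({a, -a} : Finset A) (by
      have := Finset.card_le_two (a := a) (b := -a); omega)
    obtain ⟨y, hy⟩ := ttc_exists_notMem ({a, -a, x, W - a - x} : Finset A) (by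
      have := Finset.card_le_four (a := a) (b := -a) (c := x) (d := W - a - x); omega)
    simp only [Finset.mem_insert, Finset.mem_singleton, not_or] at hx hy
    have hxy : x ≠ y := fun h => hy.2.2.1 h.symm
    refine ⟨{x, y}, by rw [Finset.card_pair hxy, hn2], ?_, ?_, ?_⟩
    · simp only [Finset.mem_insert, Finset.mem_singleton, not_or]
      exact ⟨Ne.symm hx.1, Ne.symm hy.1⟩
    · rw [Finset.sum_pair hxy]
      simp only [Finset.mem_insert, Finset.mem_singleton, not_or]
      constructor
      · intro h
        apply hy.2.1
        have : a + y + x = 0 + x := by rw [zero_add]; nth_rewrite 2 [← h]; abel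
        exact (neg_eq_of_add_eq_zero_right (add_right_cancel this)).symm
      · intro h
        apply hx.2
        have : a + x + y = 0 + y := by rw [zero_add]; nth_rewrite 2 [← h]; abel
        exact (neg_eq_of_add_eq_zero_right (add_right_cancel this)).symm
    · rw [Finset.sum_pair hxy]
      intro h
      apply hy.2.2.2
      rw [← h]; abel
  by_cases hWa : W = a
  · subst hWa
    rcases Nat.lt_or_ge (Fintype.card A) (n + 5) with hlt | hge
    · have hx := hne.resolve_left (by omega)
      rcases (by omega : Fintype.card A = n + 3 ∨ Fintype.card A = n + 4) with hc | hc
      · obtain ⟨w0, hw0⟩ := hdbl hx (-W)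
        obtain ⟨w, hw, hw1, hw2⟩ := H w0 W (-(w0 + w0))
        have hne' : w ≠ -(w + w) := by rw [hw]; exact hw2
        have hs : -(∑ x ∈ ({w, -(w + w)} : Finset A), x) = w := by
          rw [Finset.sum_pair hne']; abel
        refine K {w, -(w + w)} (by rw [Finset.card_pair hne']; omega) ?_ ?_ ?_
        · simp only [Finset.mem_insert, Finset.mem_singleton, not_or]
          refine ⟨Ne.symm hw1, ?_⟩
          intro h
          apply hw0
          rw [h, neg_neg, hw]
        · right; rw [hs]; simp
        · rw [hs]; exact hw1
      · obtain ⟨x0, hx0⟩ := hx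
        obtain ⟨x, hx, hx1, hx2⟩ := H x0 W (-W)
        obtain ⟨w, hw, hw1, -⟩ := H 0 W W
        rw [add_zero] at hw
        rw [← hx] at hx0
        have e1 : x ≠ -x := by
          intro h; apply hx0; nth_rewrite 1 [h]; simp
        have e2 : w ≠ x := by rintro rfl; exact hx0 hw
        have e3 : w ≠ -x := by
          rintro rfl; apply hx0
          rw [← neg_add, neg_eq_zero] at hw; exact hw
        have e4 : w ∉ ({x, -x} : Finset A) := by simp [e2, e3]
        have hs : -(∑ x ∈ ({w, x, -x} : Finset A), x) = w := by
          rw [Finset.sum_insert e4, Finset.sum_pair e1, add_neg_cancel, add_zero]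
          exact neg_eq_of_add_eq_zero_right hw
        refine K {w, x, -x} ?_ ?_ ?_ ?_
        · rw [Finset.card_insert_of_notMem e4, Finset.card_pair e1]; omega
        · simp only [Finset.mem_insert, Finset.mem_singleton, not_or]
          refine ⟨Ne.symm hw1, Ne.symm hx1, ?_⟩
          rintro rfl; simp at hx2
        · right; rw [hs]; simp
        · rw [hs]; exact hw1
    · obtain ⟨w, -, hw1, -⟩ := H 0 W W
      have hc2 : ({W, w} : Finset A).card = 2 := Finset.card_pair (Ne.symm hw1)
      obtain ⟨S, hSE, hS, hSg⟩ := ttc_P hi hi2 hσ hev {W, w} (by omega) (by omega) n (by omega)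
        (by omega) (w - W)
      rw [Finset.disjoint_insert_right, Finset.disjoint_singleton_right] at hSE
      refine ⟨S, hS, hSE.1, ?_, ?_⟩
      · rw [hSg, add_sub_cancel]; exact hSE.2
      · rw [hSg, add_sub_cancel]; exact hw1
  · rcases Nat.lt_or_ge (Fintype.card A) (n + 4) with hlt | hge
    · have hx := hne.resolve_left (by omega)
      obtain ⟨x0, hx0⟩ := hdbl hx (-a)
      obtain ⟨x, hx, hx1, hx2⟩ := H x0 a (-a - a)
      rw [← hx] at hx0
      have e1 : x ≠ -a - x := by
        intro h; apply hx0; nth_rewrite 1 [h]; abel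
      have hs : -(∑ x ∈ ({x, -a - x} : Finset A), x) = a := by
        rw [Finset.sum_pair e1]; abel
      refine K {x, -a - x} (by rw [Finset.card_pair e1]; omega) ?_ (Or.inl hs) ?_
      · simp only [Finset.mem_insert, Finset.mem_singleton, not_or]
        refine ⟨Ne.symm hx1, ?_⟩
        intro h; apply hx2
        nth_rewrite 2 [h]; abel
      · rw [hs]; exact Ne.symm hWa
    · obtain ⟨S, hSE, hS, hSg⟩ := ttc_P hi hi2 hσ hev {a} (by simp) (by simp) n (by omega)
        (by simp; omega) 0
      rw [Finset.disjoint_singleton_right] at hSE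
      refine ⟨S, hS, hSE, ?_, ?_⟩
      · rw [hSg, add_zero]; exact hSE
      · rw [hSg, add_zero]; exact Ne.symm hWa

lemma ttc_elem (h : ∀ x : A, x + x = 0) :
    ∃ p : ℕ, 2 ^ p = Fintype.card A ∧ Nonempty (A ≃+ (Fin p → ZMod 2)) := by
  let _ : Module (ZMod 2) A := AddCommGroup.zmodModule (n := 2) (fun x => by rw [two_nsmul, h])
  have e := (Module.finBasis (ZMod 2) A).equivFun.toAddEquiv
  refine ⟨Module.finrank (ZMod 2) A, ?_, ⟨e⟩⟩
  rw [Fintype.card_congr e.toEquiv]; simp [ZMod.card]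

end comb

lemma ttc_assign {V A : Type} [AddCommGroup A] [DecidableEq A] (C : Finset V) (S : Finset A)
    (h : S.card = C.card) : ∃ f : V → A, Set.InjOn f C ∧ C.image f = S := by
  classical
  let e := Finset.equivOfCardEq h.symm
  refine ⟨fun x => if hx : x ∈ C then (e ⟨x, hx⟩ : A) else 0, ?_, ?_⟩
  · intro x hx y hy hxy
    have hx' : x ∈ C := hx
    have hy' : y ∈ C := hy
    simp only [hx', hy', dif_pos] at hxy
    have := e.injective (Subtype.ext hxy)
    exact congrArg Subtype.val this
  · ext s
    simp only [Finset.mem_image]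
    constructor
    · rintro ⟨x, hx, rfl⟩
      simp [hx]
    · intro hs
      refine ⟨e.symm ⟨s, hs⟩, (e.symm ⟨s, hs⟩).2, ?_⟩
      simp

lemma ttc_parent_exists {V : Type} (T : SimpleGraph V) (hT : T.IsTree) (r v : V) (hv : v ≠ r) :
    ∃ u, T.Adj v u ∧ T.dist r v = T.dist r u + 1 := by
  obtain ⟨p, hp⟩ := hT.connected.exists_walk_length_eq_dist v r
  cases p with
  | nil => exact absurd rfl hv
  | cons hadj q =>
    rename_i u
    refine ⟨u, hadj, ?_⟩
    have h1 := T.dist_le q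
    rw [SimpleGraph.Walk.length_cons] at hp
    rw [SimpleGraph.dist_comm] at hp h1
    have h2 := hT.dist_eq_dist_add_one_of_adj r hadj
    omega

lemma ttc_parent_unique {V : Type} (T : SimpleGraph V) (hT : T.IsTree) (r v u w : V)
    (hu : T.Adj v u) (hud : T.dist r v = T.dist r u + 1)
    (hw : T.Adj v w) (hwd : T.dist r v = T.dist r w + 1) : u = w := by
  obtain ⟨p, hp⟩ := hT.connected.exists_walk_length_eq_dist r u
  obtain ⟨q, hq⟩ := hT.connected.exists_walk_length_eq_dist r w
  have h1 : (p.concat hu.symm).IsPath :=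
    SimpleGraph.Walk.isPath_of_length_eq_dist _ (by rw [SimpleGraph.Walk.length_concat]; omega)
  have h2 : (q.concat hw.symm).IsPath :=
    SimpleGraph.Walk.isPath_of_length_eq_dist _ (by rw [SimpleGraph.Walk.length_concat]; omega)
  have h3 := hT.existsUnique_path r v
  have h4 : p.concat hu.symm = q.concat hw.symm := h3.unique h1 h2
  have h5 := congrArg SimpleGraph.Walk.penultimate h4
  simpa using h5

/-- Let `T` be a tree with maximum degree `t ≥ 5` such that every vertex of degree `2`
has at least one neighbor of degree `2`, and let `𝒢` be an Abelian group of order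
`k ≥ t + 2` with more than one involution.  If `𝒢` is not isomorphic to `(ℤ₂)^p` for
any integer `p` with `2^p ∈ {t + 2, t + 3}`, then there exists a `𝒢`-twin edge
coloring of `T`. -/
theorem tree_twin_coloring_of_many_involutions {V : Type} [Fintype V] (T : SimpleGraph V)
    [DecidableRel T.Adj] (hT : T.IsTree) (ht : 5 ≤ T.maxDegree)
    (hdeg2 : ∀ v : V, T.degree v = 2 → ∃ u : V, T.Adj v u ∧ T.degree u = 2)
    (A : Type) [AddCommGroup A] [Fintype A]
    (hinv : ∃ ι₁ ι₂ : A, ι₁ ≠ ι₂ ∧ (ι₁ ≠ 0 ∧ ι₁ + ι₁ = 0) ∧ (ι₂ ≠ 0 ∧ ι₂ + ι₂ = 0))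
    (hcard : T.maxDegree + 2 ≤ Fintype.card A)
    (hniso : ∀ p : ℕ, (2 ^ p = T.maxDegree + 2 ∨ 2 ^ p = T.maxDegree + 3) →
      ¬ Nonempty (A ≃+ (Fin p → ZMod 2))) :
    ∃ f : Sym2 V → A, IsTwinEdgeColoring T f := by
  classical
  obtain ⟨i, j, hij, ⟨hi, hi2⟩, hj, hj2⟩ := hinv
  have comb : ∀ n : ℕ, 2 ≤ n → n + 1 ≤ T.maxDegree → ∀ a W : A,
      ∃ S : Finset A, S.card = n ∧ a ∉ S ∧ a + ∑ x ∈ S, x ∉ S ∧ a + ∑ x ∈ S, x ≠ W := by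
    intro n hn hnt a W
    refine ttc_comb hij hi hi2 hj hj2 (by omega) n hn (by omega) ?_ a W
    by_cases h : ∀ x : A, x + x = 0
    · left
      obtain ⟨p, hp, hiso⟩ := ttc_elem h
      by_contra hc
      exact hniso p (by omega) hiso
    · right
      push Not at h
      exact h
  have : Nonempty V := hT.connected.nonempty
  obtain ⟨r, hr⟩ := T.exists_maximal_degree_vertex
  set δ : V → ℕ := fun v => T.dist r v with hδ
  have hδr : δ r = 0 := by simp [hδ]
  have hδ0 : ∀ v, v ≠ r → 0 < δ v := fun v hv => hT.connected.pos_dist_of_ne (Ne.symm hv)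
  have hadjδ : ∀ u v, T.Adj u v → δ u = δ v + 1 ∨ δ v = δ u + 1 :=
    fun u v h => hT.dist_eq_dist_add_one_of_adj r h
  have hpar : ∀ v, ∃ u, v ≠ r → T.Adj v u ∧ δ v = δ u + 1 := by
    intro v
    by_cases hv : v = r
    · exact ⟨v, fun h => absurd hv h⟩
    · obtain ⟨u, hu⟩ := ttc_parent_exists T hT r v hv
      exact ⟨u, fun _ => hu⟩
  choose par hpar using hpar
  let ch : V → Finset V := fun v => (T.neighborFinset v).filter (fun x => δ x = δ v + 1)
  have mem_ch : ∀ v x, x ∈ ch v ↔ T.Adj v x ∧ δ x = δ v + 1 := by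
    intro v x; simp [ch]
  have ch_ne : ∀ v x, x ∈ ch v → x ≠ r := by
    rintro v x hx rfl
    have := ((mem_ch _ _).1 hx).2
    omega
  have ch_par : ∀ v x, x ∈ ch v → par x = v := by
    intro v x hx
    have h1 := hpar x (ch_ne v x hx)
    have h2 := (mem_ch _ _).1 hx
    exact ttc_parent_unique T hT r x (par x) v h1.1 h1.2 h2.1.symm h2.2
  have par_ch : ∀ v, v ≠ r → v ∈ ch (par v) := by
    intro v hv
    exact (mem_ch _ _).2 ⟨(hpar v hv).1.symm, (hpar v hv).2⟩
  have adj_cases : ∀ u v, T.Adj u v → (v ∈ ch u) ∨ (u ≠ r ∧ v = par u) := by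
    intro u v h
    rcases hadjδ u v h with h1 | h1
    · right
      have : u ∈ ch v := (mem_ch _ _).2 ⟨h.symm, h1⟩
      exact ⟨ch_ne _ _ this, (ch_par _ _ this).symm⟩
    · left; exact (mem_ch _ _).2 ⟨h, h1⟩
  have par_notMem : ∀ v, v ≠ r → par v ∉ ch v := by
    intro v hv h
    have h1 := (hpar v hv).2
    have h2 := ((mem_ch _ _).1 h).2
    omega
  have nbr : ∀ v, v ≠ r → T.neighborFinset v = insert (par v) (ch v) := by
    intro v hv
    ext x
    rw [T.mem_neighborFinset, Finset.mem_insert]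
    constructor
    · intro h
      rcases adj_cases _ _ h with h | h
      · exact Or.inr h
      · exact Or.inl h.2
    · rintro (rfl | h)
      · exact (hpar v hv).1
      · exact ((mem_ch _ _).1 h).1
  have nbr_r : T.neighborFinset r = ch r := by
    ext x
    rw [T.mem_neighborFinset]
    constructor
    · intro h
      rcases adj_cases _ _ h with h | h
      · exact h
      · exact absurd rfl h.1
    · intro h; exact ((mem_ch _ _).1 h).1
  have deg : ∀ v, v ≠ r → T.degree v = (ch v).card + 1 := by
    intro v hv
    rw [← T.card_neighborFinset_eq_degree, nbr v hv,
      Finset.card_insert_of_notMem (par_notMem v hv)]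
  have deg_r : T.degree r = (ch r).card := by
    rw [← T.card_neighborFinset_eq_degree, nbr_r]
  let W : (V → A) → V → A := fun g v => g v + ∑ x ∈ ch v, g x
  -- the local constraint at v
  let Loc : (V → A) → V → Prop := fun g v =>
    Set.InjOn g (ch v) ∧ (v ≠ r → ∀ x ∈ ch v, g x ≠ g v) ∧ (v ≠ r → W g v ≠ W g (par v)) ∧
    (∀ x ∈ ch v, T.degree x = 1 → g x ≠ W g v) ∧ (T.degree v = 2 → ∀ x ∈ ch v, g x ≠ 0)
  have main : ∀ n : ℕ, ∃ g : V → A, g r = 0 ∧ ∀ v, δ v < n + 1 → Loc g v := by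
    intro n
    induction n with
    | zero =>
      obtain ⟨S, hS, h0, hw, hw0⟩ := comb (T.maxDegree - 1) (by omega) (by omega) 0 0
      obtain ⟨h, hinj, him⟩ := ttc_assign (ch r) (insert 0 S) (by
        rw [Finset.card_insert_of_notMem h0, ← deg_r]; omega)
      have hrr : r ∉ ch r := fun h => ch_ne _ _ h rfl
      have hup : ∀ x ∈ ch r, Function.update h r 0 x = h x := by
        intro x hx
        exact Function.update_of_ne (ch_ne _ _ hx) _ _
      refine ⟨Function.update h r 0, by simp, ?_⟩
      intro v hv
      have hvr : v = r := by
        by_contra hc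
        have := hδ0 v hc
        omega
      subst hvr
      have hsum : W (Function.update h v 0) v = 0 + ∑ x ∈ S, x := by
        show Function.update h v 0 v + _ = _
        rw [Finset.sum_congr rfl hup, Function.update_self]
        congr 1
        have : ∑ x ∈ ch v, h x = ∑ x ∈ (ch v).image h, x := by
          rw [Finset.sum_image hinj]
        rw [this, him, Finset.sum_insert h0, zero_add]
      refine ⟨?_, fun h => absurd rfl h, fun h => absurd rfl h, ?_, ?_⟩
      · intro x hx y hy hxy
        rw [hup x hx, hup y hy] at hxy
        exact hinj hx hy hxy
      · intro x hx _ hc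
        rw [hsum, hup x hx] at hc
        have : h x ∈ insert 0 S := him ▸ Finset.mem_image_of_mem h hx
        rw [hc, Finset.mem_insert] at this
        rcases this with h | h
        · exact hw0 h
        · exact hw h
      · intro h2; omega
    | succ n ih =>
      obtain ⟨g, hgr, hg⟩ := ih
      have step : ∀ v, ∃ h : V → A, δ v = n + 1 →
          Set.InjOn h (ch v) ∧ (∀ x ∈ ch v, h x ≠ g v) ∧
          (g v + ∑ x ∈ ch v, h x ≠ W g (par v)) ∧
          (∀ x ∈ ch v, T.degree x = 1 → h x ≠ g v + ∑ x ∈ ch v, h x) ∧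
          (T.degree v = 2 → ∀ x ∈ ch v, h x ≠ 0) := by
        intro v
        by_cases hv : δ v = n + 1
        swap
        · exact ⟨g, fun h => absurd h hv⟩
        have hvr : v ≠ r := by rintro rfl; omega
        have hd := deg v hvr
        have hmax := T.degree_le_maxDegree v
        have hp := hpar v hvr
        have hgp := hg (par v) (by omega)
        obtain ⟨hp1, hp2, hp3, hp4, hp5⟩ := hgp
        rcases (by omega : (ch v).card = 0 ∨ (ch v).card = 1 ∨ 2 ≤ (ch v).card) with h0 | h1 | h2
        · refine ⟨g, fun _ => ?_⟩
          rw [Finset.card_eq_zero] at h0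
          rw [h0]
          simp only [Finset.sum_empty, add_zero, Finset.notMem_empty, false_imp_iff,
            implies_true, and_true, true_and, Finset.coe_empty, Set.injOn_empty]
          apply hp4 v (par_ch v hvr)
          rw [hd, h0]; rfl
        · obtain ⟨x, hx⟩ := Finset.card_eq_one.1 h1
          obtain ⟨b, hb⟩ := ttc_exists_notMem ({0, g v, W g (par v) - g v} : Finset A) (by
            have := Finset.card_le_three (a := 0) (b := g v) (c := W g (par v) - g v)
            omega)
          simp only [Finset.mem_insert, Finset.mem_singleton, not_or] at hb
          refine ⟨fun _ => b, fun _ => ?_⟩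
          rw [hx]
          simp only [Finset.coe_singleton, Set.injOn_singleton, Finset.mem_singleton, forall_eq,
            Finset.sum_singleton, true_and]
          refine ⟨hb.2.1, ?_, ?_, fun _ => hb.1⟩
          · intro hc; apply hb.2.2; rw [← hc]; abel
          · intro hleaf hc
            have hgv : g v = 0 := by
              have : 0 + b = g v + b := by rw [zero_add]; exact hc
              exact (add_right_cancel this).symm
            obtain ⟨u, hu, hud⟩ := hdeg2 v (by omega)
            rcases adj_cases _ _ hu with h | h
            · rw [hx, Finset.mem_singleton] at h
              rw [h] at hud; omega
            · rw [h.2] at hud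
              exact hp5 hud v (par_ch v hvr) hgv
        · obtain ⟨S, hS, haS, hw, hw0⟩ := comb (ch v).card h2 (by omega) (g v) (W g (par v))
          obtain ⟨h, hinj, him⟩ := ttc_assign (ch v) S hS
          have hsum : ∑ x ∈ ch v, h x = ∑ x ∈ S, x := by
            rw [← him, Finset.sum_image hinj]
          have hmem : ∀ x ∈ ch v, h x ∈ S := fun x hx => him ▸ Finset.mem_image_of_mem h hx
          refine ⟨h, fun _ => ⟨hinj, ?_, ?_, ?_, ?_⟩⟩
          · intro x hx hc
            exact haS (hc ▸ hmem x hx)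
          · rw [hsum]; exact hw0
          · intro x hx _ hc
            rw [hsum] at hc
            exact hw (hc ▸ hmem x hx)
          · intro h2'; omega
      choose h hh using step
      let g' : V → A := fun x => if δ x = n + 2 then h (par x) x else g x
      have g'_old : ∀ x, δ x < n + 2 → g' x = g x := by
        intro x hx
        exact if_neg (by omega)
      have g'_new : ∀ v, δ v = n + 1 → ∀ x ∈ ch v, g' x = h v x := by
        intro v hv x hx
        have h1 := ((mem_ch _ _).1 hx).2
        show (if δ x = n + 2 then h (par x) x else g x) = _
        rw [if_pos (by omega), ch_par v x hx]
      have ch_old : ∀ v, δ v < n + 1 → ∀ x ∈ ch v, g' x = g x := by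
        intro v hv x hx
        have h1 := ((mem_ch _ _).1 hx).2
        exact g'_old x (by omega)
      have W_old : ∀ v, δ v < n + 1 → W g' v = W g v := by
        intro v hv
        show g' v + _ = g v + _
        rw [g'_old v (by omega), Finset.sum_congr rfl (ch_old v hv)]
      refine ⟨g', by rw [g'_old r (by omega), hgr], ?_⟩
      intro v hv
      rcases (by omega : δ v < n + 1 ∨ δ v = n + 1) with hlt | heq
      · obtain ⟨k1, k2, k3, k4, k5⟩ := hg v hlt
        refine ⟨?_, ?_, ?_, ?_, ?_⟩
        · intro x hx y hy hxy
          rw [ch_old v hlt x hx, ch_old v hlt y hy] at hxy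
          exact k1 hx hy hxy
        · intro hvr x hx
          rw [ch_old v hlt x hx, g'_old v (by omega)]
          exact k2 hvr x hx
        · intro hvr
          have := (hpar v hvr).2
          rw [W_old v hlt, W_old (par v) (by omega)]
          exact k3 hvr
        · intro x hx hx1
          rw [ch_old v hlt x hx, W_old v hlt]
          exact k4 x hx hx1
        · intro h2 x hx
          rw [ch_old v hlt x hx]
          exact k5 h2 x hx
      · obtain ⟨k1, k2, k3, k4, k5⟩ := hh v heq
        have hW : W g' v = g v + ∑ x ∈ ch v, h v x := by
          show g' v + _ = _
          rw [g'_old v (by omega), Finset.sum_congr rfl (g'_new v heq)]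
        refine ⟨?_, ?_, ?_, ?_, ?_⟩
        · intro x hx y hy hxy
          rw [g'_new v heq x hx, g'_new v heq y hy] at hxy
          exact k1 hx hy hxy
        · intro hvr x hx
          rw [g'_new v heq x hx, g'_old v (by omega)]
          exact k2 x hx
        · intro hvr
          have := (hpar v hvr).2
          rw [hW, W_old (par v) (by omega)]
          exact k3
        · intro x hx hx1
          rw [g'_new v heq x hx, hW]
          exact k4 x hx hx1
        · intro h2 x hx
          rw [g'_new v heq x hx]
          exact k5 h2 x hx
  obtain ⟨g, hgr, hg⟩ := main (Finset.univ.sup δ)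
  have hg : ∀ v, Loc g v := fun v =>
    hg v (Nat.lt_succ_of_le (Finset.le_sup (f := δ) (Finset.mem_univ v)))
  let F : V → V → A := fun u v => if δ u < δ v then g v else if δ v < δ u then g u else 0
  have hF : ∀ u v, F u v = F v u := by
    intro u v
    show (if δ u < δ v then g v else if δ v < δ u then g u else 0) =
      (if δ v < δ u then g u else if δ u < δ v then g v else 0)
    split_ifs <;> first | rfl | omega
  let f : Sym2 V → A := Sym2.lift ⟨F, hF⟩
  have f_ch : ∀ v x, x ∈ ch v → f s(x, v) = g x := by
    intro v x hx
    have h1 := ((mem_ch _ _).1 hx).2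
    show (if δ x < δ v then g v else if δ v < δ x then g x else 0) = _
    rw [if_neg (by omega), if_pos (by omega)]
  have f_par : ∀ v, v ≠ r → f s(par v, v) = g v := by
    intro v hv
    rw [Sym2.eq_swap]
    exact f_ch _ _ (par_ch v hv)
  have f_sum : ∀ v, ∑ x ∈ T.neighborFinset v, f s(x, v) = W g v := by
    intro v
    by_cases hv : v = r
    · subst hv
      rw [nbr_r, Finset.sum_congr rfl (f_ch v)]
      show _ = g v + _
      rw [hgr, zero_add]
    · rw [nbr v hv, Finset.sum_insert (par_notMem v hv), f_par v hv,
        Finset.sum_congr rfl (f_ch v)]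
  refine ⟨f, ?_, ?_⟩
  · intro u v w huv huw hvw
    rw [Sym2.eq_swap (a := u) (b := v), Sym2.eq_swap (a := u) (b := w)]
    obtain ⟨k1, k2, -⟩ := hg u
    rcases adj_cases _ _ huv with h1 | ⟨hur, rfl⟩
    · rw [f_ch u v h1]
      rcases adj_cases _ _ huw with h2 | ⟨hur, rfl⟩
      · rw [f_ch u w h2]
        exact fun hc => hvw (k1 h1 h2 hc)
      · rw [f_par u hur]
        exact k2 hur v h1
    · rw [f_par u hur]
      rcases adj_cases _ _ huw with h2 | ⟨_, rfl⟩
      · rw [f_ch u w h2]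
        exact (k2 hur w h2).symm
      · exact absurd rfl hvw
  · intro u v huv
    rw [f_sum, f_sum]
    rcases adj_cases _ _ huv with h1 | ⟨hur, rfl⟩
    · have h2 := (hg v).2.2.1 (ch_ne _ _ h1)
      rw [ch_par _ _ h1] at h2
      exact h2.symm
    · exact (hg u).2.2.1 hur
end

section
/- Let T be a tree of order at least 3 with even maximum degree Δ(T) such that every vertex of degree 2 has at least one neighbor of degree 2. If Δ(T) ≠ 2^p − 2 for every integer p, then χ'_g(T) ≤ Δ(T) + 2. -/
open Finset SimpleGraph

lemma exists_not_mem_fin {A : Type} [Fintype A] [DecidableEq A] (F : Finset A)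
    (h : F.card < Fintype.card A) : ∃ x, x ∉ F := by
  by_contra hc
  push Not at hc
  have : F = univ := Finset.eq_univ_iff_forall.2 hc
  rw [this, Finset.card_univ] at h
  exact lt_irrefl _ h

lemma fiber_card_le {A : Type} [AddCommGroup A] [Fintype A] [DecidableEq A] (k : ℕ) (c : A) :
    (univ.filter (fun x : A => k • x = c)).card ≤ (univ.filter (fun x : A => k • x = 0)).card := by
  rcases (univ.filter (fun x : A => k • x = c)).eq_empty_or_nonempty with h | ⟨x0, hx0⟩
  · simp [h]
  · apply Finset.card_le_card_of_injOn (fun x => x - x0)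
    · intro x hx
      simp only [coe_filter, mem_univ, true_and, Set.mem_ofPred_eq, mem_filter] at hx hx0 ⊢
      rw [smul_sub, hx, hx0, sub_self]
    · intro x _ y _ h
      simpa using h

lemma group_facts {A : Type} [AddCommGroup A] [Fintype A] [DecidableEq A]
    (p : ℕ) (hp : p.Prime) (hpo : Odd p) (hpd : p ∣ Fintype.card A) (hev : Even (Fintype.card A)) :
    3 * (univ.filter (fun x : A => 2 • x = 0)).card ≤ Fintype.card A ∧
    2 * (univ.image (fun x : A => 2 • x)).card ≤ Fintype.card A ∧
    2 ≤ (univ.filter (fun x : A => 2 • x = 0)).card ∧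
    (univ.filter (fun x : A => 2 • x = 0)).card * (univ.filter (fun x : A => 3 • x = 0)).card
      ≤ Fintype.card A := by
  have hmul : (univ.filter (fun x : A => 2 • x = 0)).card * (univ.image (fun x : A => 2 • x)).card
      = Fintype.card A := by
    rw [← Finset.card_univ, Finset.card_eq_sum_card_image (fun x : A => 2 • x) univ, mul_comm,
      ← smul_eq_mul, ← Finset.sum_const]
    apply Finset.sum_congr rfl
    intro b hb
    apply le_antisymm _ (fiber_card_le 2 b)
    obtain ⟨y, -, rfl⟩ := Finset.mem_image.1 hb
    apply Finset.card_le_card_of_injOn (fun x => x + y)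
    · intro x hx
      simp only [coe_filter, mem_univ, true_and, Set.mem_ofPred_eq] at hx ⊢
      rw [smul_add, hx, zero_add]
    · intro x _ z _ h
      simpa using h
  have h2 : 2 ≤ (univ.filter (fun x : A => 2 • x = 0)).card := by
    have : Fact (Nat.Prime 2) := ⟨Nat.prime_two⟩
    obtain ⟨g, hg⟩ := exists_prime_addOrderOf_dvd_card (G := A) 2 hev.two_dvd
    have hg0 : g ≠ 0 := by
      rintro rfl
      simp at hg
    have : ({0, g} : Finset A) ⊆ univ.filter (fun x : A => 2 • x = 0) := by
      intro x hx
      simp only [mem_insert, mem_singleton] at hx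
      rcases hx with rfl | rfl
      · simp
      · simp only [mem_filter, mem_univ, true_and]
        rw [← hg]; exact addOrderOf_nsmul_eq_zero _
    calc 2 = ({0, g} : Finset A).card := (Finset.card_pair hg0.symm).symm
      _ ≤ _ := Finset.card_le_card this
  have h3 : 3 ≤ (univ.image (fun x : A => 2 • x)).card := by
    have : Fact (Nat.Prime p) := ⟨hp⟩
    obtain ⟨g, hg⟩ := exists_prime_addOrderOf_dvd_card (G := A) p hpd
    have e2 : 2 • g ≠ 0 := by
      intro h
      have := addOrderOf_dvd_of_nsmul_eq_zero h
      rw [hg, Nat.prime_dvd_prime_iff_eq hp Nat.prime_two] at this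
      subst this; revert hpo; decide
    have e4 : 2 • (2 • g) ≠ 0 := by
      intro h
      rw [← mul_smul] at h
      have := addOrderOf_dvd_of_nsmul_eq_zero h
      rw [hg, show 2 * 2 = 2 ^ 2 from rfl] at this
      have := hp.dvd_of_dvd_pow this
      rw [Nat.prime_dvd_prime_iff_eq hp Nat.prime_two] at this
      subst this; revert hpo; decide
    have : ({0, 2 • g, 2 • (2 • g)} : Finset A) ⊆ univ.image (fun x : A => 2 • x) := by
      intro x hx
      simp only [mem_insert, mem_singleton] at hx
      rw [Finset.mem_image]
      rcases hx with rfl | rfl | rfl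
      · exact ⟨0, by simp⟩
      · exact ⟨g, by simp⟩
      · exact ⟨2 • g, by simp⟩
    have hc : ({0, 2 • g, 2 • (2 • g)} : Finset A).card = 3 := by
      rw [Finset.card_eq_three]
      refine ⟨_, _, _, e2.symm, e4.symm, ?_, rfl⟩
      intro h
      apply e2
      rw [two_nsmul (2 • g)] at h
      simpa using h
    rw [← hc]
    exact Finset.card_le_card this
  refine ⟨by nlinarith, by nlinarith, h2, ?_⟩
  rw [← Finset.card_product, ← Finset.card_univ]
  apply Finset.card_le_card_of_injOn (fun q => q.1 + q.2) (fun _ _ => by simp)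
  rintro ⟨x, y⟩ hx ⟨x', y'⟩ hx' h
  simp only [coe_product, coe_filter, mem_univ, true_and, Set.mem_prod, Set.mem_ofPred_eq] at hx hx' h
  obtain ⟨a1, a2⟩ := hx
  obtain ⟨b1, b2⟩ := hx'
  have hd : x - x' = y' - y := by
    rw [sub_eq_sub_iff_add_eq_add]; rw [h]; abel
  have d2 : 2 • (x - x') = 0 := by rw [smul_sub, a1, b1, sub_self]
  have d3 : 3 • (x - x') = 0 := by rw [hd, smul_sub, a2, b2, sub_self]
  have d1 : x - x' = 0 := by
    rw [succ_nsmul, d2, zero_add] at d3; exact d3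
  have e1 : x = x' := sub_eq_zero.1 d1
  have e2 : y = y' := (sub_eq_zero.1 (hd.symm.trans d1)).symm
  rw [e1, e2]

/-- any `c` is a sum of `m` distinct elements avoiding `a, t`. -/
lemma subset_sum {A : Type} [AddCommGroup A] [Fintype A] [DecidableEq A]
    (h1 : 3 * (univ.filter (fun x : A => 2 • x = 0)).card ≤ Fintype.card A)
    (h2 : 2 * (univ.image (fun x : A => 2 • x)).card ≤ Fintype.card A)
    (hn : 8 < Fintype.card A) (m : ℕ) (hm : 2 ≤ m) (hm' : 2 * m < Fintype.card A) (a t c : A) :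
    ∃ S : Finset A, a ∉ S ∧ t ∉ S ∧ S.card = m ∧ ∑ x ∈ S, x = c := by
  set P : Finset A := {a, t} with hP
  have hPc : P.card ≤ 2 := Finset.card_le_two
  rcases Nat.lt_or_ge m 3 with h3 | h3
  · have hm2 : m = 2 := by omega
    have := fiber_card_le 2 c
    obtain ⟨x, hx⟩ := exists_not_mem_fin
      (P ∪ P.image (fun z => c - z) ∪ univ.filter (fun x : A => 2 • x = c)) (by
        have e1 := Finset.card_union_le (P ∪ P.image (fun z => c - z))
          (univ.filter (fun x : A => 2 • x = c))
        have e2 := Finset.card_union_le P (P.image (fun z => c - z))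
        have e3 := Finset.card_image_le (s := P) (f := fun z => c - z)
        omega)
    simp only [mem_union, mem_image, mem_filter, mem_univ, true_and, not_or, not_exists, not_and,
      hP, mem_insert, mem_singleton, forall_eq_or_imp, forall_eq] at hx
    obtain ⟨⟨⟨xa, xt⟩, ca, ct⟩, hx2⟩ := hx
    have hne : x ≠ c - x := by
      intro h; apply hx2; rw [two_nsmul]; nth_rewrite 1 [h]; abel
    refine ⟨{x, c - x}, ?_, ?_, ?_, ?_⟩
    · simp only [mem_insert, mem_singleton, not_or]
      exact ⟨Ne.symm xa, fun h => ca (by rw [h]; abel)⟩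
    · simp only [mem_insert, mem_singleton, not_or]
      exact ⟨Ne.symm xt, fun h => ct (by rw [h]; abel)⟩
    · rw [Finset.card_pair hne, hm2]
    · rw [Finset.sum_pair hne]; abel
  · obtain ⟨R0, hR0, hR0c⟩ := Finset.exists_subset_card_eq (s := Pᶜ) (n := m - 3) (by
      rw [Finset.card_compl]; omega)
    obtain ⟨r, hr⟩ := exists_not_mem_fin
      (P ∪ R0 ∪ (univ.image (fun x : A => 2 • x)).image (fun y => c - ∑ x ∈ R0, x - y)) (by
        have e1 := Finset.card_union_le (P ∪ R0)
          ((univ.image (fun x : A => 2 • x)).image (fun y => c - ∑ x ∈ R0, x - y))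
        have e2 := Finset.card_union_le P R0
        have e3 := Finset.card_image_le (s := univ.image (fun x : A => 2 • x))
          (f := fun y => c - ∑ x ∈ R0, x - y)
        omega)
    simp only [mem_union, not_or] at hr
    obtain ⟨⟨rP, rR⟩, hr2⟩ := hr
    set R := insert r R0 with hR
    have hRc : R.card = m - 2 := by rw [hR, Finset.card_insert_of_notMem rR]; omega
    have hRs : ∑ x ∈ R, x = r + ∑ x ∈ R0, x := Finset.sum_insert rR
    have hRP : ∀ z ∈ P, z ∉ R := by
      intro z hz hzR
      rcases Finset.mem_insert.1 hzR with h | h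
      · exact rP (h ▸ hz)
      · exact (Finset.mem_compl.1 (hR0 h)) hz
    set c' := c - ∑ x ∈ R, x with hc'
    have hodd : ∀ x : A, x ≠ c' - x := by
      intro x h
      apply hr2
      refine Finset.mem_image.2 ⟨2 • x, Finset.mem_image.2 ⟨x, by simp, rfl⟩, ?_⟩
      have : 2 • x = c' := by rw [two_nsmul]; nth_rewrite 1 [h]; abel
      rw [this, hc', hRs]; abel
    obtain ⟨x, hx⟩ := exists_not_mem_fin ((P ∪ R) ∪ (P ∪ R).image (fun z => c' - z)) (by
        have e1 := Finset.card_union_le (P ∪ R) ((P ∪ R).image (fun z => c' - z))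
        have e2 := Finset.card_union_le P R
        have e3 := Finset.card_image_le (s := P ∪ R) (f := fun z => c' - z)
        omega)
    rw [Finset.mem_union, not_or] at hx
    obtain ⟨hx1, hx2⟩ := hx
    have hy1 : c' - x ∉ P ∪ R := by
      intro h
      exact hx2 (Finset.mem_image.2 ⟨_, h, by abel⟩)
    rw [Finset.mem_union, not_or] at hx1 hy1
    have hyR := hy1.2
    have hxR : x ∉ insert (c' - x) R := by
      rw [Finset.mem_insert, not_or]; exact ⟨hodd x, hx1.2⟩
    have key : ∀ z ∈ P, z ∉ insert x (insert (c' - x) R) := by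
      intro z hz
      simp only [mem_insert, not_or]
      exact ⟨fun h => hx1.1 (h ▸ hz), fun h => hy1.1 (h ▸ hz), hRP z hz⟩
    refine ⟨insert x (insert (c' - x) R), key a (by simp [hP]), key t (by simp [hP]), ?_, ?_⟩
    · rw [Finset.card_insert_of_notMem hxR, Finset.card_insert_of_notMem hyR]; omega
    · rw [Finset.sum_insert hxR, Finset.sum_insert hyR, hc']; abel

set_option maxRecDepth 10000 in
lemma claim6 : ∀ (a s : ZMod 6), ∀ m ∈ [2, 3], ∃ S ∈ (univ : Finset (ZMod 6)).powersetCard m,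
    a ∉ S ∧ a + ∑ x ∈ S, x ∉ S ∧ a + ∑ x ∈ S, x ≠ s := by
  decide

lemma equiv6 {A : Type} [AddCommGroup A] [Fintype A] (h : Fintype.card A = 6) :
    Nonempty (ZMod 6 ≃+ A) := by
  have : Fact (Nat.Prime 2) := ⟨Nat.prime_two⟩
  have : Fact (Nat.Prime 3) := ⟨Nat.prime_three⟩
  obtain ⟨g, hg⟩ := exists_prime_addOrderOf_dvd_card (G := A) 2 (by rw [h]; decide)
  obtain ⟨k, hk⟩ := exists_prime_addOrderOf_dvd_card (G := A) 3 (by rw [h]; decide)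
  have ho : addOrderOf (g + k) = 6 := by
    rw [(AddCommute.all g k).addOrderOf_add_eq_mul_addOrderOf_of_coprime (by rw [hg, hk]; decide), hg, hk]
  have hc : IsAddCyclic A := isAddCyclic_of_addOrderOf_eq_card (g + k) (by
    rw [ho, Nat.card_eq_fintype_card, h])
  have := zmodAddCyclicAddEquiv hc
  rw [Nat.card_eq_fintype_card, h] at this
  exact ⟨this⟩

lemma claim {A : Type} [AddCommGroup A] [Fintype A] [DecidableEq A]
    (p : ℕ) (hp : p.Prime) (hpo : Odd p) (hpd : p ∣ Fintype.card A) (hev : Even (Fintype.card A))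
    (a s : A) (m : ℕ) (hm : 2 ≤ m) (hm' : m + 3 ≤ Fintype.card A) :
    ∃ S : Finset A, a ∉ S ∧ S.card = m ∧ a + ∑ x ∈ S, x ∉ S ∧ a + ∑ x ∈ S, x ≠ s := by
  obtain ⟨f1, f2, f3, f4⟩ := group_facts p hp hpo hpd hev
  rcases Nat.lt_or_ge 8 (Fintype.card A) with hn | hn
  · -- it suffices to find `t` and a set with the right sum
    have fin : ∀ t S, t ≠ s → a ∉ S → t ∉ S → S.card = m → ∑ x ∈ S, x = t - a →
        ∃ S : Finset A, a ∉ S ∧ S.card = m ∧ a + ∑ x ∈ S, x ∉ S ∧ a + ∑ x ∈ S, x ≠ s := by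
      intro t S h1 h2 h3 h4 h5
      have : a + ∑ x ∈ S, x = t := by rw [h5]; abel
      exact ⟨S, h2, h4, by rwa [this], by rwa [this]⟩
    -- complement version
    have finc : ∀ t S', t ≠ s → t ≠ a → a ∉ S' → t ∉ S' → S'.card + m + 2 = Fintype.card A →
        ∑ x ∈ S', x = (∑ x : A, x) - 2 • t →
        ∃ S : Finset A, a ∉ S ∧ S.card = m ∧ a + ∑ x ∈ S, x ∉ S ∧ a + ∑ x ∈ S, x ≠ s := by
      intro t S' h1 h2 h3 h4 h5 h6
      have e1 : t ∉ insert a S' := by simp [h2, h4]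
      refine fin t (insert t (insert a S'))ᶜ h1 (by simp) (by simp) ?_ ?_
      · rw [Finset.card_compl, Finset.card_insert_of_notMem e1, Finset.card_insert_of_notMem h3]
        omega
      · have := Finset.sum_compl_add_sum (insert t (insert a S')) (fun x : A => x)
        rw [Finset.sum_insert e1, Finset.sum_insert h3, h6] at this
        rw [eq_sub_iff_add_eq]
        rw [two_nsmul] at this
        generalize ∑ i ∈ (insert t (insert a S'))ᶜ, i = Z at this ⊢
        generalize ∑ x : A, x = Y at this
        have h7 : Z + a - t = 0 := by
          have h8 := congrArg (fun z => z - Y) this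
          simp only [sub_self] at h8
          rw [← h8]; abel
        exact sub_eq_zero.1 h7
    by_cases hA : 2 * m < Fintype.card A
    · obtain ⟨t, ht⟩ := exists_not_mem_fin ({a, s} : Finset A) (by
        have : ({a, s} : Finset A).card ≤ 2 := Finset.card_le_two
        omega)
      simp only [mem_insert, mem_singleton, not_or] at ht
      obtain ⟨S, g1, g2, g3, g4⟩ := subset_sum f1 f2 hn m hm hA a t (t - a)
      exact fin t S ht.2 g1 g2 g3 g4
    · by_cases hB : m + 3 = Fintype.card A
      · obtain ⟨t, ht⟩ := exists_not_mem_fin (({a, s} : Finset A) ∪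
          univ.filter (fun x : A => 2 • x = (∑ x : A, x) - a) ∪
          univ.filter (fun x : A => 3 • x = (∑ x : A, x))) (by
            have e0 : ({a, s} : Finset A).card ≤ 2 := Finset.card_le_two
            have e1 := Finset.card_union_le (({a, s} : Finset A) ∪
              univ.filter (fun x : A => 2 • x = (∑ x : A, x) - a))
              (univ.filter (fun x : A => 3 • x = (∑ x : A, x)))
            have e2 := Finset.card_union_le ({a, s} : Finset A)
              (univ.filter (fun x : A => 2 • x = (∑ x : A, x) - a))
            have e3 := fiber_card_le 2 ((∑ x : A, x) - a)
            have e4 := fiber_card_le 3 (∑ x : A, x)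
            by_contra hcon
            set g2 := (univ.filter (fun x : A => 2 • x = 0)).card
            set g3 := (univ.filter (fun x : A => 3 • x = 0)).card
            have hs : Fintype.card A ≤ 2 + g2 + g3 := by omega
            rcases Nat.lt_or_ge g3 2 with h | h
            · omega
            · nlinarith [mul_nonneg (Nat.zero_le (g2 - 2)) (Nat.zero_le (g3 - 2)),
                Nat.mul_le_mul f3 h, Nat.sub_add_cancel f3, Nat.sub_add_cancel h])
        simp only [mem_union, mem_insert, mem_singleton, mem_filter, mem_univ, true_and,
          not_or] at ht
        obtain ⟨⟨⟨ta, ts⟩, t2⟩, t3⟩ := ht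
        refine finc t {(∑ x : A, x) - 2 • t} ts ta ?_ ?_ ?_ ?_
        · rw [mem_singleton]; intro h; apply t2; rw [h]; abel
        · rw [mem_singleton]; intro h; apply t3
          rw [succ_nsmul]; nth_rewrite 2 [h]; abel
        · rw [card_singleton]; omega
        · rw [sum_singleton]
      · obtain ⟨t, ht⟩ := exists_not_mem_fin ({a, s} : Finset A) (by
          have : ({a, s} : Finset A).card ≤ 2 := Finset.card_le_two
          omega)
        simp only [mem_insert, mem_singleton, not_or] at ht
        obtain ⟨S, g1, g2, g3, g4⟩ := subset_sum f1 f2 hn (Fintype.card A - 2 - m) (by omega)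
          (by omega) a t ((∑ x : A, x) - 2 • t)
        exact finc t S ht.2 ht.1 g1 g2 (by omega) g4
  · have h6 : Fintype.card A = 6 := by
      have hp2 := hp.two_le
      obtain ⟨q, hq⟩ := hpd
      obtain ⟨k, hk⟩ := hpo
      obtain ⟨l, hl⟩ := hev
      have hk1 : 1 ≤ k := by omega
      have hq8 : q * 3 ≤ 8 := by nlinarith
      have : q = 0 ∨ q = 1 ∨ q = 2 := by omega
      rcases this with rfl | rfl | rfl <;> omega
    obtain ⟨e⟩ := equiv6 h6
    obtain ⟨S, hS, s1, s2, s3⟩ := claim6 (e.symm a) (e.symm s) m (by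
      simp only [List.mem_cons, List.not_mem_nil, or_false]; omega)
    have hsum : a + ∑ x ∈ S.map e.toEquiv.toEmbedding, x = e (e.symm a + ∑ x ∈ S, x) := by
      rw [Finset.sum_map, map_add, map_sum]; simp
    refine ⟨S.map e.toEquiv.toEmbedding, ?_, ?_, ?_, ?_⟩
    · intro h
      obtain ⟨x, hx, hxa⟩ := Finset.mem_map.1 h
      apply s1
      rw [← hxa]; simpa using hx
    · rw [Finset.card_map]; exact (Finset.mem_powersetCard.1 hS).2
    · rw [hsum]; intro h
      obtain ⟨x, hx, hxa⟩ := Finset.mem_map.1 h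
      have : x = e.symm a + ∑ x ∈ S, x := e.injective hxa
      exact s2 (this ▸ hx)
    · rw [hsum]; intro h
      apply s3; rw [← h]; simp

lemma tree_par {V : Type} [Fintype V] (T : SimpleGraph V) (hT : T.IsTree) (r : V) :
    ∃ par : V → V, (∀ x, x ≠ r → T.Adj x (par x) ∧ T.dist r (par x) < T.dist r x) ∧
      (∀ x y, T.Adj x y → T.dist r y < T.dist r x → y = par x) := by
  classical
  have hp : ∀ x, ∃ p : T.Walk r x, p.IsPath ∧ p.length = T.dist r x :=
    fun x => (hT.connected r x).exists_path_of_dist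
  choose p hp1 hp2 using hp
  refine ⟨fun x => (p x).penultimate, ?_, ?_⟩
  · intro x hx
    have hnn : ¬ (p x).Nil := fun h => hx h.eq.symm
    refine ⟨((p x).adj_penultimate hnn).symm, ?_⟩
    show T.dist r (p x).penultimate < T.dist r x
    have h1 := T.dist_le (p x).dropLast
    have h2 := (p x).length_dropLast_add_one hnn
    have := hp2 x
    omega
  · intro x y hxy hlt
    have hd := hT.dist_eq_dist_add_one_of_adj r hxy
    have hl : ((p y).concat hxy.symm).length = T.dist r x := by
      rw [SimpleGraph.Walk.length_concat, hp2 y]; omega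
    have hpath := SimpleGraph.Walk.isPath_of_length_eq_dist _ hl
    have := (hT.existsUnique_path r x).unique hpath (hp1 x)
    show y = (p x).penultimate
    rw [← this, SimpleGraph.Walk.penultimate_concat]

lemma rec_exists {V B : Type} (par : V → V) (r : V) (rk : V → ℕ)
    (h : ∀ x, x ≠ r → rk (par x) < rk x) (b0 : B) (Φ : V → B → B) :
    ∃ st : V → B, st r = b0 ∧ ∀ x, x ≠ r → st x = Φ x (st (par x)) := by
  classical
  let F : (x : V) → ((y : V) → rk y < rk x → B) → B := fun x rec =>
    if hx : x = r then b0 else Φ x (rec (par x) (h x hx))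
  let wf : WellFounded (fun x y : V => rk x < rk y) := InvImage.wf rk Nat.lt_wfRel.wf
  refine ⟨wf.fix F, ?_, ?_⟩
  · rw [wf.fix_eq]; simp [F]
  · intro x hx
    rw [wf.fix_eq]; simp [F, hx]

lemma exists_labels {V A : Type} [DecidableEq A] [AddCommGroup A] (C : Finset V) (S : Finset A)
    (h : S.card = C.card) : ∃ g : V → A, Set.InjOn g C ∧ (∀ x ∈ C, g x ∈ S) ∧
      ∑ x ∈ C, g x = ∑ y ∈ S, y := by
  classical
  let e := Finset.equivOfCardEq h.symm
  let g : V → A := fun x => if hx : x ∈ C then (e ⟨x, hx⟩ : A) else 0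
  have hin : Set.InjOn g C := by
    intro x hx y hy hxy
    have hx' : x ∈ C := hx
    have hy' : y ∈ C := hy
    simp only [g, hx', hy', dif_pos] at hxy
    have := e.injective (Subtype.ext hxy)
    simpa using this
  have hS : ∀ x ∈ C, g x ∈ S := by
    intro x hx
    simp only [g, hx, dif_pos]
    exact (e ⟨x, hx⟩).2
  refine ⟨g, hin, hS, ?_⟩
  have : C.image g = S := by
    apply Finset.eq_of_subset_of_card_le
    · intro y hy
      obtain ⟨x, hx, rfl⟩ := Finset.mem_image.1 hy
      exact hS x hx
    · rw [Finset.card_image_of_injOn hin, h]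
  rw [← this, Finset.sum_image hin]

lemma coloring_exists {V : Type} [Fintype V] (T : SimpleGraph V)
    [DecidableRel T.Adj] (hT : T.IsTree)
    (h4 : 4 ≤ T.maxDegree)
    (hdeg2 : ∀ v : V, T.degree v = 2 → ∃ u : V, T.Adj v u ∧ T.degree u = 2)
    {A : Type} [AddCommGroup A] [Fintype A] (hA : Fintype.card A = T.maxDegree + 2)
    (hcl : ∀ (a s : A) (m : ℕ), 2 ≤ m → m + 3 ≤ Fintype.card A →
      ∃ S : Finset A, a ∉ S ∧ S.card = m ∧ a + ∑ x ∈ S, x ∉ S ∧ a + ∑ x ∈ S, x ≠ s) :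
    ∃ f : Sym2 V → A, IsTwinEdgeColoring T f := by
  classical
  have : Nonempty V := hT.connected.nonempty
  obtain ⟨r, hr⟩ := T.exists_maximal_degree_vertex
  obtain ⟨par, hpar, huniq⟩ := tree_par T hT r
  set rk : V → ℕ := fun x => T.dist r x with hrk
  let Ch : V → Finset V := fun v => univ.filter (fun x => x ≠ r ∧ par x = v)
  have memCh : ∀ v x, x ∈ Ch v ↔ x ≠ r ∧ par x = v := by intro v x; simp [Ch]
  have chadj : ∀ v x, x ∈ Ch v → T.Adj v x ∧ rk v < rk x := by
    intro v x hx
    obtain ⟨h1, rfl⟩ := (memCh v x).1 hx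
    exact ⟨(hpar x h1).1.symm, (hpar x h1).2⟩
  have adjcase : ∀ v x, T.Adj v x → (v ≠ r ∧ x = par v) ∨ x ∈ Ch v := by
    intro v x hvx
    rcases Nat.lt_or_ge (rk x) (rk v) with h | h
    · left
      refine ⟨?_, huniq v x hvx h⟩
      rintro rfl
      simp [hrk] at h
    · right
      have hlt : rk v < rk x := lt_of_le_of_ne h (hT.dist_ne_of_adj r hvx)
      refine (memCh v x).2 ⟨?_, (huniq x v hvx.symm hlt).symm⟩
      rintro rfl
      simp [hrk] at hlt
  have pnot : ∀ v, v ≠ r → par v ∉ Ch v := by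
    intro v hv h
    have h1 := (chadj _ _ h).2
    have h2 := (hpar v hv).2
    simp only [hrk] at h1
    omega
  have nbr : ∀ v, v ≠ r → T.neighborFinset v = insert (par v) (Ch v) := by
    intro v hv
    ext x
    rw [T.mem_neighborFinset, Finset.mem_insert]
    constructor
    · intro h
      rcases adjcase v x h with h | h
      · exact Or.inl h.2
      · exact Or.inr h
    · rintro (rfl | h)
      · exact (hpar v hv).1
      · exact (chadj _ _ h).1
  have nbrr : T.neighborFinset r = Ch r := by
    ext x
    rw [T.mem_neighborFinset]
    constructor
    · intro h
      rcases adjcase r x h with h | h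
      · exact absurd rfl h.1
      · exact h
    · intro h
      exact (chadj _ _ h).1
  have cardCh : ∀ v, v ≠ r → (Ch v).card + 1 = T.degree v := by
    intro v hv
    rw [← T.card_neighborFinset_eq_degree, nbr v hv, Finset.card_insert_of_notMem (pnot v hv)]
  have cardr : (Ch r).card = T.degree r := by
    rw [← T.card_neighborFinset_eq_degree, nbrr]
  let Inv : V → A × A → Prop := fun x q =>
    (T.degree x = 1 → q.1 ≠ q.2) ∧ (T.degree x = 2 → T.degree (par x) = 2 → q.1 ≠ 0)
  let Good : V → A × A → (V → A) → Prop := fun v q g =>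
    Set.InjOn g (Ch v) ∧ (∀ x ∈ Ch v, g x ≠ q.1) ∧ q.1 + ∑ x ∈ Ch v, g x ≠ q.2 ∧
      ∀ x ∈ Ch v, Inv x (g x, q.1 + ∑ x ∈ Ch v, g x)
  have step : ∀ v, v ≠ r → ∀ q, ∃ g : V → A, Inv v q → Good v q g := by
    rintro v hv ⟨a, s⟩
    by_cases hI : Inv v (a, s)
    swap
    · exact ⟨0, fun h => absurd h hI⟩
    have hc := cardCh v hv
    have hmax := T.degree_le_maxDegree v
    rcases Nat.lt_or_ge (T.degree v) 3 with hd | hd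
    · rcases Nat.lt_or_ge (T.degree v) 2 with hd1 | hd2
      · have he : Ch v = ∅ := Finset.card_eq_zero.1 (by omega)
        refine ⟨0, fun _ => ?_⟩
        simp only [Good, he]
        refine ⟨by simp, by simp, ?_, by simp⟩
        simpa using hI.1 (by omega)
      · have hd : T.degree v = 2 := by omega
        obtain ⟨x, hx⟩ := Finset.card_eq_one.1 (show (Ch v).card = 1 by omega)
        obtain ⟨b, hb⟩ := exists_not_mem_fin ({a, s - a, 0} : Finset A) (by
          have : ({a, s - a, 0} : Finset A).card ≤ 3 := Finset.card_le_three
          omega)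
        simp only [mem_insert, mem_singleton, not_or] at hb
        obtain ⟨b1, b2, b3⟩ := hb
        refine ⟨fun _ => b, fun _ => ?_⟩
        simp only [Good, hx, Finset.sum_singleton, Finset.mem_singleton, forall_eq]
        refine ⟨by simp, b1, fun h => b2 (by rw [← h]; abel), ?_, fun _ _ => b3⟩
        intro hx1 hab
        have ha0 : a ≠ 0 := by
          apply hI.2 hd
          obtain ⟨u, hu, hu2⟩ := hdeg2 v hd
          rcases adjcase v u hu with h | h
          · rw [← h.2]; exact hu2
          · rw [hx, Finset.mem_singleton] at h
            rw [h] at hu2; omega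
        apply ha0
        simpa using hab
    · obtain ⟨S, s1, s2, s3, s4⟩ := hcl a s (T.degree v - 1) (by omega) (by omega)
      obtain ⟨g, g1, g2, g3⟩ := exists_labels (Ch v) S (by omega)
      refine ⟨g, fun _ => ⟨g1, ?_, ?_, ?_⟩⟩
      · intro x hx h
        have h' : g x = a := h
        exact s1 (h' ▸ g2 x hx)
      · simp only [g3]; exact s4
      · intro x hx
        refine ⟨fun _ h => ?_, fun _ h => ?_⟩
        · simp only [g3] at h
          exact s3 (h ▸ g2 x hx)
        · rw [((memCh v x).1 hx).2] at h; omega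
  obtain ⟨g0, r1, r2⟩ : ∃ g : V → A, Set.InjOn g (Ch r) ∧
      ∀ x ∈ Ch r, Inv x (g x, ∑ x ∈ Ch r, g x) := by
    obtain ⟨S, s1, s2, s3, s4⟩ := hcl 0 0 (T.degree r - 1) (by omega) (by omega)
    obtain ⟨g, g1, g2, g3⟩ := exists_labels (Ch r) (insert 0 S) (by
      rw [Finset.card_insert_of_notMem s1]; omega)
    rw [Finset.sum_insert s1] at g3
    refine ⟨g, g1, fun x hx => ⟨fun _ h => ?_, fun _ h => ?_⟩⟩
    · simp only [g3] at h
      have := g2 x hx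
      rw [h, Finset.mem_insert] at this
      rcases this with h | h
      · exact s4 h
      · exact s3 h
    · rw [((memCh r x).1 hx).2] at h; omega
  choose! G hG using step
  -- labels and weights, computed top-down
  let lab : V → A × A → V → A := fun v q => if v = r then g0 else G v q
  obtain ⟨st, st0, st1⟩ := rec_exists par r rk (fun x hx => (hpar x hx).2) ((0 : A), (0 : A))
    (fun x q => (lab (par x) q x, q.1 + ∑ y ∈ Ch (par x), lab (par x) q y))
  have stCh : ∀ v x, x ∈ Ch v →
      st x = (lab v (st v) x, (st v).1 + ∑ y ∈ Ch v, lab v (st v) y) := by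
    intro v x hx
    obtain ⟨h1, rfl⟩ := (memCh v x).1 hx
    exact st1 x h1
  let c : V → A := fun x => (st x).1
  have csum : ∀ v, ∑ x ∈ Ch v, c x = ∑ y ∈ Ch v, lab v (st v) y := by
    intro v
    apply Finset.sum_congr rfl
    intro x hx
    simp only [c, stCh v x hx]
  let W : V → A := fun v => c v + ∑ x ∈ Ch v, c x
  have stW : ∀ v x, x ∈ Ch v → (st x).2 = W v := by
    intro v x hx
    simp only [W, csum v, stCh v x hx, c]
  have hInv : ∀ n x, rk x = n → x ≠ r → Inv x (st x) := by
    intro n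
    induction n using Nat.strong_induction_on with
    | _ n ih =>
      intro x hxn hx
      have hm : x ∈ Ch (par x) := (memCh _ _).2 ⟨hx, rfl⟩
      by_cases hp : par x = r
      · rw [hp] at hm
        have := r2 x hm
        rw [stCh r x hm]
        simpa [lab, st0] using this
      · have h1 := ih _ (hxn ▸ (hpar x hx).2) (par x) rfl hp
        have h2 := (hG (par x) hp (st (par x)) h1).2.2.2 x hm
        rw [stCh _ x hm]
        simpa [lab, hp] using h2
  have cinj : ∀ v, Set.InjOn c (Ch v) := by
    intro v x hx y hy hxy
    simp only [c, stCh v x hx, stCh v y hy] at hxy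
    by_cases hv : v = r
    · subst hv
      simp only [lab, if_true] at hxy
      exact r1 hx hy hxy
    · simp only [lab, if_neg hv] at hxy
      exact (hG v hv (st v) (hInv _ v rfl hv)).1 hx hy hxy
  have cpar : ∀ v, v ≠ r → ∀ x ∈ Ch v, c x ≠ c v := by
    intro v hv x hx
    have := (hG v hv (st v) (hInv _ v rfl hv)).2.1 x hx
    simpa [c, stCh v x hx, lab, hv] using this
  have hW : ∀ v, v ≠ r → W v ≠ W (par v) := by
    intro v hv
    rw [← stW (par v) v ((memCh _ _).2 ⟨hv, rfl⟩)]
    have := (hG v hv (st v) (hInv _ v rfl hv)).2.2.1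
    simp only [W, csum v]
    simpa [lab, hv] using this
  -- the edge labelling
  let F : V → V → A := fun x y => if rk y < rk x then c x else if rk x < rk y then c y else 0
  have Fsymm : ∀ x y, F x y = F y x := by
    intro x y
    simp only [F]
    split_ifs <;> first | rfl | omega
  let f : Sym2 V → A := Sym2.lift ⟨F, Fsymm⟩
  have fpar : ∀ v, v ≠ r → f s(v, par v) = c v := by
    intro v hv
    show F v (par v) = c v
    exact if_pos (hpar v hv).2
  have fCh : ∀ v x, x ∈ Ch v → f s(x, v) = c x := by
    intro v x hx
    obtain ⟨h1, rfl⟩ := (memCh v x).1 hx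
    exact fpar x h1
  have fsum : ∀ v, ∑ x ∈ T.neighborFinset v, f s(x, v) = W v := by
    intro v
    by_cases hv : v = r
    · subst hv
      rw [nbrr, Finset.sum_congr rfl (fCh v)]
      simp [W, c, st0]
    · rw [nbr v hv, Finset.sum_insert (pnot v hv), Finset.sum_congr rfl (fCh v), Sym2.eq_swap,
        fpar v hv]
  refine ⟨f, ?_, ?_⟩
  · intro u v w huv huw hvw
    rcases adjcase u v huv with ⟨hu, rfl⟩ | hv <;> rcases adjcase u w huw with ⟨hu', rfl⟩ | hw
    · exact absurd rfl hvw
    · rw [fpar u hu, Sym2.eq_swap, fCh u w hw]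
      exact (cpar u hu w hw).symm
    · rw [fpar u hu', Sym2.eq_swap, fCh u v hv]
      exact cpar u hu' v hv
    · rw [Sym2.eq_swap, fCh u v hv, Sym2.eq_swap, fCh u w hw]
      exact fun h => hvw (cinj u hv hw h)
  · intro u v huv
    rw [fsum, fsum]
    rcases adjcase u v huv with ⟨hu, rfl⟩ | hv
    · exact hW u hu
    · obtain ⟨h1, rfl⟩ := (memCh u v).1 hv
      exact (hW v h1).symm

/-- Let `T` be a tree of order at least `3` with even maximum degree such that every
vertex of degree `2` has at least one neighbor of degree `2`.  If `Δ(T) ≠ 2^p - 2` for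
every integer `p`, then `χ'_g(T) ≤ Δ(T) + 2`. -/
theorem tree_groupTwinChromaticIndex_le_of_even {V : Type} [Fintype V] (T : SimpleGraph V)
    [DecidableRel T.Adj] (hT : T.IsTree) (hcard : 3 ≤ Fintype.card V)
    (heven : Even T.maxDegree)
    (hdeg2 : ∀ v : V, T.degree v = 2 → ∃ u : V, T.Adj v u ∧ T.degree u = 2)
    (hΔ : ∀ p : ℕ, T.maxDegree ≠ 2 ^ p - 2) :
    ∃ k ∈ TwinSet T, k ≤ T.maxDegree + 2 := by
  refine ⟨T.maxDegree + 2, ⟨by omega, ?_⟩, le_refl _⟩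
  intro A _ _ hA
  classical
  have h4 : 4 ≤ T.maxDegree := by
    have e1 : T.maxDegree ≠ 0 := hΔ 1
    have e2 : T.maxDegree ≠ 2 := hΔ 2
    obtain ⟨l, hl⟩ := heven
    omega
  obtain ⟨k, hk⟩ | ⟨p, hp, hpd, hpo⟩ := (T.maxDegree + 2).eq_two_pow_or_exists_odd_prime_and_dvd
  · exact (hΔ k (by omega)).elim
  · refine coloring_exists T hT h4 hdeg2 hA ?_
    intro a s m hm hm'
    exact claim p hp hpo (hA ▸ hpd) (hA ▸ heven.add (by decide)) a s m hm hm'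
end
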